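/- Let D be drawn from the full-plane smooth phase P_a, a in (0,1), with height function h_D. There exist constants c_a, d_a > 0 such that: (i) for every face f and all m > 0, P(|h_D(f)| > m) <= 2 exp(-d_a m^2); (ii) for any two faces f, f', Cov(h_D(f), h_D(f')) <= c_a exp(-d_a ||f - f'||_infinity). -/

import Mathlib

/-!
STATEMENT 12: Under the full-plane smooth phase `P_a`, `a ∈ (0,1)` (the local limit of
the two-periodic Aztec diamond measures), with the height function anchored at infinity,
there exist constants `c_a, d_a > 0` such that (i) `P(|h_D(f)| > m) ≤ 2 exp(-d_a m²)`
for every face `f` and all `m > 0`, and (ii)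
`Cov(h_D(f), h_D(f')) ≤ c_a exp(-d_a ‖f - f'‖_∞)` for any two faces `f, f'`.
-/

open scoped Classical

noncomputable section

def diagDirs : Set (ℤ × ℤ) := {(1, 1), (1, -1), (-1, 1), (-1, -1)}
def WhiteV (v : ℤ × ℤ) : Prop := Odd v.1 ∧ Even v.2
def BlackV (v : ℤ × ℤ) : Prop := Even v.1 ∧ Odd v.2

/-- A perfect matching of the full-plane square lattice (rotated 45°), recorded as a
set of (white, black) matched pairs. -/
def IsFullMatching (M : Set ((ℤ × ℤ) × (ℤ × ℤ))) : Prop :=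
  (∀ p ∈ M, WhiteV p.1 ∧ (p.2 - p.1) ∈ diagDirs) ∧
  (∀ v, WhiteV v → ∃! b, (v, b) ∈ M) ∧
  (∀ b, BlackV b → ∃! v, (v, b) ∈ M)

def covered (M : Set ((ℤ × ℤ) × (ℤ × ℤ))) (v w : ℤ × ℤ) : Prop :=
  (v, w) ∈ M ∨ (w, v) ∈ M

def stepVal (M : Set ((ℤ × ℤ) × (ℤ × ℤ))) (v w : ℤ × ℤ) : ℤ :=
  if covered M v w then -3 else 1

def WhiteRules (M : Set ((ℤ × ℤ) × (ℤ × ℤ))) (h : ℤ × ℤ → ℤ) (c : ℤ × ℤ) : Prop :=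
  h (c + (0, 1)) = h (c + (1, 0)) + stepVal M c (c + (1, 1)) ∧
  h (c + (-1, 0)) = h (c + (0, 1)) + stepVal M c (c + (-1, 1)) ∧
  h (c + (0, -1)) = h (c + (-1, 0)) + stepVal M c (c + (-1, -1)) ∧
  h (c + (1, 0)) = h (c + (0, -1)) + stepVal M c (c + (1, -1))

def BlackRules (M : Set ((ℤ × ℤ) × (ℤ × ℤ))) (h : ℤ × ℤ → ℤ) (c : ℤ × ℤ) : Prop :=
  h (c + (0, -1)) = h (c + (1, 0)) + stepVal M c (c + (1, -1)) ∧
  h (c + (-1, 0)) = h (c + (0, -1)) + stepVal M c (c + (-1, -1)) ∧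
  h (c + (0, 1)) = h (c + (-1, 0)) + stepVal M c (c + (-1, 1)) ∧
  h (c + (1, 0)) = h (c + (0, 1)) + stepVal M c (c + (1, 1))

/-- A full-plane height function for the matching `M` (defined up to a global shift). -/
def IsFullHeight (M : Set ((ℤ × ℤ) × (ℤ × ℤ))) (h : ℤ × ℤ → ℤ) : Prop :=
  (∀ c, WhiteV c → WhiteRules M h c) ∧ (∀ c, BlackV c → BlackRules M h c)

/-- `a`-faces. -/
def aFaceP (f : ℤ × ℤ) : Prop := Odd f.1 ∧ Odd f.2 ∧ (4 : ℤ) ∣ (f.1 + f.2 - 2)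

/-- The south Temperleyan forest path of `M` started at `v₀`: each step goes from a
vertex `v` to `v + 2e` where `{v, v+e}` is the dimer covering `v`. -/
def IsForestPath (M : Set ((ℤ × ℤ) × (ℤ × ℤ))) (v0 : ℤ × ℤ) (P : ℕ → ℤ × ℤ) : Prop :=
  P 0 = v0 ∧ ∀ i, ∃ e ∈ diagDirs, (P i, P i + e) ∈ M ∧ P (i + 1) = P i + e + e

/-- The counterclockwise winding number of the path `p` about the base point `b`:
right-to-left crossings minus left-to-right crossings of the upward vertical ray
from `b`. -/
def windPath (p : ℕ → ℤ × ℤ) (b : ℤ × ℤ) : ℤ :=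
  ({i : ℕ | (p (i + 1)).1 = b.1 ∧ b.2 < (p (i + 1)).2 ∧
      b.1 < (p i).1 ∧ (p (i + 2)).1 < b.1}.ncard : ℤ)
  - ({i : ℕ | (p (i + 1)).1 = b.1 ∧ b.2 < (p (i + 1)).2 ∧
      (p i).1 < b.1 ∧ b.1 < (p (i + 2)).1}.ncard : ℤ)

/-- The height `h` is anchored at infinity. -/
def AnchoredAtInfinity (M : Set ((ℤ × ℤ) × (ℤ × ℤ))) (h : ℤ × ℤ → ℤ) : Prop :=
  ∀ f, aFaceP f → ∀ P : ℕ → ℤ × ℤ, IsForestPath M (f - (0, 1)) P →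
    h f = -4 * windPath P (f - (0, 1))

def inBox (n : ℤ) (v : ℤ × ℤ) : Prop := |v.1| ≤ n ∧ |v.2| ≤ n

/-- A dimer configuration of the Aztec diamond of size `n`. -/
def IsAztecMatching (n : ℤ) (M : Set ((ℤ × ℤ) × (ℤ × ℤ))) : Prop :=
  (∀ p ∈ M, WhiteV p.1 ∧ (p.2 - p.1) ∈ diagDirs ∧ inBox n p.1 ∧ inBox n p.2) ∧
  (∀ v, WhiteV v → inBox n v → ∃! b, (v, b) ∈ M) ∧
  (∀ b, BlackV b → inBox n b → ∃! v, (v, b) ∈ M)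

/-- Two-periodic edge weights: weight `a` on edges incident to an `a`-face, else `1`. -/
def edgeWeight (a : ℝ) (p : (ℤ × ℤ) × (ℤ × ℤ)) : ℝ :=
  if aFaceP (p.1.1, p.2.2) ∨ aFaceP (p.2.1, p.1.2) then a else 1

/-- The weight of a configuration. -/
def configWeight (a : ℝ) (M : Set ((ℤ × ℤ) × (ℤ × ℤ))) : ℝ :=
  ∏ᶠ p ∈ M, edgeWeight a p

/-- The partition function of the two-periodic Aztec diamond of size `n`. -/
def aztecZ (a : ℝ) (n : ℤ) : ℝ :=
  ∑ᶠ M ∈ {M : Set ((ℤ × ℤ) × (ℤ × ℤ)) | IsAztecMatching n M}, configWeight a M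

/-- The probability, under the two-periodic Aztec diamond measure of size `n`, that all
edges of `E` are covered by dimers. -/
def aztecCylProb (a : ℝ) (n : ℤ) (E : Finset ((ℤ × ℤ) × (ℤ × ℤ))) : ℝ :=
  (∑ᶠ M ∈ {M : Set ((ℤ × ℤ) × (ℤ × ℤ)) | IsAztecMatching n M ∧ ∀ e ∈ E, e ∈ M},
    configWeight a M) / aztecZ a n

/-! ### Directions, Kasteleyn signs and weights -/

/-- The sign encoded by a Boolean. -/
def sg (b : Bool) : ℤ := if b then 1 else -1

/-- The diagonal unit vector encoded by two Booleans. -/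
def dv (d : Bool × Bool) : ℤ × ℤ := (sg d.1, sg d.2)

/-- The product of the two signs of a direction. -/
def ds (d : Bool × Bool) : ℝ := if d.1 = d.2 then 1 else -1

/-- The class of vertices whose north edges are incident to an `a`-face. -/
def northA (v : ℤ × ℤ) : Prop := (4 : ℤ) ∣ v.1 + v.2 - 1

/-- The weight of the edge leaving `v` in direction `d`. -/
def wt (a : ℝ) (v : ℤ × ℤ) (d : Bool × Bool) : ℝ := if (northA v ↔ d.2 = true) then a else 1

/-- A Kasteleyn sign: only south-west edges are negative. -/
def ks (d : Bool × Bool) : ℝ := if d = (false, false) then -1 else 1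

/-- Kasteleyn coefficients. -/
def kc (a : ℝ) (v : ℤ × ℤ) (d : Bool × Bool) : ℝ := ks d * wt a v d

/-- The Kasteleyn operator from functions on black vertices to functions on white vertices. -/
def latK (a : ℝ) (F : ℤ × ℤ → ℝ) (v : ℤ × ℤ) : ℝ := ∑ d, kc a v d * F (v + dv d)

/-- The transpose of the Kasteleyn operator. -/
def adjK (a : ℝ) (f : ℤ × ℤ → ℝ) (b : ℤ × ℤ) : ℝ := ∑ d, kc a (b - dv d) d * f (b - dv d)

lemma sum_dirs {M : Type*} [AddCommMonoid M] (f : Bool × Bool → M) :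
    ∑ d, f d = f (true, true) + f (true, false) + (f (false, true) + f (false, false)) := by
  simp [Fintype.sum_prod_type]

lemma northA_shift {v : ℤ × ℤ} (hv : WhiteV v) (d d' : Bool × Bool) :
    northA (v + dv d - dv d') ↔ (northA v ↔ (d.1 = d'.1 ↔ d.2 = d'.2)) := by
  obtain ⟨⟨x, hx⟩, ⟨y, hy⟩⟩ := hv
  obtain ⟨d1, d2⟩ := d
  obtain ⟨e1, e2⟩ := d'
  unfold northA dv
  cases d1 <;> cases d2 <;> cases e1 <;> cases e2 <;> simp [sg] <;> omega

lemma northA_shift' {b : ℤ × ℤ} (hb : BlackV b) (d d' : Bool × Bool) :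
    northA (b - dv d') ↔ (northA (b - dv d) ↔ (d.1 = d'.1 ↔ d.2 = d'.2)) := by
  obtain ⟨⟨x, hx⟩, ⟨y, hy⟩⟩ := hb
  obtain ⟨d1, d2⟩ := d
  obtain ⟨e1, e2⟩ := d'
  unfold northA dv
  cases d1 <;> cases d2 <;> cases e1 <;> cases e2 <;> simp [sg] <;> omega

theorem latK_adjK (a : ℝ) (f : ℤ × ℤ → ℝ) {v : ℤ × ℤ} (hv : WhiteV v) :
    latK a (adjK a f) v = 2 * (1 + a ^ 2) * f v - a * ∑ d, ds d * f (v + 2 • dv d) := by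
  have h := northA_shift hv
  obtain ⟨x, y⟩ := v
  simp only [latK, adjK, kc, wt, h]
  by_cases hc : northA (x, y)
  all_goals
    simp only [sum_dirs, hc]
    simp [ks, ds, dv, sg]
    ring_nf

theorem adjK_latK (a : ℝ) (f : ℤ × ℤ → ℝ) {b : ℤ × ℤ} (hb : BlackV b) :
    adjK a (latK a f) b = 2 * (1 + a ^ 2) * f b - a * ∑ d, ds d * f (b + 2 • dv d) := by
  have h := northA_shift' hb (true, true)
  obtain ⟨x, y⟩ := b
  by_cases hc : northA ((x, y) - dv (true, true))
  all_goals
    simp only [hc] at h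
    simp only [latK, adjK, kc, wt, h, sum_dirs]
    simp [ks, ds, dv, sg]
    ring_nf

/-! ### One-dimensional walk kernels -/

/-- Step-two walk kernels on `ℤ`, left steps carrying the factor `s`. -/
def wk (s : ℝ) : ℕ → ℤ → ℝ
  | 0, x => if x = 0 then 1 else 0
  | k + 1, x => wk s k (x - 2) + s * wk s k (x + 2)

lemma wk_eq_zero_of_abs (s : ℝ) (k : ℕ) (x : ℤ) (h : 2 * (k : ℤ) < |x|) : wk s k x = 0 := by
  induction k generalizing x with
  | zero => simp only [wk]; rw [if_neg]; rintro rfl; simp at h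
  | succ k ih =>
    simp only [wk]
    push_cast at h
    rw [ih, ih, mul_zero, add_zero] <;> grind

lemma wk_eq_zero_of_not_dvd (s : ℝ) (k : ℕ) (x : ℤ) (h : ¬ (4 : ℤ) ∣ 2 * k - x) :
    wk s k x = 0 := by
  induction k generalizing x with
  | zero => simp only [wk]; rw [if_neg]; rintro rfl; simp at h
  | succ k ih =>
    simp only [wk]
    push_cast at h
    rw [ih, ih, mul_zero, add_zero] <;> omega

lemma wk_one_nonneg (k : ℕ) (x : ℤ) : 0 ≤ wk 1 k x := by
  induction k generalizing x with
  | zero => simp only [wk]; split_ifs <;> norm_num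
  | succ k ih => simp only [wk]; linarith [ih (x - 2), ih (x + 2)]

lemma wk_neg (s : ℝ) (hs : s * s = 1) (k : ℕ) (x : ℤ) : wk s k (-x) = s ^ k * wk s k x := by
  induction k generalizing x with
  | zero => simp [wk]
  | succ k ih =>
    simp only [wk]
    have h1 : -x - 2 = -(x + 2) := by ring
    have h2 : -x + 2 = -(x - 2) := by ring
    rw [h1, h2, ih, ih, pow_succ]
    linear_combination (-(s ^ k) * wk s k (x + 2)) * hs

lemma wk_neg_one (k : ℕ) (x : ℤ) :
    wk (-1) k x = (Int.negOnePow ((2 * k - x) / 4) : ℤ) * wk 1 k x := by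
  induction k generalizing x with
  | zero => simp only [wk]; split_ifs with h <;> simp [h]
  | succ k ih =>
    by_cases h : (4 : ℤ) ∣ 2 * ((k + 1 : ℕ) : ℤ) - x
    · obtain ⟨t, ht⟩ := h
      simp only [wk]
      push_cast at ht ⊢
      have h1 : (2 * (k : ℤ) - (x - 2)) / 4 = t := by omega
      have h2 : (2 * (k : ℤ) - (x + 2)) / 4 = t - 1 := by omega
      have h3 : (2 * ((k : ℤ) + 1) - x) / 4 = t := by omega
      rw [ih, ih, h1, h2, h3, Int.negOnePow_sub, Int.negOnePow_one]
      push_cast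
      ring
    · rw [wk_eq_zero_of_not_dvd _ _ _ h, wk_eq_zero_of_not_dvd _ _ _ h, mul_zero]

lemma wk_one_le (k : ℕ) (x : ℤ) : wk 1 k x ≤ 2 ^ k := by
  induction k generalizing x with
  | zero => simp only [wk]; split_ifs <;> norm_num
  | succ k ih => simp only [wk, pow_succ]; linarith [ih (x - 2), ih (x + 2)]

lemma abs_wk_neg_one (k : ℕ) (x : ℤ) : |wk (-1) k x| = wk 1 k x := by
  rw [wk_neg_one, abs_mul, abs_of_nonneg (wk_one_nonneg k x)]
  rcases Int.units_eq_one_or (Int.negOnePow ((2 * k - x) / 4)) with h | h <;> simp [h]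

/-! ### Planar kernels -/

/-- The diagonal walk kernel with `k` steps. -/
def pk (s : ℝ) (k : ℕ) (v : ℤ × ℤ) : ℝ := wk s k v.1 * wk s k v.2

lemma pk_neg_one_succ (k : ℕ) (v : ℤ × ℤ) :
    ∑ d, ds d * pk (-1) k (v + 2 • dv d) = pk (-1) (k + 1) v := by
  simp [sum_dirs, ds, dv, sg, pk, wk]
  ring_nf

lemma pk_one_succ (k : ℕ) (v : ℤ × ℤ) :
    ∑ d, pk 1 k (v + 2 • dv d) = pk 1 (k + 1) v := by
  simp [sum_dirs, dv, sg, pk, wk]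
  ring_nf

lemma pk_zero (s : ℝ) (v : ℤ × ℤ) : pk s 0 v = if v = 0 then 1 else 0 := by
  rcases v with ⟨x, y⟩
  simp only [pk, wk, Prod.mk_eq_zero]
  split_ifs <;> simp_all

lemma pk_neg (s : ℝ) (hs : s * s = 1) (k : ℕ) (v : ℤ × ℤ) : pk s k (-v) = pk s k v := by
  simp only [pk, Prod.fst_neg, Prod.snd_neg, wk_neg s hs]
  have : s ^ k * s ^ k = 1 := by rw [← mul_pow, hs, one_pow]
  linear_combination (wk s k v.1 * wk s k v.2) * this

lemma abs_pk_neg_one (k : ℕ) (v : ℤ × ℤ) : |pk (-1) k v| = pk 1 k v := by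
  rw [pk, abs_mul, abs_wk_neg_one, abs_wk_neg_one, pk]

lemma pk_one_nonneg (k : ℕ) (v : ℤ × ℤ) : 0 ≤ pk 1 k v :=
  mul_nonneg (wk_one_nonneg _ _) (wk_one_nonneg _ _)

lemma pk_one_le (k : ℕ) (v : ℤ × ℤ) : pk 1 k v ≤ 4 ^ k := by
  calc pk 1 k v ≤ 2 ^ k * 2 ^ k :=
        mul_le_mul (wk_one_le _ _) (wk_one_le _ _) (wk_one_nonneg _ _) (by positivity)
    _ = 4 ^ k := by rw [← mul_pow]; norm_num

lemma pk_eq_zero_of_lt (s : ℝ) (k : ℕ) (v : ℤ × ℤ) (h : 2 * (k : ℤ) < max |v.1| |v.2|) :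
    pk s k v = 0 := by
  rcases lt_max_iff.1 h with h | h
  · rw [pk, wk_eq_zero_of_abs _ _ _ h, zero_mul]
  · rw [pk, wk_eq_zero_of_abs _ _ _ h, mul_zero]

/-- The sublattice carrying the planar kernels. -/
def inLam (v : ℤ × ℤ) : Prop := (2 : ℤ) ∣ v.1 ∧ (4 : ℤ) ∣ v.1 - v.2

lemma pk_eq_zero_of_not_inLam (s : ℝ) (k : ℕ) (v : ℤ × ℤ) (h : ¬ inLam v) : pk s k v = 0 := by
  by_contra hne
  rw [pk, mul_eq_zero, not_or] at hne
  have h1 : (4 : ℤ) ∣ 2 * k - v.1 := by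
    by_contra hh; exact hne.1 (wk_eq_zero_of_not_dvd _ _ _ hh)
  have h2 : (4 : ℤ) ∣ 2 * k - v.2 := by
    by_contra hh; exact hne.2 (wk_eq_zero_of_not_dvd _ _ _ hh)
  exact h ⟨by omega, by omega⟩

lemma pk_neg_one (k : ℕ) (v : ℤ × ℤ) :
    pk (-1) k v = (Int.negOnePow ((v.1 - v.2) / 4) : ℤ) * pk 1 k v := by
  by_cases h : (4 : ℤ) ∣ 2 * k - v.1 ∧ (4 : ℤ) ∣ 2 * k - v.2
  · obtain ⟨⟨s, hs⟩, ⟨t, ht⟩⟩ := h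
    rw [pk, wk_neg_one, wk_neg_one, pk]
    have h1 : (2 * (k : ℤ) - v.1) / 4 = s := by omega
    have h2 : (2 * (k : ℤ) - v.2) / 4 = t := by omega
    have h3 : (v.1 - v.2) / 4 = t - s := by omega
    rw [h1, h2, h3, Int.negOnePow_sub]
    push_cast
    ring
  · have : ∀ s, pk s k v = 0 := fun s => by
      rw [not_and_or] at h
      rcases h with h | h
      · rw [pk, wk_eq_zero_of_not_dvd _ _ _ h, zero_mul]
      · rw [pk, wk_eq_zero_of_not_dvd _ _ _ h, mul_zero]
    rw [this, this, mul_zero]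

/-! ### Green functions of the diagonal walks -/

/-- Truncated Green function. -/
def gt (s r : ℝ) (L : ℕ) (v : ℤ × ℤ) : ℝ := ∑ k ∈ Finset.range L, r ^ k * pk s k v

/-- Green function. -/
def gr (s r : ℝ) (v : ℤ × ℤ) : ℝ := ∑' k, r ^ k * pk s k v

lemma abs_pk_le {s : ℝ} (hs : s = 1 ∨ s = -1) (k : ℕ) (v : ℤ × ℤ) : |pk s k v| ≤ 4 ^ k := by
  rcases hs with rfl | rfl
  · rw [abs_of_nonneg (pk_one_nonneg k v)]; exact pk_one_le k v
  · rw [abs_pk_neg_one]; exact pk_one_le k v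

lemma abs_gr_term_le {s r : ℝ} (hs : s = 1 ∨ s = -1) (hr : 0 ≤ r) (k : ℕ) (v : ℤ × ℤ) :
    |r ^ k * pk s k v| ≤ (4 * r) ^ k := by
  rw [abs_mul, abs_of_nonneg (by positivity), mul_pow, mul_comm]
  exact mul_le_mul_of_nonneg_right (abs_pk_le hs k v) (by positivity)

lemma summable_gr {s r : ℝ} (hs : s = 1 ∨ s = -1) (hr : 0 ≤ r) (hr' : 4 * r < 1) (v : ℤ × ℤ) :
    Summable fun k => r ^ k * pk s k v :=
  Summable.of_norm_bounded (summable_geometric_of_lt_one (by positivity) hr')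
    (fun k => abs_gr_term_le hs hr k v)

lemma tendsto_gt {s r : ℝ} (hs : s = 1 ∨ s = -1) (hr : 0 ≤ r) (hr' : 4 * r < 1) (v : ℤ × ℤ) :
    Filter.Tendsto (fun L => gt s r L v) Filter.atTop (nhds (gr s r v)) :=
  (summable_gr hs hr hr' v).hasSum.tendsto_sum_nat

lemma abs_gr_sub_gt_le {s r : ℝ} (hs : s = 1 ∨ s = -1) (hr : 0 ≤ r) (hr' : 4 * r < 1) (L : ℕ)
    (v : ℤ × ℤ) : |gr s r v - gt s r L v| ≤ (4 * r) ^ L / (1 - 4 * r) := by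
  have h := (summable_gr hs hr hr' v).sum_add_tsum_nat_add L
  have h2 : gr s r v - gt s r L v = ∑' k, r ^ (k + L) * pk s (k + L) v := by
    rw [gr, gt, ← h]; ring
  rw [h2]
  have hsum : HasSum (fun k => (4 * r) ^ (k + L)) ((4 * r) ^ L / (1 - 4 * r)) := by
    have := (hasSum_geometric_of_lt_one (by positivity : 0 ≤ 4 * r) hr').mul_left ((4 * r) ^ L)
    simpa [pow_add, mul_comm, div_eq_mul_inv] using this
  rw [← Real.norm_eq_abs]
  exact tsum_of_norm_bounded hsum (fun k => abs_gr_term_le hs hr (k + L) v)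

lemma gt_eq_zero (s r : ℝ) (L : ℕ) (v : ℤ × ℤ) (h : 2 * (L : ℤ) - 2 < max |v.1| |v.2|) :
    gt s r L v = 0 := by
  refine Finset.sum_eq_zero fun k hk => ?_
  have := Finset.mem_range.1 hk
  rw [pk_eq_zero_of_lt _ _ _ (by omega), mul_zero]

lemma abs_gr_le_of_dist {s r : ℝ} (hs : s = 1 ∨ s = -1) (hr : 0 ≤ r) (hr' : 4 * r < 1) (L : ℕ)
    (v : ℤ × ℤ) (h : 2 * (L : ℤ) - 2 < max |v.1| |v.2|) :
    |gr s r v| ≤ (4 * r) ^ L / (1 - 4 * r) := by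
  have := abs_gr_sub_gt_le hs hr hr' L v
  rwa [gt_eq_zero s r L v h, sub_zero] at this

lemma gr_eq_zero_of_not_inLam (s r : ℝ) (v : ℤ × ℤ) (h : ¬ inLam v) : gr s r v = 0 := by
  simp [gr, pk_eq_zero_of_not_inLam s _ v h]

lemma gr_neg {s r : ℝ} (hs : s = 1 ∨ s = -1) (v : ℤ × ℤ) : gr s r (-v) = gr s r v := by
  have : s * s = 1 := by rcases hs with rfl | rfl <;> norm_num
  simp only [gr, pk_neg s this]

lemma gt_neg_one_eq (r : ℝ) (L : ℕ) (v : ℤ × ℤ) :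
    gt (-1) r L v - r * ∑ d, ds d * gt (-1) r L (v + 2 • dv d)
      = (if v = 0 then 1 else 0) - r ^ L * pk (-1) L v := by
  induction L with
  | zero => simp [gt, pk_zero]
  | succ L ih =>
    have h : ∀ w, gt (-1) r (L + 1) w = gt (-1) r L w + r ^ L * pk (-1) L w := fun w =>
      Finset.sum_range_succ _ _
    have h2 := pk_neg_one_succ L v
    simp only [h, mul_add, Finset.sum_add_distrib] at ih ⊢
    have h3 : ∑ d, ds d * (r ^ L * pk (-1) L (v + 2 • dv d)) = r ^ L * pk (-1) (L + 1) v := by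
      rw [← h2, Finset.mul_sum]
      exact Finset.sum_congr rfl fun d _ => by ring
    rw [h3]
    linear_combination ih

lemma gt_one_eq (r : ℝ) (L : ℕ) (v : ℤ × ℤ) :
    gt 1 r L v - r * ∑ d, gt 1 r L (v + 2 • dv d)
      = (if v = 0 then 1 else 0) - r ^ L * pk 1 L v := by
  induction L with
  | zero => simp [gt, pk_zero]
  | succ L ih =>
    have h : ∀ w, gt 1 r (L + 1) w = gt 1 r L w + r ^ L * pk 1 L w := fun w =>
      Finset.sum_range_succ _ _
    have h2 := pk_one_succ L v
    simp only [h, Finset.sum_add_distrib] at ih ⊢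
    have h3 : ∑ d, r ^ L * pk 1 L (v + 2 • dv d) = r ^ L * pk 1 (L + 1) v := by
      rw [← h2, Finset.mul_sum]
    rw [h3]
    linear_combination ih

lemma tendsto_pow_mul_pk {s r : ℝ} (hs : s = 1 ∨ s = -1) (hr : 0 ≤ r) (hr' : 4 * r < 1)
    (v : ℤ × ℤ) : Filter.Tendsto (fun L => r ^ L * pk s L v) Filter.atTop (nhds 0) :=
  (summable_gr hs hr hr' v).tendsto_atTop_zero

lemma gr_neg_one_eq {r : ℝ} (hr : 0 ≤ r) (hr' : 4 * r < 1) (v : ℤ × ℤ) :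
    gr (-1) r v - r * ∑ d, ds d * gr (-1) r (v + 2 • dv d) = if v = 0 then 1 else 0 := by
  have ht := tendsto_gt (s := -1) (Or.inr rfl) hr hr'
  have h1 : Filter.Tendsto (fun L => gt (-1) r L v - r * ∑ d, ds d * gt (-1) r L (v + 2 • dv d))
      Filter.atTop (nhds (gr (-1) r v - r * ∑ d, ds d * gr (-1) r (v + 2 • dv d))) :=
    (ht v).sub (Filter.Tendsto.const_mul _ (tendsto_finsetSum _ fun d _ => (ht _).const_mul _))
  simp only [gt_neg_one_eq] at h1
  have h2 := (tendsto_pow_mul_pk (s := -1) (Or.inr rfl) hr hr' v).const_sub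
    (if v = 0 then (1 : ℝ) else 0)
  rw [sub_zero] at h2
  exact tendsto_nhds_unique h1 h2

lemma gr_one_eq {r : ℝ} (hr : 0 ≤ r) (hr' : 4 * r < 1) (v : ℤ × ℤ) :
    gr 1 r v - r * ∑ d, gr 1 r (v + 2 • dv d) = if v = 0 then 1 else 0 := by
  have ht := tendsto_gt (s := 1) (Or.inl rfl) hr hr'
  have h1 : Filter.Tendsto (fun L => gt 1 r L v - r * ∑ d, gt 1 r L (v + 2 • dv d))
      Filter.atTop (nhds (gr 1 r v - r * ∑ d, gr 1 r (v + 2 • dv d))) :=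
    (ht v).sub (Filter.Tendsto.const_mul _ (tendsto_finsetSum _ fun d _ => ht _))
  simp only [gt_one_eq] at h1
  have h2 := (tendsto_pow_mul_pk (s := 1) (Or.inl rfl) hr hr' v).const_sub
    (if v = 0 then (1 : ℝ) else 0)
  rw [sub_zero] at h2
  exact tendsto_nhds_unique h1 h2

lemma gr_neg_one (r : ℝ) (v : ℤ × ℤ) :
    gr (-1) r v = (Int.negOnePow ((v.1 - v.2) / 4) : ℤ) * gr 1 r v := by
  rw [gr, gr, ← tsum_mul_left]
  exact tsum_congr fun k => by rw [pk_neg_one]; ring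

/-! ### The full-plane inverse Kasteleyn kernel -/

/-- The step weight of the walk underlying the inverse Kasteleyn kernel. -/
def kap (a : ℝ) : ℝ := a / (2 * (1 + a ^ 2))

lemma kap_pos {a : ℝ} (ha : a ∈ Set.Ioo (0 : ℝ) 1) : 0 < kap a := by
  have := ha.1; unfold kap; positivity

lemma four_kap_lt {a : ℝ} (ha : a ∈ Set.Ioo (0 : ℝ) 1) : 4 * kap a < 1 := by
  obtain ⟨h0, h1⟩ := ha
  unfold kap
  rw [← mul_div_assoc, div_lt_one (by positivity)]
  nlinarith [sq_nonneg (a - 1), mul_pos h0 h0]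

/-- The inverse Kasteleyn kernel built from the signed Green function. -/
def Ginf (a : ℝ) (b v : ℤ × ℤ) : ℝ :=
  kap a / a * adjK a (fun w => gr (-1) (kap a) (w - v)) b

/-- Its truncation to walks with fewer than `L` steps. -/
def Gtr (a : ℝ) (L : ℕ) (b v : ℤ × ℤ) : ℝ :=
  kap a / a * adjK a (fun w => gt (-1) (kap a) L (w - v)) b

lemma latK_const_mul (a c : ℝ) (F : ℤ × ℤ → ℝ) (v : ℤ × ℤ) :
    latK a (fun b => c * F b) v = c * latK a F v := by
  simp only [latK, Finset.mul_sum]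
  exact Finset.sum_congr rfl fun d _ => by ring

lemma latK_add (a : ℝ) (F G : ℤ × ℤ → ℝ) (v : ℤ × ℤ) :
    latK a (fun b => F b + G b) v = latK a F v + latK a G v := by
  simp only [latK, ← Finset.sum_add_distrib]
  exact Finset.sum_congr rfl fun d _ => by ring

lemma latK_sub (a : ℝ) (F G : ℤ × ℤ → ℝ) (v : ℤ × ℤ) :
    latK a (fun b => F b - G b) v = latK a F v - latK a G v := by
  simp only [latK, ← Finset.sum_sub_distrib]
  exact Finset.sum_congr rfl fun d _ => by ring

lemma kap_scale {a : ℝ} (ha : 0 < a) (x S : ℝ) :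
    kap a / a * (2 * (1 + a ^ 2) * x - a * S) = x - kap a * S := by
  have : (1 + a ^ 2) ≠ 0 := by positivity
  unfold kap
  field_simp

theorem latK_Gtr {a : ℝ} (ha : 0 < a) (L : ℕ) {v' : ℤ × ℤ} (hv' : WhiteV v') (v : ℤ × ℤ) :
    latK a (fun b => Gtr a L b v) v'
      = (if v' = v then 1 else 0) - kap a ^ L * pk (-1) L (v' - v) := by
  unfold Gtr
  rw [latK_const_mul, latK_adjK a _ hv', kap_scale ha]
  have := gt_neg_one_eq (kap a) L (v' - v)
  simp only [sub_eq_zero, sub_add_eq_add_sub] at this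
  exact this

theorem latK_Ginf {a : ℝ} (ha : a ∈ Set.Ioo (0 : ℝ) 1) {v' : ℤ × ℤ} (hv' : WhiteV v')
    (v : ℤ × ℤ) : latK a (fun b => Ginf a b v) v' = if v' = v then 1 else 0 := by
  unfold Ginf
  rw [latK_const_mul, latK_adjK a _ hv', kap_scale ha.1]
  have := gr_neg_one_eq (kap_pos ha).le (four_kap_lt ha) (v' - v)
  simp only [sub_eq_zero, sub_add_eq_add_sub] at this
  exact this

lemma wt_congr (a : ℝ) {v w : ℤ × ℤ} (hv : WhiteV v) (hw : WhiteV w) (h : inLam (v - w))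
    (d : Bool × Bool) : wt a v d = wt a w d := by
  have : northA v ↔ northA w := by
    obtain ⟨⟨x, hx⟩, ⟨y, hy⟩⟩ := hv
    obtain ⟨⟨x', hx'⟩, ⟨y', hy'⟩⟩ := hw
    obtain ⟨h1, h2⟩ := h
    simp only [Prod.fst_sub, Prod.snd_sub] at h1 h2
    unfold northA
    omega
  simp only [wt, this]

lemma whiteV_sub_dv {b : ℤ × ℤ} (hb : BlackV b) (d : Bool × Bool) : WhiteV (b - dv d) := by
  obtain ⟨⟨x, hx⟩, ⟨y, hy⟩⟩ := hb
  obtain ⟨d1, d2⟩ := d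
  unfold WhiteV
  rw [Int.odd_iff, Int.even_iff]
  cases d1 <;> cases d2 <;> simp [dv, sg] <;> omega

lemma blackV_add_dv {b : ℤ × ℤ} (hb : WhiteV b) (d : Bool × Bool) : BlackV (b + dv d) := by
  obtain ⟨⟨x, hx⟩, ⟨y, hy⟩⟩ := hb
  obtain ⟨d1, d2⟩ := d
  unfold BlackV
  rw [Int.odd_iff, Int.even_iff]
  cases d1 <;> cases d2 <;> simp [dv, sg] <;> omega

theorem Ginf_mul_kc {a : ℝ} (ha : a ∈ Set.Ioo (0 : ℝ) 1) {b b' : ℤ × ℤ} (hb : BlackV b)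
    (hb' : BlackV b') :
    ∑ d, Ginf a b (b' - dv d) * kc a (b' - dv d) d = if b' = b then 1 else 0 := by
  have key : ∑ d, Ginf a b (b' - dv d) * kc a (b' - dv d) d
      = kap a / a * adjK a (latK a fun w => gr (-1) (kap a) (w - b)) b' := by
    simp only [Ginf, adjK, latK, Finset.mul_sum, Finset.sum_mul]
    refine Finset.sum_congr rfl fun d _ => Finset.sum_congr rfl fun e _ => ?_
    have hneg : b' - dv d + dv e - b = -(b - dv e - (b' - dv d)) := by abel
    rw [hneg, gr_neg (Or.inr rfl)]
    by_cases h : inLam (b - dv e - (b' - dv d))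
    · simp only [kc, wt_congr a (whiteV_sub_dv hb e) (whiteV_sub_dv hb' d) h e]
      ring
    · rw [gr_eq_zero_of_not_inLam _ _ _ h]
      ring
  rw [key, adjK_latK a _ hb', kap_scale ha.1]
  have := gr_neg_one_eq (kap_pos ha).le (four_kap_lt ha) (b' - b)
  simp only [sub_eq_zero, sub_add_eq_add_sub] at this
  exact this

lemma abs_kc_le {a : ℝ} (ha : a ∈ Set.Ioo (0 : ℝ) 1) (v : ℤ × ℤ) (d : Bool × Bool) :
    |kc a v d| ≤ 1 := by
  have h0 := ha.1
  have h1 := ha.2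
  have h2 : |ks d| = 1 := by unfold ks; split_ifs <;> simp
  rw [kc, abs_mul, h2, one_mul, wt]
  split_ifs <;> simp [abs_of_pos h0, h1.le]

lemma abs_adjK_le {a : ℝ} (ha : a ∈ Set.Ioo (0 : ℝ) 1) (f : ℤ × ℤ → ℝ) (b : ℤ × ℤ) (C : ℝ)
    (h : ∀ d, |f (b - dv d)| ≤ C) : |adjK a f b| ≤ 4 * C := by
  calc |adjK a f b| ≤ ∑ d : Bool × Bool, |kc a (b - dv d) d * f (b - dv d)| :=
        Finset.abs_sum_le_sum_abs _ _
    _ ≤ ∑ d : Bool × Bool, C := Finset.sum_le_sum fun d _ => by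
        rw [abs_mul]
        calc _ ≤ 1 * |f (b - dv d)| :=
              mul_le_mul_of_nonneg_right (abs_kc_le ha _ _) (abs_nonneg _)
          _ ≤ C := by rw [one_mul]; exact h d
    _ = 4 * C := by simp

/-- A bound constant for `Ginf`. -/
def gC (a : ℝ) : ℝ := kap a / a * (4 / (1 - 4 * kap a))

lemma gC_nonneg {a : ℝ} (ha : a ∈ Set.Ioo (0 : ℝ) 1) : 0 ≤ gC a := by
  have := ha.1
  have := (kap_pos ha).le
  have := four_kap_lt ha
  exact mul_nonneg (by positivity) (div_nonneg (by norm_num) (by linarith))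

lemma abs_Ginf_sub_Gtr_le {a : ℝ} (ha : a ∈ Set.Ioo (0 : ℝ) 1) (L : ℕ) (b v : ℤ × ℤ) :
    |Ginf a b v - Gtr a L b v| ≤ gC a * (4 * kap a) ^ L := by
  have h : Ginf a b v - Gtr a L b v = kap a / a *
      adjK a (fun w => gr (-1) (kap a) (w - v) - gt (-1) (kap a) L (w - v)) b := by
    simp only [Ginf, Gtr, adjK, ← mul_sub, ← Finset.sum_sub_distrib]
  have hk := kap_pos ha
  have h0 := ha.1
  rw [h, abs_mul, abs_of_pos (by positivity)]
  have := abs_adjK_le ha (fun w => gr (-1) (kap a) (w - v) - gt (-1) (kap a) L (w - v)) b _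
    (fun d => abs_gr_sub_gt_le (Or.inr rfl) hk.le (four_kap_lt ha) L _)
  calc _ ≤ kap a / a * (4 * ((4 * kap a) ^ L / (1 - 4 * kap a))) :=
        mul_le_mul_of_nonneg_left this (by positivity)
    _ = _ := by unfold gC; ring

lemma Gtr_eq_zero (a : ℝ) (L : ℕ) (b v : ℤ × ℤ)
    (h : 2 * (L : ℤ) - 1 < max |b.1 - v.1| |b.2 - v.2|) : Gtr a L b v = 0 := by
  rw [Gtr, adjK, Finset.sum_eq_zero, mul_zero]
  intro d _
  rw [gt_eq_zero, mul_zero]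
  obtain ⟨d1, d2⟩ := d
  rcases lt_max_iff.1 h with h | h
  · refine lt_max_of_lt_left ?_
    cases d1 <;> simp [dv, sg] <;> grind
  · refine lt_max_of_lt_right ?_
    cases d2 <;> simp [dv, sg] <;> grind

lemma abs_Ginf_le {a : ℝ} (ha : a ∈ Set.Ioo (0 : ℝ) 1) (L : ℕ) (b v : ℤ × ℤ)
    (h : 2 * (L : ℤ) - 1 < max |b.1 - v.1| |b.2 - v.2|) :
    |Ginf a b v| ≤ gC a * (4 * kap a) ^ L := by
  have := abs_Ginf_sub_Gtr_le ha L b v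
  rwa [Gtr_eq_zero a L b v h, sub_zero] at this

/-! ### One-sided solutions of the Kasteleyn equation in the Aztec diamond -/

/-- Backward difference with step four. -/
def De (f : ℤ → ℝ) (y : ℤ) : ℝ := f y - f (y - 4)

lemma De_iterate_wk (k j : ℕ) :
    De^[k] (fun y => wk (-1) j (y + 2 * k)) = fun y => (-1) ^ k * wk (-1) (j + k) y := by
  have hlin : ∀ (k : ℕ) (c : ℝ) (f : ℤ → ℝ),
      De^[k] (fun y => c * f y) = fun y => c * De^[k] f y := by
    intro k c
    induction k with
    | zero => intro f; rfl
    | succ k ih =>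
      intro f
      rw [Function.iterate_succ_apply, Function.iterate_succ_apply, ← ih]
      congr 1
      funext y
      simp only [De]
      ring
  induction k generalizing j with
  | zero => simp
  | succ k ih =>
    have h : De (fun y => wk (-1) j (y + 2 * (k + 1 : ℕ)))
        = fun y => (-1) * wk (-1) (j + 1) (y + 2 * k) := by
      funext y
      simp only [De, wk]
      push_cast
      ring_nf
    rw [Function.iterate_succ_apply, h, hlin, ih]
    funext y
    rw [pow_succ, show j + 1 + k = j + (k + 1) by ring]
    ring

lemma De_iterate_support {f : ℤ → ℝ} {l u : ℤ} (h : ∀ y, y < l ∨ u < y → f y = 0) (k : ℕ) :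
    ∀ y, y < l ∨ u + 4 * k < y → De^[k] f y = 0 := by
  induction k with
  | zero => simpa using h
  | succ k ih =>
    intro y hy
    rw [Function.iterate_succ_apply', De, ih, ih, sub_zero] <;> push_cast at hy <;> omega

section OneSided

variable (p q s : ℝ) (n : ℤ)

/-- North weights in the column with index `j`, relative to the source column. -/
def nwt (j : ℕ) (y : ℤ) : ℝ := if (4 : ℤ) ∣ y + 2 * j then p else q

/-- South weights are north weights with the roles of `p` and `q` exchanged; the ratio of the two
appears in the recursion below. -/
def be : ℕ → ℤ → ℝ
  | 0, y => if y = -n + 1 then 1 / p else if y = -n + 3 then -s / q else 0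
  | j + 1, y => -be j y - be j (y - 4)
      + 2 * s * (nwt q p (j + 1) (y - 1) / nwt p q (j + 1) (y - 1)) * be j (y - 2)

/-- The column operator. -/
def colOp (j : ℕ) (f g : ℤ → ℝ) (y : ℤ) : ℝ :=
  nwt p q j y * (f (y + 1) + g (y + 1)) + s * nwt q p j y * (f (y - 1) - g (y - 1))

variable {p q s}

lemma colOp_De (j k : ℕ) (f g : ℤ → ℝ) :
    colOp p q s j (De^[k] f) (De^[k] g) = De^[k] (colOp p q s j f g) := by
  induction k generalizing f g with
  | zero => rfl
  | succ k ih =>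
    rw [Function.iterate_succ_apply, Function.iterate_succ_apply, Function.iterate_succ_apply, ih]
    congr 1
    funext y
    have h : ∀ p q : ℝ, nwt p q j (y - 4) = nwt p q j y := fun p q => by
      simp only [nwt]
      congr 1
      exact propext ⟨fun h => by omega, fun h => by omega⟩
    simp only [colOp, De, h]
    rw [show y - 4 + 1 = y + 1 - 4 by ring, show y - 4 - 1 = y - 1 - 4 by ring]
    ring

lemma nwt_ne_zero (hp : p ≠ 0) (hq : q ≠ 0) (j : ℕ) (y : ℤ) : nwt p q j y ≠ 0 := by
  unfold nwt; split_ifs <;> assumption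

lemma colOp_be_succ (hp : p ≠ 0) (hq : q ≠ 0) (hs : s * s = 1) (j : ℕ) {y : ℤ} (hy : Even y) :
    colOp p q s (j + 1) (be p q s n (j + 1)) (De (be p q s n j)) y = 0 := by
  have h1 : nwt p q (j + 1) (y - 1 - 1) = nwt q p (j + 1) y := by
    obtain ⟨t, rfl⟩ := hy
    simp only [nwt]; push_cast; split_ifs <;> first | rfl | omega
  have h2 : nwt q p (j + 1) (y - 1 - 1) = nwt p q (j + 1) y := by
    obtain ⟨t, rfl⟩ := hy
    simp only [nwt]; push_cast; split_ifs <;> first | rfl | omega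
  have h3 := nwt_ne_zero hp hq (j + 1) y
  have h4 := nwt_ne_zero hq hp (j + 1) y
  simp only [colOp, De, be, h1, h2, add_sub_cancel_right]
  rw [show y + 1 - 4 = y - 1 - 2 by ring, show y + 1 - 2 = y - 1 by ring]
  field_simp
  linear_combination (2 * nwt p q (j + 1) y * be p q s n j (y - 1 - 2)) * hs

lemma colOp_be_zero (hp : p ≠ 0) (hq : q ≠ 0) (hs : s * s = 1) (hn : (4 : ℤ) ∣ n) {y : ℤ}
    (hy : Even y) :
    colOp p q s 0 (be p q s n 0) (fun _ => 0) y = De (fun y => if y = -n then 1 else 0) y := by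
  obtain ⟨t, rfl⟩ := hy
  obtain ⟨m, rfl⟩ := hn
  simp only [colOp, De, be, nwt]
  rcases lt_trichotomy (t + t) (-(4 * m)) with h | h | h
  · simp (disch := omega) only [if_neg]; simp
  · have : t = -(2 * m) := by omega
    subst this
    simp (disch := omega) only [if_neg, if_pos]
    simp [hp]
  · by_cases h2 : t + t = -(4 * m) + 2
    · have : t = -(2 * m) + 1 := by omega
      subst this
      simp (disch := omega) only [if_neg, if_pos]
      field_simp
      simp
    · by_cases h4 : t + t = -(4 * m) + 4
      · have : t = -(2 * m) + 2 := by omega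
        subst this
        simp (disch := omega) only [if_neg, if_pos]
        field_simp
        simp [hs]
      · simp (disch := omega) only [if_neg]; simp

lemma be_support (j : ℕ) : ∀ y, y < -n + 1 ∨ -n + 3 + 4 * j < y → be p q s n j y = 0 := by
  induction j with
  | zero => intro y hy; simp only [be]; simp (disch := omega) only [if_neg]
  | succ j ih =>
    intro y hy
    push_cast at hy
    simp only [be]
    rw [ih, ih, ih] <;> first | omega | simp

end OneSided

/-- The solution emanating from a source column. -/
def oneSided (p q : ℝ) (σ : ℤ) (N : ℕ) (x : ℤ) (b : ℤ × ℤ) : ℝ :=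
  if 0 < σ * (b.1 - x) ∧ (σ * (b.1 - x) - 1) / 2 < 2 * N then
    De^[2 * N - 1 - ((σ * (b.1 - x) - 1) / 2).toNat]
      (be p q σ (4 * N) ((σ * (b.1 - x) - 1) / 2).toNat) b.2
  else 0

lemma oneSided_eq_zero_of_le (p q : ℝ) {σ : ℤ} (N : ℕ) {x : ℤ} {b : ℤ × ℤ}
    (hb : 4 * (N : ℤ) ≤ |b.2|) : oneSided p q σ N x b = 0 := by
  unfold oneSided
  split_ifs with h
  · apply De_iterate_support (be_support (4 * N) _)
    rcases le_abs.1 hb with h2 | h2 <;> omega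
  · rfl

lemma De_iterate_even {f g : ℤ → ℝ} (h : ∀ y, Even y → f y = g y) (k : ℕ) :
    ∀ y, Even y → De^[k] f y = De^[k] g y := by
  induction k with
  | zero => exact h
  | succ k ih =>
    intro y hy
    rw [Function.iterate_succ_apply', Function.iterate_succ_apply', De, De, ih y hy,
      ih _ (hy.sub (by decide))]

lemma latK_eq (a : ℝ) (F : ℤ × ℤ → ℝ) (v : ℤ × ℤ) :
    latK a F v = wt a v (true, true) * (F (v.1 + 1, v.2 + 1) + F (v.1 - 1, v.2 + 1))
      + wt a v (true, false) * (F (v.1 + 1, v.2 - 1) - F (v.1 - 1, v.2 - 1)) := by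
  obtain ⟨x, y⟩ := v
  by_cases h : northA (x, y)
  all_goals
    simp [latK, sum_dirs, kc, ks, dv, sg, wt, h, ← sub_eq_add_neg]
    ring

theorem latK_oneSided {a : ℝ} (ha : a ≠ 0) {σ : ℤ} (hσ : σ = 1 ∨ σ = -1) (N : ℕ) {x : ℤ}
    (hx : Odd x) (hx1 : 1 ≤ σ * x) {v : ℤ × ℤ} (hv : WhiteV v) (hvn : |v.1| ≤ 4 * N - 1) :
    latK a (oneSided (wt a (x, 0) (true, true)) (wt a (x, 0) (true, false)) σ N x) v
      = if v.1 = x then wk (-1) (2 * N) v.2 else 0 := by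
  obtain ⟨X, y⟩ := v
  obtain ⟨⟨X', rfl⟩, hy⟩ := hv
  obtain ⟨x', rfl⟩ := hx
  simp only at hy hvn ⊢
  set p := wt a (2 * x' + 1, 0) (true, true) with hp
  set q := wt a (2 * x' + 1, 0) (true, false) with hq
  have hp0 : p ≠ 0 := by rw [hp, wt]; split_ifs <;> first | exact ha | exact one_ne_zero
  have hq0 : q ≠ 0 := by rw [hq, wt]; split_ifs <;> first | exact ha | exact one_ne_zero
  have hss : (σ : ℝ) * σ = 1 := by rcases hσ with rfl | rfl <;> norm_num
  set t := σ * (X' - x') with ht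
  set F := oneSided p q σ N (2 * x' + 1) with hF
  have hbound : t < 2 * N := by
    have := abs_le.1 hvn
    rcases hσ with rfl | rfl <;> omega
  have hout : ∀ z, F (2 * X' + 1 + σ, z)
      = if 0 ≤ t then De^[2 * N - 1 - t.toNat] (be p q σ (4 * N) t.toNat) z else 0 := by
    intro z
    have h1 : σ * (2 * X' + 1 + σ - (2 * x' + 1)) = 2 * t + 1 := by
      rcases hσ with rfl | rfl <;> rw [ht] <;> ring
    simp only [hF, oneSided, h1]
    rw [show (2 * t + 1 - 1) / 2 = t by omega]
    congr 1
    exact propext ⟨fun h => by omega, fun h => by omega⟩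
  have hin : ∀ z, F (2 * X' + 1 - σ, z)
      = if 1 ≤ t then De^[2 * N - 1 - (t - 1).toNat] (be p q σ (4 * N) (t - 1).toNat) z
        else 0 := by
    intro z
    have h1 : σ * (2 * X' + 1 - σ - (2 * x' + 1)) = 2 * t - 1 := by
      rcases hσ with rfl | rfl <;> rw [ht] <;> ring
    simp only [hF, oneSided, h1]
    rw [show (2 * t - 1 - 1) / 2 = t - 1 by omega]
    congr 1
    exact propext ⟨fun h => by omega, fun h => by omega⟩
  have hwN : 0 ≤ t → wt a (2 * X' + 1, y) (true, true) = nwt p q t.toNat y := by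
    intro h0
    obtain ⟨y', rfl⟩ := hy
    simp only [hp, hq, wt, nwt, northA, iff_true, Bool.false_eq_true, iff_false]
    rcases hσ with rfl | rfl <;> split_ifs <;> first | rfl | omega
  have hwS : 0 ≤ t → wt a (2 * X' + 1, y) (true, false) = nwt q p t.toNat y := by
    intro h0
    obtain ⟨y', rfl⟩ := hy
    simp only [hp, hq, wt, nwt, northA, iff_true, Bool.false_eq_true, iff_false]
    rcases hσ with rfl | rfl <;> split_ifs <;> first | rfl | omega
  have hlat : latK a F (2 * X' + 1, y) = wt a (2 * X' + 1, y) (true, true) *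
        (F (2 * X' + 1 + σ, y + 1) + F (2 * X' + 1 - σ, y + 1))
      + σ * wt a (2 * X' + 1, y) (true, false) *
        (F (2 * X' + 1 + σ, y - 1) - F (2 * X' + 1 - σ, y - 1)) := by
    rw [latK_eq]
    rcases hσ with rfl | rfl
    · push_cast; ring
    · push_cast; rw [sub_neg_eq_add, ← sub_eq_add_neg]; ring
  rw [hlat]
  simp only [hout, hin]
  have htx : (2 * X' + 1 = 2 * x' + 1) ↔ t = 0 := by
    rcases hσ with rfl | rfl <;> omega
  simp only [htx]
  rcases lt_trichotomy t 0 with h | h | h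
  · simp (disch := omega) only [if_neg]; simp
  · rw [hwN h.ge, hwS h.ge]
    simp (disch := omega) only [if_neg, if_pos, h]
    simp only [Int.toNat_zero, Nat.sub_zero]
    have hN : 2 * N = (2 * N - 1) + 1 := by omega
    have hzero : De^[2 * N - 1] (fun _ => (0 : ℝ)) = fun _ => 0 :=
      Function.iterate_fixed (by funext y; simp [De]) _
    have h1 := congrFun (colOp_De (p := p) (q := q) (s := σ) 0 (2 * N - 1) (be p q σ (4 * N) 0)
      (fun _ => 0)) y
    have h2 := De_iterate_even (fun z hz => colOp_be_zero (4 * N) hp0 hq0 hss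
      (Dvd.intro _ rfl) hz) (2 * N - 1) y hy
    rw [hzero, h2, ← Function.iterate_succ_apply, Nat.succ_eq_add_one, ← hN] at h1
    have h3 := congrFun (De_iterate_wk (2 * N) 0) y
    have h4 : (fun y : ℤ => wk (-1) 0 (y + 2 * (2 * N : ℕ)))
        = fun y : ℤ => if y = -(4 * (N : ℤ)) then 1 else 0 := by
      funext z
      simp only [wk]
      congr 1
      push_cast
      exact propext ⟨fun h => by omega, fun h => by omega⟩
    rw [h4] at h3
    rw [h3] at h1
    simpa [colOp] using h1
  · rw [hwN h.le, hwS h.le]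
    simp (disch := omega) only [if_neg, if_pos]
    obtain ⟨j, hj⟩ : ∃ j : ℕ, t = j + 1 := ⟨(t - 1).toNat, by omega⟩
    have e1 : t.toNat = j + 1 := by omega
    have e2 : (t - 1).toNat = j := by omega
    have e3 : 2 * N - 1 - j = (2 * N - 1 - (j + 1)) + 1 := by omega
    rw [e1, e2, e3, Function.iterate_succ_apply]
    have h1 := congrFun (colOp_De (p := p) (q := q) (s := σ) (j + 1) (2 * N - 1 - (j + 1))
      (be p q σ (4 * N) (j + 1)) (De (be p q σ (4 * N) j))) y
    have h2 := De_iterate_even (g := fun _ => 0) (fun z hz => colOp_be_succ (4 * N) hp0 hq0 hss j hz)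
      (2 * N - 1 - (j + 1)) y hy
    have hzero : De^[2 * N - 1 - (j + 1)] (fun _ => (0 : ℝ)) = fun _ => 0 :=
      Function.iterate_fixed (by funext y; simp [De]) _
    rw [h2, hzero] at h1
    simpa [colOp] using h1

theorem exists_column_solution {a : ℝ} (ha : a ≠ 0) (N : ℕ) {x : ℤ} (hx : Odd x) :
    ∃ F : ℤ × ℤ → ℝ, (∀ b : ℤ × ℤ, b.1 = 0 → F b = 0) ∧
      (∀ b : ℤ × ℤ, 4 * (N : ℤ) ≤ |b.2| → F b = 0) ∧
      ∀ v, WhiteV v → |v.1| ≤ 4 * N - 1 →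
        latK a F v = if v.1 = x then wk (-1) (2 * N) v.2 else 0 := by
  have key : ∀ σ : ℤ, (σ = 1 ∨ σ = -1) → 1 ≤ σ * x → ∃ F : ℤ × ℤ → ℝ,
      (∀ b : ℤ × ℤ, b.1 = 0 → F b = 0) ∧ (∀ b : ℤ × ℤ, 4 * (N : ℤ) ≤ |b.2| → F b = 0) ∧
      ∀ v, WhiteV v → |v.1| ≤ 4 * N - 1 →
        latK a F v = if v.1 = x then wk (-1) (2 * N) v.2 else 0 := by
    intro σ hσ h1
    refine ⟨oneSided _ _ σ N x, fun b hb => ?_, fun b hb => oneSided_eq_zero_of_le _ _ N hb,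
      fun v hv hvn => latK_oneSided ha hσ N hx h1 hv hvn⟩
    rw [oneSided, if_neg]
    rw [hb, zero_sub, mul_neg]
    omega
  obtain ⟨t, rfl⟩ := hx
  rcases lt_or_ge t 0 with h | h
  · exact key (-1) (Or.inr rfl) (by omega)
  · exact key 1 (Or.inl rfl) (by omega)

/-! ### Convergence of the inverse Kasteleyn matrix -/

lemma exists_column_solution' {a : ℝ} (ha : a ≠ 0) (N : ℕ) (x : ℤ) :
    ∃ F : ℤ × ℤ → ℝ, (∀ b : ℤ × ℤ, b.1 = 0 → F b = 0) ∧
      (∀ b : ℤ × ℤ, 4 * (N : ℤ) ≤ |b.2| → F b = 0) ∧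
      ∀ v, WhiteV v → |v.1| ≤ 4 * N - 1 →
        latK a F v = if v.1 = x then wk (-1) (2 * N) v.2 else 0 := by
  by_cases hx : Odd x
  · exact exists_column_solution ha N hx
  · refine ⟨fun _ => 0, fun _ _ => rfl, fun _ _ => rfl, fun v hv _ => ?_⟩
    rw [if_neg]
    · simp [latK]
    · rintro rfl; exact hx hv.1

/-- `R` is the inverse of the Kasteleyn matrix of the Aztec diamond of size `n`, extended by
zero. -/
structure IsInvKer (a : ℝ) (n : ℤ) (R : ℤ × ℤ → ℤ × ℤ → ℝ) : Prop where
  zero_black : ∀ b v, ¬ inBox n b → R b v = 0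
  zero_white : ∀ b v, ¬ inBox n v → R b v = 0
  right_inv : ∀ v v', WhiteV v → inBox n v → WhiteV v' → inBox n v' →
    latK a (fun b => R b v) v' = if v' = v then 1 else 0
  left_inv : ∀ b b', BlackV b → inBox n b → BlackV b' → inBox n b' →
    ∑ d, R b (b' - dv d) * kc a (b' - dv d) d = if b' = b then 1 else 0
  unique : ∀ F : ℤ × ℤ → ℝ, (∀ b, BlackV b → n < |b.2| → F b = 0) →
    ∀ v, WhiteV v → inBox n v →
    (∀ v', WhiteV v' → inBox n v' → latK a F v' = if v' = v then 1 else 0) →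
    ∀ b, BlackV b → inBox n b → F b = R b v

lemma latK_finset_sum {ι : Type*} (a : ℝ) (s : Finset ι) (F : ι → ℤ × ℤ → ℝ) (v : ℤ × ℤ) :
    latK a (fun b => ∑ i ∈ s, F i b) v = ∑ i ∈ s, latK a (F i) v := by
  simp only [latK, Finset.mul_sum]
  exact Finset.sum_comm

theorem IsInvKer.eq_Gtr {a : ℝ} (ha : 0 < a) {N : ℕ} (hN : 0 < N) {R : ℤ × ℤ → ℤ × ℤ → ℝ}
    (hR : IsInvKer a (4 * N) R) {b v : ℤ × ℤ} (hb : BlackV b) (hv : WhiteV v) (hb0 : b.1 = 0)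
    (hv0 : v.2 = 0) : R b v = Gtr a (2 * N) b v := by
  by_cases hvn : inBox (4 * N) v
  swap
  · rw [hR.zero_white _ _ hvn, Gtr_eq_zero]
    simp only [inBox, hv0, not_and_or, abs_zero] at hvn
    rw [hb0]
    refine lt_max_of_lt_left ?_
    rw [zero_sub, abs_neg]
    push_cast
    omega
  by_cases hbn : inBox (4 * N) b
  swap
  · rw [hR.zero_black _ _ hbn, Gtr_eq_zero]
    simp only [inBox, hb0, not_and_or, abs_zero] at hbn
    rw [hv0]
    refine lt_max_of_lt_right ?_
    rw [sub_zero]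
    push_cast
    omega
  choose Φ h1 h2 h3 using exists_column_solution' ha.ne' N
  set F : ℤ × ℤ → ℝ := fun b => Gtr a (2 * N) b v + ∑ x ∈ Finset.Icc (-(4 * (N : ℤ))) (4 * N),
    kap a ^ (2 * N) * wk (-1) (2 * N) (x - v.1) * Φ x b with hF
  have hodd : ∀ w, WhiteV w → |w.1| ≤ 4 * (N : ℤ) → |w.1| ≤ 4 * N - 1 := by
    rintro w ⟨⟨t, ht⟩, -⟩ h
    rw [abs_le] at h ⊢
    omega
  have := hR.unique F ?_ v hv hvn ?_ b hb hbn
  · rw [← this, hF]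
    simp only
    rw [Finset.sum_eq_zero fun x _ => by rw [h1 x b hb0, mul_zero], add_zero]
  · intro b' hb' hlt
    rw [hF]
    simp only
    rw [Finset.sum_eq_zero fun x _ => by rw [h2 x b' hlt.le, mul_zero], add_zero, Gtr_eq_zero]
    refine lt_max_of_lt_right ?_
    rw [hv0, sub_zero]
    push_cast
    omega
  · intro v' hv' hvn'
    rw [hF, latK_add, latK_Gtr ha _ hv', latK_finset_sum]
    simp only [latK_const_mul]
    rw [Finset.sum_eq_single v'.1, h3 v'.1 v' hv' (hodd v' hv' hvn'.1), if_pos rfl]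
    · simp only [pk, Prod.fst_sub, Prod.snd_sub, hv0, sub_zero]
      ring
    · intro x _ hx
      rw [h3 x v' hv' (hodd v' hv' hvn'.1), if_neg (Ne.symm hx), mul_zero]
    · intro h
      exact absurd (Finset.mem_Icc.2 (abs_le.1 hvn'.1)) h

lemma latK_eq_signed (a : ℝ) (F : ℤ × ℤ → ℝ) {σ : ℤ} (hσ : σ = 1 ∨ σ = -1) (X y : ℤ) :
    latK a F (X, y) = wt a (X, y) (true, true) * (F (X + σ, y + 1) + F (X - σ, y + 1))
      + σ * wt a (X, y) (true, false) * (F (X + σ, y - 1) - F (X - σ, y - 1)) := by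
  rw [latK_eq]
  rcases hσ with rfl | rfl
  · push_cast; ring
  · push_cast; rw [sub_neg_eq_add, ← sub_eq_add_neg]; ring

theorem wt_snd (a : ℝ) (v : ℤ × ℤ) (c δ : Bool) : wt a v (c, δ) = wt a v (false, δ) := rfl

lemma wt_pos {a : ℝ} (ha : a ∈ Set.Ioo (0 : ℝ) 1) (v : ℤ × ℤ) (d : Bool × Bool) :
    0 < wt a v d := by
  have := ha.1
  unfold wt; split_ifs <;> simp [this]

lemma le_wt {a : ℝ} (ha : a ∈ Set.Ioo (0 : ℝ) 1) (v : ℤ × ℤ) (d : Bool × Bool) :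
    a ≤ wt a v d := by
  have := ha.2
  unfold wt; split_ifs <;> simp [this.le]

lemma wt_le_one {a : ℝ} (ha : a ∈ Set.Ioo (0 : ℝ) 1) (v : ℤ × ℤ) (d : Bool × Bool) :
    wt a v d ≤ 1 := by
  have := ha.2
  unfold wt; split_ifs <;> simp [this.le]

lemma wt_south_eq_north {X y : ℤ} (hv : WhiteV (X, y)) (a : ℝ) (c c' : Bool) :
    wt a (X, y + 2) (c, false) = wt a (X, y) (c', true) := by
  obtain ⟨⟨s, hs⟩, ⟨t, ht⟩⟩ := hv
  simp only at hs ht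
  simp only [wt, northA, iff_true, Bool.false_eq_true, iff_false]
  congr 1
  exact propext ⟨fun h => by omega, fun h => by omega⟩

lemma bound_of_recursion {c : ℕ → ℝ} {t e : ℝ} {J : ℕ} (h0 : c 0 ≤ t)
    (hstep : ∀ j < J, c (j + 1) ≤ c j + e) : ∀ j ≤ J, c j ≤ t + j * e := by
  intro j
  induction j with
  | zero => intro _; simpa using h0
  | succ j ih =>
    intro hj
    push_cast
    linarith [ih (by omega), hstep j (by omega)]

section Limit

variable {a : ℝ} {R : ℕ → ℤ × ℤ → ℤ × ℤ → ℝ}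

/-- The discrepancy between the inverse Kasteleyn matrices and the full-plane kernel decays
superpolynomially, uniformly for black vertices in column `X` and white vertices in row `Y`. -/
def SmallErr (a : ℝ) (R : ℕ → ℤ × ℤ → ℤ × ℤ → ℝ) (X Y : ℤ) : Prop :=
  ∃ e : ℕ → ℝ, Asymptotics.SuperpolynomialDecay Filter.atTop (fun m : ℕ => (m : ℝ)) e ∧
    ∀ᶠ m in Filter.atTop, ∀ y x, Odd y → Odd x →
      |Ginf a (X, y) (x, Y) - R m (X, y) (x, Y)| ≤ e m

lemma superpolynomialDecay_geometric {r : ℝ} (hr : 0 ≤ r) (hr' : r < 1) :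
    Asymptotics.SuperpolynomialDecay Filter.atTop (fun m : ℕ => (m : ℝ)) fun m => r ^ m := by
  intro k
  exact tendsto_pow_const_mul_const_pow_of_abs_lt_one k (by rwa [abs_of_nonneg hr])

/-- The size of the full-plane kernel far away. -/
def tiny (a : ℝ) (m : ℕ) : ℝ := gC a * (4 * kap a) ^ m

lemma tiny_nonneg (ha : a ∈ Set.Ioo (0 : ℝ) 1) (m : ℕ) : 0 ≤ tiny a m :=
  mul_nonneg (gC_nonneg ha) (pow_nonneg (by linarith [kap_pos ha]) _)

lemma superpolynomialDecay_tiny (ha : a ∈ Set.Ioo (0 : ℝ) 1) :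
    Asymptotics.SuperpolynomialDecay Filter.atTop (fun m : ℕ => (m : ℝ)) (tiny a) :=
  (superpolynomialDecay_geometric (by linarith [kap_pos ha]) (four_kap_lt ha)).const_mul _

lemma abs_Ginf_le_tiny (ha : a ∈ Set.Ioo (0 : ℝ) 1) {m : ℕ} {b v : ℤ × ℤ}
    (h : 2 * (m : ℤ) ≤ |b.1 - v.1| ∨ 2 * (m : ℤ) ≤ |b.2 - v.2|) : |Ginf a b v| ≤ tiny a m := by
  refine abs_Ginf_le ha m b v ?_
  rcases h with h | h
  · exact lt_max_of_lt_left (by omega)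
  · exact lt_max_of_lt_right (by omega)

lemma smallErr_zero (ha : a ∈ Set.Ioo (0 : ℝ) 1)
    (hR : ∀ᶠ m : ℕ in Filter.atTop, IsInvKer a (4 * ((m + 1 : ℕ) : ℤ)) (R m)) :
    SmallErr a R 0 0 := by
  refine ⟨tiny a, superpolynomialDecay_tiny ha, hR.mono fun m hm y x hy hx => ?_⟩
  rw [hm.eq_Gtr ha.1 m.succ_pos (b := (0, y)) (v := (x, 0)) ⟨Even.zero, hy⟩ ⟨hx, Even.zero⟩ rfl rfl]
  refine (abs_Ginf_sub_Gtr_le ha _ _ _).trans ?_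
  exact mul_le_mul_of_nonneg_left (pow_le_pow_of_le_one (by linarith [kap_pos ha])
    (four_kap_lt ha).le (by omega)) (gC_nonneg ha)

lemma superpolynomialDecay_step (ha : a ∈ Set.Ioo (0 : ℝ) 1) {e : ℕ → ℝ}
    (he : Asymptotics.SuperpolynomialDecay Filter.atTop (fun m : ℕ => (m : ℝ)) e) :
    Asymptotics.SuperpolynomialDecay Filter.atTop (fun m : ℕ => (m : ℝ))
      fun m => a⁻¹ * (tiny a m + ((m : ℝ) * (8 * e m) + 10 * e m)) :=
  ((superpolynomialDecay_tiny ha).add ((he.const_mul 8).param_mul.add (he.const_mul 10))).const_mul _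

lemma le_step {m : ℕ} {t e w ρ : ℝ} {j : ℕ} (ha : a ∈ Set.Ioo (0 : ℝ) 1) (he : 0 ≤ e)
    (hw : a ≤ w) (hρ : 0 ≤ ρ) (hj : j ≤ 4 * m + 5) (h : w * ρ ≤ t + j * (2 * e)) :
    ρ ≤ a⁻¹ * (t + ((m : ℝ) * (8 * e) + 10 * e)) := by
  rw [← div_eq_inv_mul, le_div_iff₀ ha.1]
  have h2 : (j : ℝ) ≤ 4 * m + 5 := by exact_mod_cast hj
  nlinarith [mul_le_mul_of_nonneg_right hw hρ, mul_le_mul_of_nonneg_right h2 he]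

lemma le_step' {m : ℕ} {t e ρ : ℝ} (ha : a ∈ Set.Ioo (0 : ℝ) 1) (he : 0 ≤ e) (ht : 0 ≤ t)
    (h : ρ ≤ t) : ρ ≤ a⁻¹ * (t + ((m : ℝ) * (8 * e) + 10 * e)) := by
  have h1 : (1 : ℝ) ≤ a⁻¹ := (one_le_inv₀ ha.1).2 ha.2.le
  have h2 : 0 ≤ (m : ℝ) * (8 * e) + 10 * e := by positivity
  nlinarith

theorem SmallErr.column (ha : a ∈ Set.Ioo (0 : ℝ) 1)
    (hR : ∀ᶠ m : ℕ in Filter.atTop, IsInvKer a (4 * ((m + 1 : ℕ) : ℤ)) (R m)) {X Y : ℤ}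
    (hX : Even X) (hY : Even Y) (h : SmallErr a R X Y) {σ : ℤ} (hσ : σ = 1 ∨ σ = -1) :
    SmallErr a R (X + 2 * σ) Y := by
  obtain ⟨e, he, hb⟩ := h
  refine ⟨_, superpolynomialDecay_step ha he, ?_⟩
  filter_upwards [hR, hb, Filter.eventually_ge_atTop (X.natAbs + Y.natAbs + 2)]
    with m hm hb hlarge y x hy hx
  have he0 : 0 ≤ e m := (abs_nonneg _).trans (hb 1 1 odd_one odd_one)
  have hXa : |X| + |Y| + 2 ≤ (m : ℤ) := by rw [Int.abs_eq_natAbs, Int.abs_eq_natAbs]; omega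
  have ht := tiny_nonneg ha m
  by_cases hvn : inBox (4 * ((m + 1 : ℕ) : ℤ)) (x, Y)
  swap
  · rw [hm.zero_white _ _ hvn, sub_zero]
    refine le_step' ha he0 ht (abs_Ginf_le_tiny ha (Or.inl ?_))
    simp only [inBox, not_and_or] at hvn ⊢
    push_cast at hvn
    rcases hσ with rfl | rfl <;> grind
  have hfar : ∀ z : ℤ, 4 * ((m + 1 : ℕ) : ℤ) < |z| →
      |Ginf a (X + 2 * σ, z) (x, Y) - R m (X + 2 * σ, z) (x, Y)| ≤ tiny a m := by
    intro z hz
    rw [hm.zero_black _ _ (fun hh => absurd hh.2 (not_le.2 hz)), sub_zero]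
    refine abs_Ginf_le_tiny ha (Or.inr ?_)
    push_cast at hz
    simp only
    grind
  by_cases hyn : 4 * ((m + 1 : ℕ) : ℤ) < |y|
  · exact le_step' ha he0 ht (hfar y hyn)
  set n : ℤ := 4 * ((m + 1 : ℕ) : ℤ) with hn
  set r : ℤ × ℤ → ℝ := fun b => Ginf a b (x, Y) - R m b (x, Y) with hr
  have hrec := bound_of_recursion (t := tiny a m) (e := 2 * e m) (J := 4 * m + 5)
    (c := fun j => wt a (X + σ, -n + 2 * j) (true, false) * |r (X + 2 * σ, -n + 2 * j - 1)|)
    ?_ ?_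
  · obtain ⟨j, hj⟩ : ∃ j : ℕ, y = -n + 2 * j - 1 := by
      obtain ⟨s, rfl⟩ := hy
      refine ⟨(s + 1 + 2 * (m + 1)).toNat, ?_⟩
      rw [not_lt, abs_le] at hyn
      omega
    have hjJ : j ≤ 4 * m + 5 := by
      rw [not_lt, abs_le] at hyn
      omega
    have := hrec j hjJ
    simp only [← hj] at this
    exact le_step ha he0 (le_wt ha _ _) (abs_nonneg _) hjJ this
  · have h1 := hfar (-n - 1) (by rw [abs_of_neg] <;> omega)
    have h2 := wt_le_one ha (X + σ, -n) (true, false)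
    have h3 := wt_pos ha (X + σ, -n) (true, false)
    simp only [Nat.cast_zero, mul_zero, add_zero, hr]
    nlinarith [abs_nonneg (Ginf a (X + 2 * σ, -n - 1) (x, Y) - R m (X + 2 * σ, -n - 1) (x, Y))]
  · intro j hj
    have hwhite : WhiteV (X + σ, -n + 2 * j) := by
      obtain ⟨s, rfl⟩ := hX
      refine ⟨?_, ⟨-2 * (m + 1) + j, by simp only [hn]; push_cast; ring⟩⟩
      rcases hσ with rfl | rfl
      · exact ⟨s, by simp only; ring⟩
      · exact ⟨s - 1, by simp only; ring⟩
    have hbox : inBox n (X + σ, -n + 2 * j) := by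
      constructor
      · simp only [abs_le]
        have := abs_le.1 (show |X| ≤ m - 2 by linarith [abs_nonneg Y])
        rcases hσ with rfl | rfl <;> omega
      · simp only [abs_le]
        omega
    have h1 := hm.right_inv (x, Y) _ ⟨hx, hY⟩ hvn hwhite hbox
    have h2 := latK_Ginf ha hwhite (x, Y)
    have h3 : latK a r (X + σ, -n + 2 * j) = 0 := by
      rw [hr, latK_sub, h1, h2, sub_self]
    rw [latK_eq_signed a r hσ] at h3
    have hodd : Odd (-n + 2 * j + 1) := ⟨-2 * (m + 1) + j, by simp only [hn]; push_cast; ring⟩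
    have hodd' : Odd (-n + 2 * j - 1) :=
      ⟨-2 * (m + 1) + j - 1, by simp only [hn]; push_cast; ring⟩
    have b1 : |r (X, -n + 2 * j + 1)| ≤ e m := hb _ _ hodd hx
    have b2 : |r (X, -n + 2 * j - 1)| ≤ e m := hb _ _ hodd' hx
    rw [show X + σ + σ = X + 2 * σ by ring, show X + σ - σ = X by ring] at h3
    have hN := wt_le_one ha (X + σ, -n + 2 * j) (true, true)
    have hN' := wt_pos ha (X + σ, -n + 2 * j) (true, true)
    have hS := wt_le_one ha (X + σ, -n + 2 * j) (true, false)
    have hS' := wt_pos ha (X + σ, -n + 2 * j) (true, false)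
    have hw := wt_south_eq_north hwhite a true true
    rw [show -n + 2 * ((j + 1 : ℕ) : ℤ) = -n + 2 * j + 2 by push_cast; ring, hw,
      show -n + 2 * (j : ℤ) + 2 - 1 = -n + 2 * j + 1 by ring]
    set wN := wt a (X + σ, -n + 2 * j) (true, true)
    set wS := wt a (X + σ, -n + 2 * j) (true, false)
    have hσa : |(σ : ℝ)| = 1 := by rcases hσ with rfl | rfl <;> simp
    have h4 : wN * r (X + 2 * σ, -n + 2 * j + 1) = -(σ * wS * r (X + 2 * σ, -n + 2 * j - 1))
        + (-(wN * r (X, -n + 2 * j + 1)) + σ * wS * r (X, -n + 2 * j - 1)) := by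
      linear_combination h3
    calc wN * |r (X + 2 * σ, -n + 2 * j + 1)| = |wN * r (X + 2 * σ, -n + 2 * j + 1)| := by
          rw [abs_mul, abs_of_pos hN']
      _ ≤ |σ * wS * r (X + 2 * σ, -n + 2 * j - 1)|
          + (|wN * r (X, -n + 2 * j + 1)| + |σ * wS * r (X, -n + 2 * j - 1)|) := by
          rw [h4]
          refine (abs_add_le _ _).trans ?_
          rw [abs_neg]
          refine add_le_add le_rfl ((abs_add_le _ _).trans ?_)
          rw [abs_neg]
      _ ≤ wS * |r (X + 2 * σ, -n + 2 * j - 1)| + 2 * e m := by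
          rw [abs_mul, abs_mul, abs_mul, abs_mul, abs_mul, hσa, abs_of_pos hN', abs_of_pos hS',
            one_mul]
          nlinarith [abs_nonneg (r (X, -n + 2 * j + 1)), abs_nonneg (r (X, -n + 2 * j - 1))]

theorem SmallErr.row (ha : a ∈ Set.Ioo (0 : ℝ) 1)
    (hR : ∀ᶠ m : ℕ in Filter.atTop, IsInvKer a (4 * ((m + 1 : ℕ) : ℤ)) (R m)) {X Y : ℤ}
    (hX : Even X) (hY : Even Y) (h : SmallErr a R X Y) {σ : ℤ} (hσ : σ = 1 ∨ σ = -1) :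
    SmallErr a R X (Y + 2 * σ) := by
  obtain ⟨e, he, hb⟩ := h
  refine ⟨_, superpolynomialDecay_step ha he, ?_⟩
  filter_upwards [hR, hb, Filter.eventually_ge_atTop (X.natAbs + Y.natAbs + 2)]
    with m hm hb hlarge y x hy hx
  have he0 : 0 ≤ e m := (abs_nonneg _).trans (hb 1 1 odd_one odd_one)
  have hXa : |X| + |Y| + 2 ≤ (m : ℤ) := by rw [Int.abs_eq_natAbs, Int.abs_eq_natAbs]; omega
  have ht := tiny_nonneg ha m
  by_cases hbn : inBox (4 * ((m + 1 : ℕ) : ℤ)) (X, y)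
  swap
  · rw [hm.zero_black _ _ hbn, sub_zero]
    refine le_step' ha he0 ht (abs_Ginf_le_tiny ha (Or.inr ?_))
    simp only [inBox, not_and_or] at hbn ⊢
    push_cast at hbn
    rcases hσ with rfl | rfl <;> grind
  have hfar : ∀ z : ℤ, 4 * ((m + 1 : ℕ) : ℤ) < |z| →
      |Ginf a (X, y) (z, Y + 2 * σ) - R m (X, y) (z, Y + 2 * σ)| ≤ tiny a m := by
    intro z hz
    rw [hm.zero_white _ _ (fun hh => absurd hh.1 (not_le.2 hz)), sub_zero]
    refine abs_Ginf_le_tiny ha (Or.inl ?_)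
    push_cast at hz
    simp only
    grind
  by_cases hxn : 4 * ((m + 1 : ℕ) : ℤ) < |x|
  · exact le_step' ha he0 ht (hfar x hxn)
  set n : ℤ := 4 * ((m + 1 : ℕ) : ℤ) with hn
  set r : ℤ × ℤ → ℝ := fun v => Ginf a (X, y) v - R m (X, y) v with hr
  set δ : Bool := decide (σ = -1) with hδ
  have hrec := bound_of_recursion (t := tiny a m) (e := 2 * e m) (J := 4 * m + 5)
    (c := fun j => wt a (-n + 2 * j - 1, Y + 2 * σ) (true, δ) * |r (-n + 2 * j - 1, Y + 2 * σ)|)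
    ?_ ?_
  · obtain ⟨j, hj⟩ : ∃ j : ℕ, x = -n + 2 * j - 1 := by
      obtain ⟨s, rfl⟩ := hx
      refine ⟨(s + 1 + 2 * (m + 1)).toNat, ?_⟩
      rw [not_lt, abs_le] at hxn
      omega
    have hjJ : j ≤ 4 * m + 5 := by
      rw [not_lt, abs_le] at hxn
      omega
    have := hrec j hjJ
    simp only [← hj] at this
    exact le_step ha he0 (le_wt ha _ _) (abs_nonneg _) hjJ this
  · have h1 := hfar (-n - 1) (by rw [abs_of_neg] <;> omega)
    have h2 := wt_le_one ha (-n - 1, Y + 2 * σ) (true, δ)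
    have h3 := wt_pos ha (-n - 1, Y + 2 * σ) (true, δ)
    simp only [Nat.cast_zero, mul_zero, add_zero, hr]
    nlinarith [abs_nonneg (Ginf a (X, y) (-n - 1, Y + 2 * σ) - R m (X, y) (-n - 1, Y + 2 * σ))]
  · intro j hj
    have hblack : BlackV (-n + 2 * j, Y + σ) := by
      obtain ⟨s, rfl⟩ := hY
      refine ⟨⟨-2 * (m + 1) + j, by simp only [hn]; push_cast; ring⟩, ?_⟩
      rcases hσ with rfl | rfl
      · exact ⟨s, by simp only; ring⟩
      · exact ⟨s - 1, by simp only; ring⟩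
    have hbox : inBox n (-n + 2 * j, Y + σ) := by
      constructor
      · simp only [abs_le]
        omega
      · simp only [abs_le]
        have := abs_le.1 (show |Y| ≤ m - 2 by linarith [abs_nonneg X])
        rcases hσ with rfl | rfl <;> omega
    have h1 := hm.left_inv (X, y) _ ⟨hX, hy⟩ hbn hblack hbox
    have h2 := Ginf_mul_kc ha (b := (X, y)) ⟨hX, hy⟩ hblack
    have h3 : ∑ d, r ((-n + 2 * j, Y + σ) - dv d) * kc a ((-n + 2 * j, Y + σ) - dv d) d = 0 := by
      simp only [hr, sub_mul, Finset.sum_sub_distrib]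
      rw [h1, h2, sub_self]
    have hodd : Odd (-n + 2 * j + 1) := ⟨-2 * (m + 1) + j, by simp only [hn]; push_cast; ring⟩
    have hodd' : Odd (-n + 2 * j - 1) :=
      ⟨-2 * (m + 1) + j - 1, by simp only [hn]; push_cast; ring⟩
    have b1 : |r (-n + 2 * j + 1, Y)| ≤ e m := hb _ _ hy hodd
    have b2 : |r (-n + 2 * j - 1, Y)| ≤ e m := hb _ _ hy hodd'
    rw [show -n + 2 * ((j + 1 : ℕ) : ℤ) - 1 = -n + 2 * j + 1 by push_cast; ring]
    have k1 := abs_kc_le ha (-n + 2 * j + 1, Y) (false, !δ)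
    have k2 := abs_kc_le ha (-n + 2 * j - 1, Y) (true, !δ)
    have hks : |ks (false, δ)| = 1 := by unfold ks; split_ifs <;> simp
    have h4 : ks (false, δ) * (wt a (-n + 2 * j + 1, Y + 2 * σ) (true, δ)
          * r (-n + 2 * j + 1, Y + 2 * σ))
        = -(wt a (-n + 2 * j - 1, Y + 2 * σ) (true, δ) * r (-n + 2 * j - 1, Y + 2 * σ))
        + (-(kc a (-n + 2 * j + 1, Y) (false, !δ) * r (-n + 2 * j + 1, Y))
          + -(kc a (-n + 2 * j - 1, Y) (true, !δ) * r (-n + 2 * j - 1, Y))) := by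
      rcases hσ with rfl | rfl
      · have e1 : Y + 1 - -1 = Y + 2 := by ring
        have e2 : Y + 1 - 1 = Y := by ring
        simp only [sum_dirs, dv, sg, kc, hδ, ks, wt_snd a _ true] at h3 ⊢
        simp [e1, e2] at h3 ⊢
        linear_combination h3
      · have e1 : Y + -1 - -1 = Y := by ring
        have e2 : Y + -1 - 1 = Y + -2 := by ring
        simp only [sum_dirs, dv, sg, kc, hδ, ks, wt_snd a _ true] at h3 ⊢
        simp [e1, e2] at h3 ⊢
        linear_combination h3
    have hw1 := wt_pos ha (-n + 2 * j + 1, Y + 2 * σ) (true, δ)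
    have hw2 := wt_pos ha (-n + 2 * j - 1, Y + 2 * σ) (true, δ)
    calc wt a (-n + 2 * j + 1, Y + 2 * σ) (true, δ) * |r (-n + 2 * j + 1, Y + 2 * σ)|
        = |ks (false, δ) * (wt a (-n + 2 * j + 1, Y + 2 * σ) (true, δ)
          * r (-n + 2 * j + 1, Y + 2 * σ))| := by
          rw [abs_mul, abs_mul, hks, one_mul, abs_of_pos hw1]
      _ ≤ |wt a (-n + 2 * j - 1, Y + 2 * σ) (true, δ) * r (-n + 2 * j - 1, Y + 2 * σ)|
          + (|kc a (-n + 2 * j + 1, Y) (false, !δ) * r (-n + 2 * j + 1, Y)|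
            + |kc a (-n + 2 * j - 1, Y) (true, !δ) * r (-n + 2 * j - 1, Y)|) := by
          rw [h4]
          refine (abs_add_le _ _).trans ?_
          rw [abs_neg]
          refine add_le_add le_rfl ((abs_add_le _ _).trans ?_)
          rw [abs_neg, abs_neg]
      _ ≤ wt a (-n + 2 * j - 1, Y + 2 * σ) (true, δ) * |r (-n + 2 * j - 1, Y + 2 * σ)|
          + 2 * e m := by
          rw [abs_mul, abs_mul, abs_mul, abs_of_pos hw2]
          nlinarith [abs_nonneg (r (-n + 2 * j + 1, Y)), abs_nonneg (r (-n + 2 * j - 1, Y))]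

theorem smallErr (ha : a ∈ Set.Ioo (0 : ℝ) 1)
    (hR : ∀ᶠ m : ℕ in Filter.atTop, IsInvKer a (4 * ((m + 1 : ℕ) : ℤ)) (R m)) (i j : ℤ) :
    SmallErr a R (2 * i) (2 * j) := by
  have hrow : SmallErr a R 0 (2 * j) := by
    induction j using Int.induction_on with
    | zero => exact smallErr_zero ha hR
    | succ j ih =>
      have := ih.row ha hR Even.zero (even_two_mul _) (Or.inl rfl)
      rwa [show 2 * (j : ℤ) + 2 * 1 = 2 * (j + 1) by ring] at this
    | pred j ih =>
      have := ih.row ha hR Even.zero (even_two_mul _) (Or.inr rfl)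
      rwa [show 2 * (-(j : ℤ)) + 2 * -1 = 2 * (-j - 1) by ring] at this
  induction i using Int.induction_on with
  | zero => exact hrow
  | succ i ih =>
    have := ih.column ha hR (even_two_mul _) (even_two_mul _) (Or.inl rfl)
    rwa [show 2 * (i : ℤ) + 2 * 1 = 2 * (i + 1) by ring] at this
  | pred i ih =>
    have := ih.column ha hR (even_two_mul _) (even_two_mul _) (Or.inr rfl)
    rwa [show 2 * (-(i : ℤ)) + 2 * -1 = 2 * (-i - 1) by ring] at this

theorem tendsto_inverse_kernel (ha : a ∈ Set.Ioo (0 : ℝ) 1)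
    (hR : ∀ᶠ m : ℕ in Filter.atTop, IsInvKer a (4 * ((m + 1 : ℕ) : ℤ)) (R m)) {b v : ℤ × ℤ}
    (hb : BlackV b) (hv : WhiteV v) :
    Filter.Tendsto (fun m => R m b v) Filter.atTop (nhds (Ginf a b v)) := by
  obtain ⟨X, y⟩ := b
  obtain ⟨x, Y⟩ := v
  obtain ⟨⟨i, hi⟩, hy⟩ := hb
  obtain ⟨hx, ⟨j, hj⟩⟩ := hv
  simp only at hi hj hx hy
  obtain ⟨e, he, hev⟩ := smallErr ha hR i j
  have he0 : Filter.Tendsto e Filter.atTop (nhds 0) := by simpa using he 0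
  rw [← tendsto_sub_nhds_zero_iff]
  refine squeeze_zero_norm' (hev.mono fun m hm => ?_) he0
  have := hm y x hy hx
  rw [← two_mul] at hi hj
  subst hi hj
  rwa [Real.norm_eq_abs, abs_sub_comm]

end Limit

/-! ### The sign of a dimer configuration -/

/-- The white vertices of the Aztec diamond. -/
def boxW (n : ℤ) : Finset (ℤ × ℤ) :=
  (Finset.Icc (-n) n ×ˢ Finset.Icc (-n) n).filter WhiteV

/-- The black vertices of the Aztec diamond. -/
def boxB (n : ℤ) : Finset (ℤ × ℤ) :=
  (Finset.Icc (-n) n ×ˢ Finset.Icc (-n) n).filter BlackV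

lemma mem_boxW {n : ℤ} {v : ℤ × ℤ} : v ∈ boxW n ↔ WhiteV v ∧ inBox n v := by
  simp [boxW, inBox, abs_le, and_comm]

lemma mem_boxB {n : ℤ} {v : ℤ × ℤ} : v ∈ boxB n ↔ BlackV v ∧ inBox n v := by
  simp [boxB, inBox, abs_le, and_comm]

lemma card_boxB (n : ℤ) : (boxB n).card = (boxW n).card := by
  refine Finset.card_nbij' Prod.swap Prod.swap ?_ ?_ (fun _ _ => rfl) fun _ _ => rfl
  · intro v hv
    rw [Finset.mem_coe, mem_boxB] at hv
    exact mem_boxW.2 ⟨⟨hv.1.2, hv.1.1⟩, ⟨hv.2.2, hv.2.1⟩⟩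
  · intro v hv
    rw [Finset.mem_coe, mem_boxW] at hv
    exact mem_boxB.2 ⟨⟨hv.1.2, hv.1.1⟩, ⟨hv.2.2, hv.2.1⟩⟩

/-- The lexicographic order on the lattice. -/
def lexLt (v w : ℤ × ℤ) : Prop := v.1 < w.1 ∨ v.1 = w.1 ∧ v.2 < w.2

lemma exists_lex_enum (s : Finset (ℤ × ℤ)) {N : ℕ} (h : s.card = N) :
    ∃ e : Fin N ≃ s, ∀ i j, i < j ↔ lexLt (e i) (e j) := by
  let s' : Finset (ℤ ×ₗ ℤ) := s.map toLex.toEmbedding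
  have h' : s'.card = N := by rw [Finset.card_map, h]
  let φ := s'.orderIsoOfFin h'
  have key : ∀ x : ℤ × ℤ, x ∈ s ↔ toLex x ∈ s' := fun x => by simp [s']
  let ψ : s' ≃ s := (toLex.subtypeEquiv key).symm
  refine ⟨φ.toEquiv.trans ψ, fun i j => ?_⟩
  rw [← φ.lt_iff_lt, ← Subtype.coe_lt_coe]
  have h2 : ∀ i, (φ i : ℤ ×ₗ ℤ) = toLex ((φ.toEquiv.trans ψ i : s) : ℤ × ℤ) := fun i => rfl
  rw [h2, h2, Prod.Lex.toLex_lt_toLex]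
  rfl

/-- An enumeration of the white vertices in lexicographic order. -/
def enumW (n : ℤ) : Fin (boxW n).card ≃ boxW n := (exists_lex_enum (boxW n) rfl).choose

/-- An enumeration of the black vertices in lexicographic order. -/
def enumB (n : ℤ) : Fin (boxW n).card ≃ boxB n :=
  (exists_lex_enum (boxB n) (card_boxB n)).choose

lemma enumW_lt (n : ℤ) (i j) : i < j ↔ lexLt (enumW n i) (enumW n j) :=
  (exists_lex_enum (boxW n) rfl).choose_spec i j

lemma enumB_lt (n : ℤ) (i j) : i < j ↔ lexLt (enumB n i) (enumB n j) :=
  (exists_lex_enum (boxB n) (card_boxB n)).choose_spec i j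

/-- The order preserving bijection between white and black vertices. -/
def refB (n : ℤ) : boxW n ≃ boxB n := (enumW n).symm.trans (enumB n)

/-- The sign `-1` of a proposition. -/
def chi (P : Prop) : ℤ := if P then -1 else 1

lemma chi_mul_self (P : Prop) : chi P * chi P = 1 := by
  unfold chi; split_ifs <;> simp

lemma prod_chi {ι : Type*} (s : Finset ι) (P : ι → Prop) [DecidablePred P] :
    ∏ i ∈ s, chi (P i) = (-1) ^ (s.filter P).card := by
  have h : ∀ i, chi (P i) = if P i then -1 else 1 := fun i => by unfold chi; congr
  simp only [h, Finset.prod_ite, Finset.prod_const, one_pow, mul_one]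

lemma sign_eq_prod_chi (n : ℤ) (σ : boxW n ≃ boxB n) :
    ((Equiv.Perm.sign (σ.trans (refB n).symm) : ℤˣ) : ℤ)
      = ∏ w' : boxW n, ∏ w : boxW n, chi (lexLt w w' ∧ lexLt (σ w') (σ w)) := by
  rw [← Equiv.Perm.sign_trans_trans_symm (σ.trans (refB n).symm) (enumW n),
    Equiv.Perm.sign_eq_prod_prod_Iio]
  push_cast
  rw [← Equiv.prod_comp (enumW n)]
  refine Finset.prod_congr rfl fun j _ => ?_
  rw [← Equiv.prod_comp (enumW n)]
  rw [← Finset.prod_subset (Finset.subset_univ (Finset.Iio j))]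
  · refine Finset.prod_congr rfl fun i hi => ?_
    have hij := (enumW_lt n i j).1 (Finset.mem_Iio.1 hi)
    set ρ := ((enumW n).trans (σ.trans (refB n).symm)).trans (enumW n).symm with hρ
    have hne : ρ i ≠ ρ j := fun h => by
      rw [ρ.injective h] at hi
      simp at hi
    have hB : ∀ k, enumB n (ρ k) = σ (enumW n k) := fun k => by simp [hρ, refB]
    have := enumB_lt n (ρ j) (ρ i)
    rw [hB, hB] at this
    simp only [hij, true_and, ← this, chi]
    rcases lt_or_gt_of_ne hne with h | h
    · simp [h, h.le]
    · simp [h, h.le]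
  · intro i _ hi
    have : ¬ lexLt (enumW n i) (enumW n j) := by
      rw [← enumW_lt]
      simpa using hi
    simp [chi, this]

lemma chi_inversion {x y x' y' : ℤ} {d d' : Bool × Bool} (hw : WhiteV (x, y))
    (hw' : WhiteV (x', y'))
    (hinj : x + sg d.1 = x' + sg d'.1 → y + sg d.2 = y' + sg d'.2 → x = x' ∧ y = y')
    (hd : x = x' → y = y' → d = d') :
    chi (lexLt (x, y) (x', y') ∧ lexLt (x' + sg d'.1, y' + sg d'.2) (x + sg d.1, y + sg d.2))
      = (chi (d'.1 = false ∧ x = x' ∧ y < y')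
        * chi (d'.1 = false ∧ x + sg d.1 = x' + sg d'.1 ∧ y' + sg d'.2 < y + sg d.2))
        * (chi (d'.1 = false ∧ d.1 = false ∧ x = x' ∧ y < y')
        * chi (d.1 = false ∧ d'.1 = false ∧ x' = x ∧ y' < y)) := by
  obtain ⟨⟨s, hs⟩, ⟨t, ht⟩⟩ := hw
  obtain ⟨⟨s', hs'⟩, ⟨t', ht'⟩⟩ := hw'
  obtain ⟨d1, d2⟩ := d
  obtain ⟨e1, e2⟩ := d'
  simp only at hs ht hs' ht'
  unfold chi lexLt
  cases d1 <;> cases d2 <;> cases e1 <;> cases e2 <;> simp [sg] at hinj hd ⊢ <;>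
    (try split_ifs) <;> first | rfl | omega

lemma card_white_below {n : ℤ} {w : ℤ × ℤ} (hn : Even n) (hw : w ∈ boxW n) :
    (((Finset.univ : Finset (boxW n)).filter
      fun v => v.1.1 = w.1 ∧ v.1.2 < w.2).card : ℤ) * 2 = w.2 + n := by
  obtain ⟨⟨hw1, hw2⟩, hb⟩ := mem_boxW.1 hw
  simp only [inBox, abs_le] at hb
  obtain ⟨k, hk⟩ : ∃ k : ℕ, w.2 + n = 2 * k := by
    obtain ⟨i, hi⟩ := hn
    obtain ⟨j, hj⟩ := hw2
    exact ⟨(i + j).toNat, by omega⟩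
  rw [hk, mul_comm, Finset.card_bij' (t := Finset.range k)
    (fun v _ => ((v.1.2 + n) / 2).toNat) (fun i hi => ⟨(w.1, -n + 2 * (i : ℤ)), by
      rw [Finset.mem_range] at hi
      refine mem_boxW.2 ⟨⟨hw1, ?_⟩, ?_⟩
      · exact (hn.neg).add (even_two_mul _)
      · simp only [inBox, abs_le]; omega⟩), Finset.card_range]
  · rintro ⟨v, hvb⟩ hv
    obtain ⟨⟨-, ⟨j, hj⟩⟩, hb'⟩ := mem_boxW.1 hvb
    simp only [inBox, abs_le] at hb'
    obtain ⟨i, hi⟩ := hn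
    simp only [Finset.mem_filter, Finset.mem_univ, true_and, Finset.mem_range] at hv ⊢
    omega
  · intro i hi
    simp only [Finset.mem_filter, Finset.mem_univ, true_and, Finset.mem_range] at hi ⊢
    omega
  · rintro ⟨v, hvb⟩ hv
    simp only [Finset.mem_filter, Finset.mem_univ, true_and] at hv
    obtain ⟨⟨-, ⟨j, hj⟩⟩, hb'⟩ := mem_boxW.1 hvb
    obtain ⟨i, hi⟩ := hn
    simp only [inBox, abs_le] at hb'
    refine Subtype.ext (Prod.ext hv.1.symm ?_)
    simp only
    omega
  · intro i _
    simp

lemma card_black_above {n : ℤ} {b : ℤ × ℤ} (hn : Even n) (hb : b ∈ boxB n) :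
    (((Finset.univ : Finset (boxB n)).filter
      fun v => v.1.1 = b.1 ∧ b.2 < v.1.2).card : ℤ) * 2 = n - 1 - b.2 := by
  obtain ⟨⟨hw1, hw2⟩, hb⟩ := mem_boxB.1 hb
  simp only [inBox, abs_le] at hb
  obtain ⟨k, hk⟩ : ∃ k : ℕ, n - 1 - b.2 = 2 * k := by
    obtain ⟨i, hi⟩ := hn
    obtain ⟨j, hj⟩ := hw2
    exact ⟨(i - 1 - j).toNat, by omega⟩
  rw [hk, mul_comm, Finset.card_bij' (t := Finset.range k)
    (fun v _ => ((n - 1 - v.1.2) / 2).toNat) (fun i hi => ⟨(b.1, n - 1 - 2 * (i : ℤ)), by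
      rw [Finset.mem_range] at hi
      refine mem_boxB.2 ⟨⟨hw1, ?_⟩, ?_⟩
      · exact (hn.sub_odd odd_one).sub_even (even_two_mul _)
      · simp only [inBox, abs_le]; omega⟩), Finset.card_range]
  · rintro ⟨v, hvb⟩ hv
    obtain ⟨⟨-, ⟨j, hj⟩⟩, hb'⟩ := mem_boxB.1 hvb
    simp only [inBox, abs_le] at hb'
    obtain ⟨i, hi⟩ := hn
    simp only [Finset.mem_filter, Finset.mem_univ, true_and, Finset.mem_range] at hv ⊢
    omega
  · intro i hi
    simp only [Finset.mem_filter, Finset.mem_univ, true_and, Finset.mem_range] at hi ⊢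
    omega
  · rintro ⟨v, hvb⟩ hv
    simp only [Finset.mem_filter, Finset.mem_univ, true_and] at hv
    obtain ⟨⟨-, ⟨j, hj⟩⟩, hb'⟩ := mem_boxB.1 hvb
    obtain ⟨i, hi⟩ := hn
    simp only [inBox, abs_le] at hb'
    refine Subtype.ext (Prod.ext hv.1.symm ?_)
    simp only
    omega
  · intro i _
    simp only
    omega

/-- The sign of a dimer configuration times the product of its Kasteleyn signs only depends on
the number of edges going west. -/
theorem sign_mul_prod_ks {n : ℤ} (hn : Even n) (σ : boxW n ≃ boxB n)
    (δ : boxW n → Bool × Bool) (hσ : ∀ w, (σ w : ℤ × ℤ) = w + dv (δ w)) :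
    ((Equiv.Perm.sign (σ.trans (refB n).symm) : ℤˣ) : ℤ)
        * ∏ w, (if δ w = (false, false) then -1 else 1)
      = ∏ w, chi ((δ w).1 = false) := by
  have key : ∀ w' w : boxW n, chi (lexLt w w' ∧ lexLt (σ w') (σ w))
      = (chi ((δ w').1 = false ∧ w.1.1 = w'.1.1 ∧ w.1.2 < w'.1.2)
        * chi ((δ w').1 = false ∧ (σ w).1.1 = (σ w').1.1 ∧ (σ w').1.2 < (σ w).1.2))
        * (chi ((δ w').1 = false ∧ (δ w).1 = false ∧ w.1.1 = w'.1.1 ∧ w.1.2 < w'.1.2)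
        * chi ((δ w).1 = false ∧ (δ w').1 = false ∧ w'.1.1 = w.1.1 ∧ w'.1.2 < w.1.2)) := by
    intro w' w
    have h1 := hσ w
    have h2 := hσ w'
    have hinj : (σ w : ℤ × ℤ) = σ w' → w.1 = w'.1 := fun h => by
      rw [σ.injective (Subtype.ext h)]
    rw [h1, h2] at hinj ⊢
    obtain ⟨⟨x, y⟩, hw⟩ := w
    obtain ⟨⟨x', y'⟩, hw'⟩ := w'
    refine chi_inversion (mem_boxW.1 hw).1 (mem_boxW.1 hw').1 (fun e1 e2 => ?_) fun e1 e2 => ?_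
    · exact Prod.ext_iff.1 (hinj (Prod.ext e1 e2))
    · subst e1 e2; rfl
  rw [sign_eq_prod_chi]
  simp only [key]
  rw [Finset.prod_congr rfl fun w' _ => Finset.prod_mul_distrib,
    Finset.prod_mul_distrib]
  simp only [Finset.prod_mul_distrib]
  rw [Finset.prod_comm (f := fun w' w : boxW n => chi ((δ w).1 = false ∧ (δ w').1 = false ∧
    w'.1.1 = w.1.1 ∧ w'.1.2 < w.1.2))]
  simp only [← Finset.prod_mul_distrib, chi_mul_self, mul_one]
  refine Finset.prod_congr rfl fun w _ => ?_
  rw [Finset.prod_mul_distrib]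
  by_cases hL : (δ w).1 = false
  · simp only [hL, true_and]
    rw [prod_chi, Equiv.prod_comp σ fun b : boxB n => chi (b.1.1 = (σ w).1.1 ∧
      (σ w).1.2 < b.1.2), prod_chi, ← pow_add]
    have h1 := card_white_below hn w.2
    have h2 := card_black_above hn (σ w).2
    have h3 := hσ w
    rw [h3] at h2 ⊢
    obtain ⟨i, hi⟩ := hn
    rcases hd : δ w with ⟨d1, d2⟩
    rw [hd] at hL h2
    simp only at hL
    subst hL
    set A := ((Finset.univ : Finset (boxW n)).filter fun v => v.1.1 = w.1.1 ∧ v.1.2 < w.1.2).card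
    set B := ((Finset.univ : Finset (boxB n)).filter fun v =>
      v.1.1 = (w.1 + dv (false, d2)).1 ∧ (w.1 + dv (false, d2)).2 < v.1.2).card
    simp only [dv, Prod.snd_add] at h2
    cases d2
    · simp only [sg, Bool.false_eq_true, if_false] at h2
      have : Even (A + B) := by
        rw [← Int.even_coe_nat]
        push_cast
        exact ⟨(i : ℤ), by omega⟩
      rw [this.neg_one_pow]
      simp [chi]
    · simp only [sg, if_true] at h2
      have : Odd (A + B) := by
        rw [← Int.odd_coe_nat]
        push_cast
        exact ⟨(i : ℤ) - 1, by omega⟩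
      rw [this.neg_one_pow]
      simp [chi]
  · have : δ w ≠ (false, false) := fun h => hL (by rw [h])
    simp [hL, this, chi]

lemma card_west {n : ℤ} (σ : boxW n ≃ boxB n)
    (δ : boxW n → Bool × Bool) (hσ : ∀ w, (σ w : ℤ × ℤ) = w + dv (δ w)) :
    2 * (((Finset.univ : Finset (boxW n)).filter fun w => (δ w).1 = false).card : ℤ)
      = (boxW n).card + ∑ w ∈ boxW n, w.1 - ∑ b ∈ boxB n, b.1 := by
  have h1 : ∑ b ∈ boxB n, b.1 = ∑ w ∈ boxW n, w.1 + ∑ w : boxW n, sg (δ w).1 := by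
    rw [← Finset.sum_coe_sort (boxB n), ← Finset.sum_coe_sort (boxW n),
      ← Equiv.sum_comp σ, ← Finset.sum_add_distrib]
    refine Finset.sum_congr rfl fun w _ => ?_
    rw [hσ]; rfl
  have h2 : ∀ w : boxW n, sg (δ w).1 = 1 - 2 * if (δ w).1 = false then 1 else 0 := by
    intro w
    cases (δ w).1 <;> simp [sg]
  simp only [h2, Finset.sum_sub_distrib, ← Finset.mul_sum, Finset.sum_boole] at h1
  simp only [Finset.sum_const, Finset.card_univ, Fintype.card_coe, nsmul_eq_mul, mul_one] at h1
  linarith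

/-- The Kasteleyn sign theorem for the Aztec diamond. -/
theorem exists_kasteleyn_sign {n : ℤ} (hn : Even n) : ∃ s : ℝ, s * s = 1 ∧
    ∀ (σ : boxW n ≃ boxB n) (δ : boxW n → Bool × Bool),
      (∀ w, (σ w : ℤ × ℤ) = w + dv (δ w)) →
      ((Equiv.Perm.sign (σ.trans (refB n).symm) : ℤˣ) : ℝ) * ∏ w, ks (δ w) = s := by
  by_cases h : ∃ (σ : boxW n ≃ boxB n) (δ : boxW n → Bool × Bool),
      ∀ w, (σ w : ℤ × ℤ) = w + dv (δ w)
  · obtain ⟨σ₀, δ₀, h₀⟩ := h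
    refine ⟨((∏ w, chi ((δ₀ w).1 = false) : ℤ) : ℝ), ?_, fun σ δ hσ => ?_⟩
    · rw [← Int.cast_mul, ← Finset.prod_mul_distrib]
      simp only [chi_mul_self, Finset.prod_const_one, Int.cast_one]
    · have h1 := sign_mul_prod_ks hn σ δ hσ
      have h2 := card_west σ δ hσ
      rw [← card_west σ₀ δ₀ h₀] at h2
      rw [prod_chi] at h1 ⊢
      rw [show (((Finset.univ : Finset (boxW n)).filter fun w => (δ₀ w).1 = false).card)
        = (((Finset.univ : Finset (boxW n)).filter fun w => (δ w).1 = false).card) by omega,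
        ← h1]
      push_cast
      congr 1
  · push Not at h
    refine ⟨1, one_mul 1, fun σ δ hσ => ?_⟩
    obtain ⟨w, hw⟩ := h σ δ
    exact absurd (hσ w) hw

/-! ### Partition functions as determinants -/

lemma dv_injective : Function.Injective dv := by
  rintro ⟨a, b⟩ ⟨c, d⟩ h
  simp only [dv, Prod.mk.injEq] at h
  revert h
  cases a <;> cases b <;> cases c <;> cases d <;> simp [sg]

lemma mem_diagDirs {v : ℤ × ℤ} : v ∈ diagDirs ↔ ∃ d, v = dv d := by
  constructor
  · rintro (h | h | h | h)
    exacts [⟨(true, true), h⟩, ⟨(true, false), h⟩, ⟨(false, true), h⟩, ⟨(false, false), h⟩]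
  · rintro ⟨⟨a, b⟩, rfl⟩
    cases a <;> cases b <;> simp [diagDirs, dv, sg]

lemma edgeWeight_eq (a : ℝ) {v : ℤ × ℤ} (hv : WhiteV v) (d : Bool × Bool) :
    edgeWeight a (v, v + dv d) = wt a v d := by
  obtain ⟨⟨s, hs⟩, ⟨t, ht⟩⟩ := hv
  obtain ⟨d1, d2⟩ := d
  unfold edgeWeight wt aFaceP northA
  congr 1
  simp only [dv, Prod.fst_add, Prod.snd_add, hs, ht, Int.odd_iff, eq_iff_iff]
  cases d1 <;> cases d2 <;> simp [sg] <;> omega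

/-- The Kasteleyn matrix entry of a pair, restricted to the pairs allowed by `A`. -/
def Kp (a : ℝ) (A : ℤ × ℤ → ℤ × ℤ → Prop) (w b : ℤ × ℤ) : ℝ :=
  ∑ d, if b = w + dv d ∧ A w b then kc a w d else 0

lemma Kp_of_adj (a : ℝ) (A : ℤ × ℤ → ℤ × ℤ → Prop) (w : ℤ × ℤ) (d : Bool × Bool) :
    Kp a A w (w + dv d) = if A w (w + dv d) then kc a w d else 0 := by
  unfold Kp
  rw [Finset.sum_eq_single d]
  · simp
  · intro e _ he
    rw [if_neg]
    rintro ⟨h, -⟩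
    exact he (dv_injective (add_left_cancel h)).symm
  · simp

lemma Kp_of_not (a : ℝ) (A : ℤ × ℤ → ℤ × ℤ → Prop) (w b : ℤ × ℤ)
    (h : ¬ ((∃ d, b = w + dv d) ∧ A w b)) : Kp a A w b = 0 :=
  Finset.sum_eq_zero fun d _ => if_neg fun h' => h ⟨⟨d, h'.1⟩, h'.2⟩

/-- The Kasteleyn matrix of the Aztec diamond restricted to the pairs allowed by `A`. -/
def KM (a : ℝ) (n : ℤ) (A : ℤ × ℤ → ℤ × ℤ → Prop) : Matrix (boxW n) (boxW n) ℝ :=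
  fun w w' => Kp a A w (refB n w')

lemma inBox_mem_boxB {n : ℤ} {w b : ℤ × ℤ} (hw : WhiteV w) (hb : inBox n b)
    (h : b - w ∈ diagDirs) : b ∈ boxB n := by
  obtain ⟨d, hd⟩ := mem_diagDirs.1 h
  rw [sub_eq_iff_eq_add, add_comm] at hd
  exact mem_boxB.2 ⟨hd ▸ blackV_add_dv hw d, hb⟩

/-- The set of dimers of a bijection. -/
def graphSet {n : ℤ} (σ : boxW n ≃ boxB n) : Set ((ℤ × ℤ) × (ℤ × ℤ)) :=
  Set.range fun w : boxW n => ((w : ℤ × ℤ), (σ w : ℤ × ℤ))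

lemma bijOn_graphSet (n : ℤ) (A : ℤ × ℤ → ℤ × ℤ → Prop) :
    Set.BijOn (graphSet (n := n)) {σ | ∀ w, (∃ d, (σ w : ℤ × ℤ) = w + dv d) ∧ A w (σ w)}
      {M | IsAztecMatching n M ∧ ∀ p ∈ M, A p.1 p.2} := by
  refine ⟨?_, ?_, ?_⟩
  · intro σ hσ
    refine ⟨⟨?_, ?_, ?_⟩, ?_⟩
    · rintro _ ⟨w, rfl⟩
      refine ⟨(mem_boxW.1 w.2).1, ?_, (mem_boxW.1 w.2).2, (mem_boxB.1 (σ w).2).2⟩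
      obtain ⟨d, hd⟩ := (hσ w).1
      refine mem_diagDirs.2 ⟨d, ?_⟩
      simp only [hd, add_sub_cancel_left]
    · intro v hv hvn
      refine ⟨σ ⟨v, mem_boxW.2 ⟨hv, hvn⟩⟩, ⟨⟨v, _⟩, rfl⟩, ?_⟩
      rintro b ⟨w, hw⟩
      obtain ⟨rfl, rfl⟩ := Prod.ext_iff.1 hw
      rfl
    · intro b hb hbn
      refine ⟨σ.symm ⟨b, mem_boxB.2 ⟨hb, hbn⟩⟩, ⟨σ.symm ⟨b, mem_boxB.2 ⟨hb, hbn⟩⟩, by simp⟩, ?_⟩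
      rintro v ⟨w, hw⟩
      obtain ⟨rfl, rfl⟩ := Prod.ext_iff.1 hw
      simp
    · rintro _ ⟨w, rfl⟩
      exact (hσ w).2
  · intro σ _ τ _ h
    ext1 w
    have : ((w : ℤ × ℤ), (σ w : ℤ × ℤ)) ∈ graphSet τ := h ▸ ⟨w, rfl⟩
    obtain ⟨w', hw'⟩ := this
    obtain ⟨h1, h2⟩ := Prod.ext_iff.1 hw'
    have : w' = w := Subtype.ext h1
    subst this
    exact Subtype.ext h2.symm
  · rintro M ⟨⟨h1, h2, h3⟩, h4⟩
    have hex : ∀ w : boxW n, ∃ b : boxB n, ((w : ℤ × ℤ), (b : ℤ × ℤ)) ∈ M := by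
      rintro ⟨w, hw⟩
      obtain ⟨b, hb, -⟩ := h2 w (mem_boxW.1 hw).1 (mem_boxW.1 hw).2
      exact ⟨⟨b, inBox_mem_boxB (h1 _ hb).1 (h1 _ hb).2.2.2 (h1 _ hb).2.1⟩, hb⟩
    choose f hf using hex
    have hbij : Function.Bijective f := by
      constructor
      · intro w w' h
        have h5 := hf w'
        rw [← h] at h5
        exact Subtype.ext ((h3 _ (mem_boxB.1 (f w).2).1 (mem_boxB.1 (f w).2).2).unique
          (hf w) h5)
      · rintro ⟨b, hb⟩
        obtain ⟨v, hv, -⟩ := h3 b (mem_boxB.1 hb).1 (mem_boxB.1 hb).2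
        have hvW : v ∈ boxW n := mem_boxW.2 ⟨(h1 _ hv).1, (h1 _ hv).2.2.1⟩
        refine ⟨⟨v, hvW⟩, Subtype.ext ?_⟩
        exact (h2 v (mem_boxW.1 hvW).1 (mem_boxW.1 hvW).2).unique (hf ⟨v, hvW⟩) hv
    refine ⟨Equiv.ofBijective f hbij, fun w => ⟨?_, h4 _ (hf w)⟩, ?_⟩
    · obtain ⟨d, hd⟩ := mem_diagDirs.1 (h1 _ (hf w)).2.1
      rw [sub_eq_iff_eq_add, add_comm] at hd
      exact ⟨d, hd⟩
    · ext ⟨v, b⟩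
      constructor
      · rintro ⟨w, hw⟩
        rw [← hw]
        exact hf w
      · intro hp
        have hvW : v ∈ boxW n := mem_boxW.2 ⟨(h1 _ hp).1, (h1 _ hp).2.2.1⟩
        refine ⟨⟨v, hvW⟩, Prod.ext rfl ?_⟩
        exact (h2 v (mem_boxW.1 hvW).1 (mem_boxW.1 hvW).2).unique (hf ⟨v, hvW⟩) hp

/-- Kasteleyn's theorem for the Aztec diamond with restricted edges. -/
theorem exists_sum_configWeight_eq_det (a : ℝ) {n : ℤ} (hn : Even n) : ∃ s : ℝ, s * s = 1 ∧
    ∀ A : ℤ × ℤ → ℤ × ℤ → Prop,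
      ∑ᶠ M ∈ {M | IsAztecMatching n M ∧ ∀ p ∈ M, A p.1 p.2}, configWeight a M
        = s * (KM a n A).det := by
  obtain ⟨s, hs, hsign⟩ := exists_kasteleyn_sign hn
  refine ⟨s, hs, fun A => ?_⟩
  rw [← finsum_mem_eq_of_bijOn (f := fun σ => ∏ w : boxW n,
    edgeWeight a ((w : ℤ × ℤ), (σ w : ℤ × ℤ))) _ (bijOn_graphSet n A)]
  swap
  · intro σ _
    unfold configWeight graphSet
    rw [finprod_mem_range, finprod_eq_prod_of_fintype]
    intro w w' h
    exact Subtype.ext (Prod.ext_iff.1 h).1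
  rw [finsum_mem_def, finsum_eq_sum_of_fintype, ← Matrix.det_transpose, Matrix.det_apply,
    Finset.mul_sum]
  symm
  refine Fintype.sum_equiv (Equiv.equivCongr (Equiv.refl _) (refB n)) _ _ fun π => ?_
  set σ := Equiv.equivCongr (Equiv.refl _) (refB n) π with hσ
  have hσπ : ∀ w, σ w = refB n (π w) := fun w => rfl
  have hπ : π = σ.trans (refB n).symm := by
    ext1 w
    simp [hσπ]
  simp only [Matrix.transpose_apply, KM, ← hσπ]
  by_cases h : ∀ w, (∃ d, (σ w : ℤ × ℤ) = w + dv d) ∧ A w (σ w)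
  · rw [Set.indicator_of_mem (show σ ∈ {σ : boxW n ≃ boxB n | ∀ w, (∃ d, (σ w : ℤ × ℤ) = w + dv d) ∧ A w (σ w)} from h)]
    have hA := fun w => (h w).2
    choose δ hδ using fun w => (h w).1
    rw [← hsign σ δ hδ, ← hπ]
    have h1 : ∀ w : boxW n, Kp a A w (σ w) = ks (δ w) * edgeWeight a (w, σ w) := by
      intro w
      have := hA w
      rw [hδ w] at this ⊢
      rw [Kp_of_adj, if_pos this, edgeWeight_eq a (mem_boxW.1 w.2).1, kc]
    simp only [h1, Finset.prod_mul_distrib]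
    have h2 : (∏ w, ks (δ w)) * ∏ w, ks (δ w) = 1 := by
      rw [← Finset.prod_mul_distrib]
      refine Finset.prod_eq_one fun w _ => ?_
      unfold ks; split_ifs <;> simp
    have h3 : ((Equiv.Perm.sign π : ℤˣ) : ℝ) * ((Equiv.Perm.sign π : ℤˣ) : ℝ) = 1 := by
      rw [← Int.cast_mul, ← Units.val_mul, Int.units_mul_self]
      simp
    rw [Units.smul_def, zsmul_eq_mul]
    linear_combination (∏ w : boxW n, edgeWeight a (w, σ w)) * (h3 *
      ((∏ w, ks (δ w)) * ∏ w, ks (δ w)) + h2)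
  · rw [Set.indicator_of_notMem (show σ ∉ {σ : boxW n ≃ boxB n | ∀ w, (∃ d, (σ w : ℤ × ℤ) = w + dv d) ∧ A w (σ w)} from h)]
    push Not at h
    obtain ⟨w, hw⟩ := h
    rw [Finset.prod_eq_zero (Finset.mem_univ w), smul_zero, mul_zero]
    exact Kp_of_not _ _ _ _ fun h => hw h.1 h.2

/-! ### Cylinder probabilities -/

/-- No restriction on pairs. -/
def anyPair (_ _ : ℤ × ℤ) : Prop := True

lemma sum_boxB_ite {n : ℤ} {b₀ : ℤ × ℤ} (c : ℝ) (F : ℤ × ℤ → ℝ) (h : b₀ ∉ boxB n → F b₀ = 0) :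
    ∑ b : boxB n, (if (b : ℤ × ℤ) = b₀ then c else 0) * F b = c * F b₀ := by
  rw [Finset.sum_coe_sort (boxB n) fun b => (if b = b₀ then c else 0) * F b]
  by_cases hb : b₀ ∈ boxB n
  · rw [Finset.sum_eq_single_of_mem b₀ hb fun b _ hne => by rw [if_neg hne, zero_mul], if_pos rfl]
  · rw [h hb, mul_zero]
    refine Finset.sum_eq_zero fun b hb' => ?_
    rw [if_neg, zero_mul]
    rintro rfl
    exact hb hb'

lemma sum_boxW_ite {n : ℤ} {b₀ : ℤ × ℤ} (F c : ℤ × ℤ → ℝ) (h : b₀ ∉ boxW n → F b₀ = 0) :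
    ∑ b : boxW n, F b * (if (b : ℤ × ℤ) = b₀ then c b else 0) = F b₀ * c b₀ := by
  rw [Finset.sum_coe_sort (boxW n) fun b => F b * (if b = b₀ then c b else 0)]
  by_cases hb : b₀ ∈ boxW n
  · rw [Finset.sum_eq_single_of_mem b₀ hb fun b _ hne => by rw [if_neg hne, mul_zero], if_pos rfl]
  · rw [h hb, zero_mul]
    refine Finset.sum_eq_zero fun b hb' => ?_
    rw [if_neg, mul_zero]
    rintro rfl
    exact hb hb'

lemma sum_KM_mul {a : ℝ} {n : ℤ} (F : ℤ × ℤ → ℝ) (v : boxW n)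
    (hF : ∀ d, (v : ℤ × ℤ) + dv d ∉ boxB n → F (v + dv d) = 0) :
    ∑ w, KM a n anyPair v w * F (refB n w) = latK a F v := by
  unfold KM
  rw [Equiv.sum_comp (refB n) fun b => Kp a anyPair v b * F b]
  simp only [Kp, anyPair, and_true, Finset.sum_mul, latK]
  rw [Finset.sum_comm]
  exact Finset.sum_congr rfl fun d _ => sum_boxB_ite _ _ (hF d)

lemma sum_mul_KM {a : ℝ} {n : ℤ} (F : ℤ × ℤ → ℝ) (b : boxB n)
    (hF : ∀ v, v ∉ boxW n → F v = 0) :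
    ∑ w : boxW n, F w * KM a n anyPair w ((refB n).symm b)
      = ∑ d, F (b - dv d) * kc a (b - dv d) d := by
  simp only [KM, Kp, anyPair, and_true, Finset.mul_sum, Equiv.apply_symm_apply]
  rw [Finset.sum_comm]
  refine Finset.sum_congr rfl fun d _ => ?_
  rw [← sum_boxW_ite F (fun w => kc a w d) (hF _)]
  simp only [eq_sub_iff_add_eq, eq_comm]

/-- The inverse Kasteleyn matrix as a function on the lattice. -/
def invK (a : ℝ) (n : ℤ) (b v : ℤ × ℤ) : ℝ :=
  if h : b ∈ boxB n ∧ v ∈ boxW n then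
    (KM a n anyPair)⁻¹ ((refB n).symm ⟨b, h.1⟩) ⟨v, h.2⟩ else 0

lemma invK_refB (a : ℝ) (n : ℤ) (w v : boxW n) :
    invK a n (refB n w) v = (KM a n anyPair)⁻¹ w v := by
  unfold invK
  rw [dif_pos ⟨(refB n w).2, v.2⟩]
  simp

lemma invK_eq_zero (a : ℝ) {n : ℤ} {b v : ℤ × ℤ} (h : ¬ (b ∈ boxB n ∧ v ∈ boxW n)) :
    invK a n b v = 0 := dif_neg h

theorem isInvKer_invK {a : ℝ} {n : ℤ} (hn : Even n) (h : IsUnit (KM a n anyPair).det) :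
    IsInvKer a n (invK a n) where
  zero_black b v hb := invK_eq_zero a fun h => hb (mem_boxB.1 h.1).2
  zero_white b v hv := invK_eq_zero a fun h => hv (mem_boxW.1 h.2).2
  right_inv v v' hv hvn hv' hvn' := by
    have h1 := congr_fun (congr_fun (Matrix.mul_nonsing_inv _ h) ⟨v', mem_boxW.2 ⟨hv', hvn'⟩⟩)
      ⟨v, mem_boxW.2 ⟨hv, hvn⟩⟩
    rw [Matrix.mul_apply] at h1
    simp only [← invK_refB] at h1
    rw [sum_KM_mul (fun b => invK a n b v) _ fun d hd => invK_eq_zero a fun h => hd h.1] at h1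
    rw [h1, Matrix.one_apply]
    simp
  left_inv b b' hb hbn hb' hbn' := by
    have h1 := congr_fun (congr_fun (Matrix.nonsing_inv_mul _ h)
      ((refB n).symm ⟨b, mem_boxB.2 ⟨hb, hbn⟩⟩)) ((refB n).symm ⟨b', mem_boxB.2 ⟨hb', hbn'⟩⟩)
    rw [Matrix.mul_apply] at h1
    simp only [← invK_refB, Equiv.apply_symm_apply] at h1
    rw [sum_mul_KM (fun v => invK a n b v) _ fun v hv => invK_eq_zero a fun h => hv h.2] at h1
    rw [h1, Matrix.one_apply]
    simp [eq_comm]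
  unique F hF v hv hvn hlat b hb hbn := by
    have h1 : (KM a n anyPair).mulVec (fun w => F (refB n w))
        = Pi.single (⟨v, mem_boxW.2 ⟨hv, hvn⟩⟩ : boxW n) 1 := by
      ext w
      obtain ⟨hw, hwn⟩ := mem_boxW.1 w.2
      rw [Matrix.mulVec, dotProduct, sum_KM_mul, hlat _ hw hwn, Pi.single_apply]
      · simp [Subtype.ext_iff]
      · intro d hd
        have hbl := blackV_add_dv hw d
        refine hF _ hbl ?_
        by_contra! hle
        refine hd (mem_boxB.2 ⟨hbl, ?_, hle⟩)
        obtain ⟨⟨i, hi⟩, -⟩ := hw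
        obtain ⟨j, hj⟩ := hn
        have := hwn.1
        rw [abs_le] at this ⊢
        rw [Prod.fst_add]
        have h2 : (dv d).1 = 1 ∨ (dv d).1 = -1 := by
          obtain ⟨d1, d2⟩ := d
          cases d1 <;> simp [dv, sg]
        omega
    have h2 := congr_arg (fun f => (KM a n anyPair)⁻¹.mulVec f) h1
    simp only [Matrix.mulVec_mulVec, Matrix.nonsing_inv_mul _ h, Matrix.one_mulVec,
      Matrix.mulVec_single_one] at h2
    have h3 := congr_fun h2 ((refB n).symm ⟨b, mem_boxB.2 ⟨hb, hbn⟩⟩)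
    simp only [Equiv.apply_symm_apply, Matrix.col_apply, ← invK_refB] at h3
    exact h3

/-- The pairs compatible with the dimers `(v i, v i + dv (d i))`. -/
def compat {ι : Type*} (v : ι → ℤ × ℤ) (d : ι → Bool × Bool) (w b : ℤ × ℤ) : Prop :=
  ∀ i, v i = w → b = w + dv (d i)

theorem det_KM_compat {a : ℝ} {n : ℤ} {ι : Type*} [Fintype ι] {v : ι → ℤ × ℤ}
    (hv : Function.Injective v) (hvn : ∀ i, v i ∈ boxW n) (d : ι → Bool × Bool)
    (h : IsUnit (KM a n anyPair).det) :
    (KM a n (compat v d)).det = (KM a n anyPair).det *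
      (Matrix.of fun i j => kc a (v i) (d i) * invK a n (v i + dv (d i)) (v j)).det := by
  let v' : ι → boxW n := fun i => ⟨v i, hvn i⟩
  have hv' : Function.Injective v' := fun i j hij => hv (Subtype.ext_iff.1 hij)
  let U : Matrix (boxW n) ι ℝ := fun w i => if w = v' i then 1 else 0
  let V : Matrix ι (boxW n) ℝ := fun i w =>
    KM a n (compat v d) (v' i) w - KM a n anyPair (v' i) w
  have hUV : KM a n (compat v d) = KM a n anyPair + U * V := by
    ext w w'
    rw [Matrix.add_apply, Matrix.mul_apply]
    simp only [U, V, ite_mul, one_mul, zero_mul]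
    by_cases hw : ∃ i, w = v' i
    · obtain ⟨i, rfl⟩ := hw
      rw [Finset.sum_eq_single i]
      · simp
      · intro j _ hj
        rw [if_neg fun h => hj (hv' h.symm)]
      · simp
    · push Not at hw
      rw [Finset.sum_eq_zero fun i _ => if_neg (hw i), add_zero]
      have : compat v d w (refB n w') := fun i hi => absurd (Subtype.ext hi.symm) (hw i)
      simp [KM, Kp, this, anyPair]
  rw [hUV, Matrix.det_add_mul U V h]
  congr 2
  ext i j
  have hcol : ∀ M : Matrix ι (boxW n) ℝ, (M * U) i j = M i (v' j) := by
    intro M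
    rw [Matrix.mul_apply]
    simp [U]
  rw [Matrix.add_apply, hcol, Matrix.mul_apply, Matrix.of_apply]
  simp only [V, sub_mul, Finset.sum_sub_distrib]
  rw [← Matrix.mul_apply (M := KM a n anyPair), Matrix.mul_nonsing_inv _ h, Matrix.one_apply,
    Matrix.one_apply]
  simp only [hv'.eq_iff]
  rw [add_sub_cancel]
  simp only [← invK_refB]
  unfold KM
  rw [Equiv.sum_comp (refB n) fun b => Kp a (compat v d) (v' i) b * invK a n b (v' j),
    ← sum_boxB_ite (n := n) (kc a (v i) (d i)) (fun b => invK a n b (v j))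
      fun hb => invK_eq_zero a fun h => hb h.1]
  refine Finset.sum_congr rfl fun b _ => ?_
  congr 1
  have hc : compat v d (v' i) b ↔ (b : ℤ × ℤ) = v i + dv (d i) := by
    constructor
    · exact fun h => h i rfl
    · intro h k hk
      rw [hv hk]
      exact h
  by_cases hb : (b : ℤ × ℤ) = v i + dv (d i)
  · rw [if_pos hb, hb]
    exact (Kp_of_adj _ _ _ _).trans (if_pos (hb ▸ hc.2 hb))
  · rw [if_neg hb]
    exact Kp_of_not _ _ _ _ fun h => hb (hc.1 h.2)

section
open MeasureTheory Filter

theorem measure_eq_det {a : ℝ} (ha : a ∈ Set.Ioo (0 : ℝ) 1) {Ω : Type*} [MeasurableSpace Ω]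
    (ℙ : Measure Ω) [IsProbabilityMeasure ℙ] {D : Ω → Set ((ℤ × ℤ) × (ℤ × ℤ))}
    (hlim : ∀ E : Finset ((ℤ × ℤ) × (ℤ × ℤ)),
      Tendsto (fun m : ℕ => aztecCylProb a (4 * ((m : ℤ) + 1)) E) atTop
        (nhds ((ℙ {ω | ∀ e ∈ E, e ∈ D ω}).toReal)))
    {ι : Type*} [Fintype ι] {v : ι → ℤ × ℤ} (hv : Function.Injective v) (hvw : ∀ i, WhiteV (v i))
    (d : ι → Bool × Bool) :
    (ℙ {ω | ∀ i, (v i, v i + dv (d i)) ∈ D ω}).toReal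
      = (Matrix.of fun i j => kc a (v i) (d i) * Ginf a (v i + dv (d i)) (v j)).det := by
  have hn : ∀ m : ℕ, Even (4 * ((m : ℤ) + 1)) := fun m => ⟨2 * (m + 1), by ring⟩
  choose s hs hdet using fun m : ℕ => exists_sum_configWeight_eq_det a (hn m)
  have hs0 : ∀ m, s m ≠ 0 := fun m h0 => by simpa [h0] using hs m
  have hZ : ∀ m : ℕ, aztecZ a (4 * ((m : ℤ) + 1))
      = s m * (KM a (4 * ((m : ℤ) + 1)) anyPair).det := by
    intro m
    rw [← hdet]
    simp [aztecZ, anyPair]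
  have hunit : ∀ᶠ m : ℕ in atTop, IsUnit (KM a (4 * ((m : ℤ) + 1)) anyPair).det := by
    have h0 := hlim ∅
    simp only [Finset.notMem_empty, IsEmpty.forall_iff, implies_true, Set.ofPred_true,
      measure_univ, ENNReal.toReal_one] at h0
    filter_upwards [h0.eventually_ne one_ne_zero] with m hm
    refine isUnit_iff_ne_zero.2 fun h => hm ?_
    rw [aztecCylProb, hZ, h, mul_zero, div_zero]
  have hbox : ∀ᶠ m : ℕ in atTop, ∀ i, v i ∈ boxW (4 * ((m : ℤ) + 1)) := by
    rw [eventually_all]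
    intro i
    filter_upwards [eventually_ge_atTop (|(v i).1| + |(v i).2|).toNat] with m hm
    have h1 := abs_nonneg (v i).1
    have h2 := abs_nonneg (v i).2
    exact mem_boxW.2 ⟨hvw i, by constructor <;> omega⟩
  have hker : ∀ᶠ m : ℕ in atTop, IsInvKer a (4 * ((m + 1 : ℕ) : ℤ)) (invK a (4 * ((m : ℤ) + 1))) := by
    filter_upwards [hunit] with m hm
    rw [Nat.cast_add, Nat.cast_one]
    exact isInvKer_invK (hn m) hm
  let E : Finset ((ℤ × ℤ) × (ℤ × ℤ)) := Finset.univ.image fun i => (v i, v i + dv (d i))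
  have hE : ∀ S : Set ((ℤ × ℤ) × (ℤ × ℤ)), (∀ e ∈ E, e ∈ S) ↔ ∀ i, (v i, v i + dv (d i)) ∈ S := by
    intro S
    simp [E]
  have h1 := hlim E
  simp only [hE] at h1
  refine tendsto_nhds_unique h1 ?_
  have h2 : Tendsto (fun m : ℕ => (Matrix.of fun i j => kc a (v i) (d i) *
      invK a (4 * ((m : ℤ) + 1)) (v i + dv (d i)) (v j)).det) atTop
      (nhds (Matrix.of fun i j => kc a (v i) (d i) * Ginf a (v i + dv (d i)) (v j)).det) := by
    refine ((Continuous.matrix_det continuous_id).tendsto _).comp ?_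
    refine tendsto_pi_nhds.2 fun i => tendsto_pi_nhds.2 fun j => ?_
    exact (tendsto_inverse_kernel ha hker (blackV_add_dv (hvw i) _) (hvw j)).const_mul _
  refine h2.congr' ?_
  filter_upwards [hunit, hbox] with m hm hbm
  have h3 : {M | IsAztecMatching (4 * ((m : ℤ) + 1)) M ∧ ∀ e ∈ E, e ∈ M}
      = {M | IsAztecMatching (4 * ((m : ℤ) + 1)) M ∧ ∀ p ∈ M, compat v d p.1 p.2} := by
    ext M
    simp only [Set.mem_ofPred_eq, hE]
    refine and_congr_right fun hM => ⟨?_, ?_⟩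
    · rintro h ⟨w, b⟩ hp i hi
      simp only at hi ⊢
      subst hi
      exact (hM.2.1 _ (hvw i) (mem_boxW.1 (hbm i)).2).unique hp (h i)
    · intro h i
      obtain ⟨b, hb, -⟩ := hM.2.1 _ (hvw i) (mem_boxW.1 (hbm i)).2
      have := h _ hb i rfl
      simp only at this
      rwa [← this]
  rw [aztecCylProb, h3, hdet, hZ, det_KM_compat hv hbm d hm]
  have := hm.ne_zero
  have := hs0 m
  field_simp

end

/-! ### The law of the south forest -/

/-- The vertical drift factor of a direction. -/
def ea (a : ℝ) (d : Bool × Bool) : ℝ := if d.2 then a else a⁻¹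

lemma gr_neg_one_mul {r : ℝ} {s t : ℤ × ℤ} (hs : northA s) (ht : northA t) (hs' : WhiteV s)
    (ht' : WhiteV t) :
    gr (-1) r (s - t) = ((Int.negOnePow ((s.1 - s.2 - 1) / 4) : ℤ) : ℝ)
      * ((Int.negOnePow ((t.1 - t.2 - 1) / 4) : ℤ) : ℝ) * gr 1 r (s - t) := by
  obtain ⟨⟨p, hp⟩, ⟨q, hq⟩⟩ := hs'
  obtain ⟨⟨p', hp'⟩, ⟨q', hq'⟩⟩ := ht'
  unfold northA at hs ht
  rw [gr_neg_one]
  congr 1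
  have h : ((s - t).1 - (s - t).2) / 4 = (s.1 - s.2 - 1) / 4 - (t.1 - t.2 - 1) / 4 := by
    simp only [Prod.fst_sub, Prod.snd_sub]
    omega
  rw [h, Int.negOnePow_sub]
  push_cast
  rfl

lemma northA_add {v : ℤ × ℤ} (hv : northA v) (d : Bool × Bool) : northA (v + 2 • dv d) := by
  obtain ⟨d1, d2⟩ := d
  unfold northA at *
  cases d1 <;> cases d2 <;> simp [dv, sg] <;> omega

lemma whiteV_add {v : ℤ × ℤ} (hv : WhiteV v) (d : Bool × Bool) : WhiteV (v + 2 • dv d) := by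
  obtain ⟨⟨p, hp⟩, ⟨q, hq⟩⟩ := hv
  exact ⟨⟨p + sg d.1, by simp [dv, hp]; ring⟩, ⟨q + sg d.2, by simp [dv, hq]; ring⟩⟩

lemma kc_mul_Ginf {a : ℝ} (ha : a ∈ Set.Ioo (0 : ℝ) 1) {v w : ℤ × ℤ} (hv : northA v)
    (hw : northA w) (hv' : WhiteV v) (hw' : WhiteV w) (d : Bool × Bool) :
    kc a v d * Ginf a (v + dv d) w
      = kap a * (ea a d * gr (-1) (kap a) (v - w) - ds d * gr (-1) (kap a) (v + 2 • dv d - w)) := by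
  have ha0 : a ≠ 0 := ha.1.ne'
  have hz : ∀ u : ℤ × ℤ, ¬ northA u → gr (-1) (kap a) (u - w) = 0 := by
    intro u hu
    refine gr_eq_zero_of_not_inLam _ _ _ fun h => hu ?_
    obtain ⟨⟨p, hp⟩, ⟨q, hq⟩⟩ := hw'
    obtain ⟨⟨c, hc⟩, ⟨e, he⟩⟩ := h
    simp only [Prod.fst_sub, Prod.snd_sub] at hc he
    unfold northA at *
    omega
  have hsh := northA_shift hv' d
  have h2 := northA_add hv d
  simp only [Ginf, adjK, kc, wt, hsh, sum_dirs]
  rw [show (v + 2 • dv d - w : ℤ × ℤ) = v + 2 • dv d - w from rfl]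
  obtain ⟨d1, d2⟩ := d
  have hz1 := hz (v + dv (d1, d2) - dv (d1, !d2))
    (by rw [northA_shift hv']; cases d1 <;> cases d2 <;> simp [hv])
  have hz2 := hz (v + dv (d1, d2) - dv (!d1, d2))
    (by rw [northA_shift hv']; cases d1 <;> cases d2 <;> simp [hv])
  have h3 : v + dv (d1, d2) - dv (d1, d2) = v := by abel
  have h4 : v + dv (d1, d2) - dv (!d1, !d2) = v + 2 • dv (d1, d2) := by
    have : dv (!d1, !d2) = - dv (d1, d2) := by cases d1 <;> cases d2 <;> simp [dv, sg]
    rw [this]; abel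
  cases d1 <;> cases d2 <;> simp only [Bool.not_true, Bool.not_false] at * <;>
    simp only [hz1, hz2, h3, h4, hv] <;> simp [ks, ds, ea] <;> field_simp <;> ring

theorem measure_eq_det_walk {a : ℝ} (ha : a ∈ Set.Ioo (0 : ℝ) 1) {Ω : Type*} [MeasurableSpace Ω]
    (ℙ : MeasureTheory.Measure Ω) [MeasureTheory.IsProbabilityMeasure ℙ]
    {D : Ω → Set ((ℤ × ℤ) × (ℤ × ℤ))}
    (hlim : ∀ E : Finset ((ℤ × ℤ) × (ℤ × ℤ)),
      Filter.Tendsto (fun m : ℕ => aztecCylProb a (4 * ((m : ℤ) + 1)) E) Filter.atTop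
        (nhds ((ℙ {ω | ∀ e ∈ E, e ∈ D ω}).toReal)))
    {ι : Type*} [Fintype ι] {v : ι → ℤ × ℤ} (hv : Function.Injective v)
    (hvw : ∀ i, WhiteV (v i)) (hvn : ∀ i, northA (v i)) (d : ι → Bool × Bool) :
    (ℙ {ω | ∀ i, (v i, v i + dv (d i)) ∈ D ω}).toReal
      = kap a ^ Fintype.card ι * (Matrix.of fun i j =>
        ea a (d i) * gr 1 (kap a) (v i - v j) - gr 1 (kap a) (v i + 2 • dv (d i) - v j)).det := by
  rw [measure_eq_det ha ℙ hlim hv hvw d]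
  set ε : ι → ℝ := fun i => ((Int.negOnePow (((v i).1 - (v i).2 - 1) / 4) : ℤ) : ℝ) with hε
  have hεε : ∀ i, ε i * ε i = 1 := by
    intro i
    simp only [hε]
    rcases Int.units_eq_one_or (Int.negOnePow (((v i).1 - (v i).2 - 1) / 4)) with h | h <;> simp [h]
  set B : Matrix ι ι ℝ := Matrix.of fun i j =>
        ea a (d i) * gr 1 (kap a) (v i - v j) - gr 1 (kap a) (v i + 2 • dv (d i) - v j) with hB
  have hA : (Matrix.of fun i j => kc a (v i) (d i) * Ginf a (v i + dv (d i)) (v j))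
      = Matrix.of fun i j => ε i * (Matrix.of fun i j => ε j * (kap a • B) i j) i j := by
    ext i j
    simp only [Matrix.of_apply, Matrix.smul_apply, smul_eq_mul, hB]
    rw [kc_mul_Ginf ha (hvn i) (hvn j) (hvw i) (hvw j),
      gr_neg_one_mul (hvn i) (hvn j) (hvw i) (hvw j),
      gr_neg_one_mul (northA_add (hvn i) _) (hvn j) (whiteV_add (hvw i) _) (hvw j)]
    have h : ((Int.negOnePow (((v i + 2 • dv (d i)).1 - (v i + 2 • dv (d i)).2 - 1) / 4) : ℤ) : ℝ)
        = ε i * ds (d i) := by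
      have h1 := hvn i
      obtain ⟨⟨p, hp⟩, ⟨q, hq⟩⟩ := hvw i
      unfold northA at h1
      rcases hd : d i with ⟨d1, d2⟩
      have h2 : ((v i + 2 • dv (d1, d2)).1 - (v i + 2 • dv (d1, d2)).2 - 1) / 4
          = ((v i).1 - (v i).2 - 1) / 4 + (sg d1 - sg d2) / 2 := by
        cases d1 <;> cases d2 <;> simp [dv, sg] <;> omega
      rw [h2, Int.negOnePow_add]
      simp only [hε]
      push_cast
      congr 1
      cases d1 <;> cases d2 <;> simp [ds, sg]
    rw [h]
    have hds : ds (d i) * ds (d i) = 1 := by unfold ds; split_ifs <;> norm_num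
    simp only [hε]
    linear_combination (-(kap a) * ((Int.negOnePow (((v i).1 - (v i).2 - 1) / 4) : ℤ) : ℝ)
      * ((Int.negOnePow (((v j).1 - (v j).2 - 1) / 4) : ℤ) : ℝ)
      * gr 1 (kap a) (v i + 2 • dv (d i) - v j)) * hds
  rw [hA, Matrix.det_mul_column, Matrix.det_mul_row, ← mul_assoc, ← Finset.prod_mul_distrib,
    Finset.prod_congr rfl fun i _ => hεε i, Finset.prod_const_one, one_mul, Matrix.det_smul]

/-! ### Killed kernels -/

/-- Remove the point `x` from a kernel by one step of Gaussian elimination. -/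
def elim (G : ℤ × ℤ → ℤ × ℤ → ℝ) (x u v : ℤ × ℤ) : ℝ := G u v - G u x * G x v / G x x

/-- The elimination step for a function accompanying a kernel. -/
def elimV (G : ℤ × ℤ → ℤ × ℤ → ℝ) (X : ℤ × ℤ → ℝ) (x u : ℤ × ℤ) : ℝ :=
  X u - G u x * X x / G x x

/-- The walk kernel killed on a list of points. -/
def gA (r : ℝ) : List (ℤ × ℤ) → ℤ × ℤ → ℤ × ℤ → ℝ
  | [] => fun u v => gr 1 r (u - v)
  | x :: A => elim (gA r A) x

/-- A function eliminated along a list of points. -/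
def XA (r : ℝ) (X : ℤ × ℤ → ℝ) : List (ℤ × ℤ) → ℤ × ℤ → ℝ
  | [] => X
  | x :: A => elimV (gA r A) (XA r X A) x

lemma nonneg_of_superharmonic {r : ℝ} (hr : 0 ≤ r) (hr' : 4 * r < 1) {S : Set (ℤ × ℤ)}
    {F : ℤ × ℤ → ℝ} {C : ℝ} (hC : ∀ u, |F u| ≤ C) (h0 : ∀ u ∈ S, 0 ≤ F u)
    (h1 : ∀ u, u ∉ S → r * ∑ e, F (u + 2 • dv e) ≤ F u) (u : ℤ × ℤ) : 0 ≤ F u := by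
  have hC0 : 0 ≤ C := (abs_nonneg _).trans (hC 0)
  have key : ∀ (n : ℕ) (u : ℤ × ℤ), -((4 * r) ^ n * C) ≤ F u := by
    intro n
    induction n with
    | zero => intro u; simpa using (abs_le.1 (hC u)).1
    | succ n ih =>
      intro u
      by_cases hu : u ∈ S
      · have : 0 ≤ (4 * r) ^ (n + 1) * C := by positivity
        linarith [h0 u hu]
      · refine le_trans ?_ (h1 u hu)
        have := Finset.sum_le_sum fun e (_ : e ∈ (Finset.univ : Finset (Bool × Bool))) =>
          ih (u + 2 • dv e)
        rw [sum_dirs] at this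
        calc -((4 * r) ^ (n + 1) * C) = r * (-((4 * r) ^ n * C) + -((4 * r) ^ n * C)
              + (-((4 * r) ^ n * C) + -((4 * r) ^ n * C))) := by ring
          _ ≤ _ := mul_le_mul_of_nonneg_left this hr
  have ht : Filter.Tendsto (fun n : ℕ => -((4 * r) ^ n * C)) Filter.atTop (nhds (-(0 * C))) :=
    ((tendsto_pow_atTop_nhds_zero_of_lt_one (by linarith) hr').mul_const C).neg
  have := le_of_tendsto' ht fun n => key n u
  simpa using this

structure KilledKernel (r : ℝ) (A : List (ℤ × ℤ)) : Prop where
  bdd : ∀ v, ∃ C, ∀ u, |gA r A u v| ≤ C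
  eq_zero : ∀ u ∈ A, ∀ v, gA r A u v = 0
  eqn : ∀ u, u ∉ A → ∀ v,
    gA r A u v = (if u = v then 1 else 0) + r * ∑ e, gA r A (u + 2 • dv e) v

lemma KilledKernel.nonneg {r : ℝ} (hr : 0 ≤ r) (hr' : 4 * r < 1) {A : List (ℤ × ℤ)}
    (h : KilledKernel r A) (u v : ℤ × ℤ) : 0 ≤ gA r A u v := by
  obtain ⟨C, hC⟩ := h.bdd v
  refine nonneg_of_superharmonic hr hr' (S := {u | u ∈ A}) (F := fun u => gA r A u v) hC
    (fun u hu => (h.eq_zero u hu v).ge) (fun u hu => ?_) u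
  rw [h.eqn u hu v]
  split_ifs <;> linarith

lemma KilledKernel.one_le {r : ℝ} (hr : 0 ≤ r) (hr' : 4 * r < 1) {A : List (ℤ × ℤ)}
    (h : KilledKernel r A) {x : ℤ × ℤ} (hx : x ∉ A) : 1 ≤ gA r A x x := by
  rw [h.eqn x hx x, if_pos rfl]
  have := mul_nonneg hr (Finset.sum_nonneg fun e (_ : e ∈ Finset.univ) =>
    h.nonneg hr hr' (x + 2 • dv e) x)
  linarith

theorem killedKernel {r : ℝ} (hr : 0 ≤ r) (hr' : 4 * r < 1) (A : List (ℤ × ℤ)) :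
    KilledKernel r A := by
  induction A with
  | nil =>
    refine ⟨fun v => ⟨(4 * r) ^ 0 / (1 - 4 * r), fun u => ?_⟩, by simp, fun u _ v => ?_⟩
    · refine abs_gr_le_of_dist (Or.inl rfl) hr hr' 0 (u - v) ?_
      have : 0 ≤ max |(u - v).1| |(u - v).2| := le_max_of_le_left (abs_nonneg _)
      push_cast; linarith
    · have := gr_one_eq hr hr' (u - v)
      simp only [gA]
      rw [← sub_eq_iff_eq_add]
      simp only [sub_eq_zero] at this
      rw [← this]
      congr! 4
      abel
  | cons x A ih =>
    by_cases hx : x ∈ A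
    · have h0 : gA r (x :: A) = gA r A := by
        funext u v; simp [gA, elim, ih.eq_zero x hx x]
      have hm : ∀ u, u ∈ x :: A ↔ u ∈ A := fun u => by
        rw [List.mem_cons]
        exact ⟨fun h => h.elim (fun h => h ▸ hx) id, Or.inr⟩
      exact ⟨by rw [h0]; exact ih.bdd, by simp only [hm, h0]; exact ih.eq_zero,
        by simp only [hm, h0]; exact ih.eqn⟩
    · have h1 : gA r A x x ≠ 0 := by have := ih.one_le hr hr' hx; linarith
      refine ⟨fun v => ?_, fun u hu v => ?_, fun u hu v => ?_⟩
      · obtain ⟨C, hC⟩ := ih.bdd v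
        obtain ⟨C', hC'⟩ := ih.bdd x
        refine ⟨C + C' * |gA r A x v / gA r A x x|, fun u => ?_⟩
        simp only [gA, elim, mul_div_assoc]
        refine (abs_sub _ _).trans (add_le_add (hC u) ?_)
        rw [abs_mul]
        exact mul_le_mul_of_nonneg_right (hC' u) (abs_nonneg _)
      · simp only [gA, elim]
        rcases List.mem_cons.1 hu with rfl | hu
        · field_simp; ring
        · rw [ih.eq_zero u hu, ih.eq_zero u hu]; simp
      · rw [List.mem_cons, not_or] at hu
        simp only [gA, elim]
        rw [Finset.sum_sub_distrib, ← Finset.sum_div, ← Finset.sum_mul, ih.eqn u hu.2 v,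
          ih.eqn u hu.2 x, if_neg hu.1]
        ring

lemma gA_nonneg {r : ℝ} (hr : 0 ≤ r) (hr' : 4 * r < 1) (A : List (ℤ × ℤ)) (u v : ℤ × ℤ) :
    0 ≤ gA r A u v := (killedKernel hr hr' A).nonneg hr hr' u v

lemma gA_mono {r s : ℝ} (hr : 0 ≤ r) (hrs : r ≤ s) (hs' : 4 * s < 1) (A : List (ℤ × ℤ))
    (u v : ℤ × ℤ) : gA r A u v ≤ gA s A u v := by
  have hr' : 4 * r < 1 := by linarith
  have hs : 0 ≤ s := hr.trans hrs
  have h1 := killedKernel hr hr' A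
  have h2 := killedKernel hs hs' A
  obtain ⟨C, hC⟩ := h1.bdd v
  obtain ⟨C', hC'⟩ := h2.bdd v
  have := nonneg_of_superharmonic hs hs' (S := {u | u ∈ A})
    (F := fun u => gA s A u v - gA r A u v) (C := C' + C)
    (fun u => (abs_sub _ _).trans (add_le_add (hC' u) (hC u)))
    (fun u hu => by simp [h1.eq_zero u hu v, h2.eq_zero u hu v])
    (fun u hu => by
      rw [h1.eqn u hu v, h2.eqn u hu v, Finset.sum_sub_distrib]
      have := mul_nonneg (sub_nonneg.2 hrs) (Finset.sum_nonneg fun e (_ : e ∈ Finset.univ) =>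
        h1.nonneg hr hr' (u + 2 • dv e) v)
      linarith) u
  linarith

lemma XA_eq_zero {r : ℝ} (hr : 0 ≤ r) (hr' : 4 * r < 1) (X : ℤ × ℤ → ℝ) (A : List (ℤ × ℤ)) :
    ∀ u ∈ A, XA r X A u = 0 := by
  induction A with
  | nil => simp
  | cons x A ih =>
    intro u hu
    simp only [XA, elimV]
    rcases List.mem_cons.1 hu with rfl | hu
    · by_cases hx : u ∈ A
      · rw [ih u hx]; simp
      · have h1 : gA r A u u ≠ 0 := by
          have := (killedKernel hr hr' A).one_le hr hr' hx; linarith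
        field_simp; ring
    · rw [ih u hu, (killedKernel hr hr' A).eq_zero u hu]; simp

/-- The expected lifetime of the killed walk. -/
def hA (r : ℝ) (A : List (ℤ × ℤ)) : ℤ × ℤ → ℝ := XA r (fun _ => 1 / (1 - 4 * r)) A

lemma hA_spec {r : ℝ} (hr : 0 ≤ r) (hr' : 4 * r < 1) (A : List (ℤ × ℤ)) :
    (∃ C, ∀ u, |hA r A u| ≤ C) ∧ ∀ u, u ∉ A → hA r A u = 1 + r * ∑ e, hA r A (u + 2 • dv e) := by
  induction A with
  | nil =>
    refine ⟨⟨|1 / (1 - 4 * r)|, fun u => le_rfl⟩, fun u _ => ?_⟩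
    have : 1 - 4 * r ≠ 0 := by linarith
    simp [hA, XA]
    field_simp; ring
  | cons x A ih =>
    obtain ⟨⟨C, hC⟩, h⟩ := ih
    have hk := killedKernel hr hr' A
    constructor
    · obtain ⟨C', hC'⟩ := hk.bdd x
      refine ⟨C + C' * |hA r A x / gA r A x x|, fun u => ?_⟩
      simp only [hA, XA, elimV, mul_div_assoc]
      refine (abs_sub _ _).trans (add_le_add (hC u) ?_)
      rw [abs_mul]
      exact mul_le_mul_of_nonneg_right (hC' u) (abs_nonneg _)
    · intro u hu
      rw [List.mem_cons, not_or] at hu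
      have h1 := h u hu.2
      simp only [hA, XA, elimV] at h1 ⊢
      rw [Finset.sum_sub_distrib, ← Finset.sum_div, ← Finset.sum_mul, h1, hk.eqn u hu.2 x,
        if_neg hu.1]
      ring

lemma hA_nonneg {r : ℝ} (hr : 0 ≤ r) (hr' : 4 * r < 1) (A : List (ℤ × ℤ)) (u : ℤ × ℤ) :
    0 ≤ hA r A u := by
  obtain ⟨⟨C, hC⟩, h⟩ := hA_spec hr hr' A
  exact nonneg_of_superharmonic hr hr' (S := {u | u ∈ A}) hC
    (fun u hu => (XA_eq_zero hr hr' _ A u hu).ge) (fun u hu => by rw [h u hu]; linarith) u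

lemma hA_eq {r : ℝ} (hr : 0 ≤ r) (hr' : 4 * r < 1) (A : List (ℤ × ℤ)) (x : ℤ × ℤ) :
    hA r A x = gA r A x x * (1 + r * ∑ e, hA r (x :: A) (x + 2 • dv e)) := by
  have hk := killedKernel hr hr' A
  by_cases hx : x ∈ A
  · rw [hk.eq_zero x hx x, zero_mul]; exact XA_eq_zero hr hr' _ A x hx
  · have h1 := (hA_spec hr hr' A).2 x hx
    have h2 := hk.eqn x hx x
    have h3 : gA r A x x ≠ 0 := by have := hk.one_le hr hr' hx; linarith
    rw [if_pos rfl] at h2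
    have h4 : ∑ e, hA r (x :: A) (x + 2 • dv e) = ∑ e, hA r A (x + 2 • dv e)
        - (∑ e, gA r A (x + 2 • dv e) x) * hA r A x / gA r A x x := by
      simp only [hA, XA, elimV]
      rw [Finset.sum_sub_distrib, ← Finset.sum_div, ← Finset.sum_mul]
    rw [h4]
    field_simp
    linear_combination gA r A x x * h1 - hA r A x * h2

/-! ### Bordered determinants -/

/-- The kernel matrix of a sequence of points, bordered by a function. -/
def bord (k : ℕ) (G : ℤ × ℤ → ℤ × ℤ → ℝ) (X : ℤ × ℤ → ℝ) (γ : ℕ → ℤ × ℤ) :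
    Matrix (Fin (k + 1)) (Fin (k + 1)) ℝ :=
  Matrix.of fun i j => if (j : ℕ) < k then G (γ i) (γ j) else X (γ i)

lemma det_bord_succ (k : ℕ) (G : ℤ × ℤ → ℤ × ℤ → ℝ) (X : ℤ × ℤ → ℝ) (γ : ℕ → ℤ × ℤ)
    (h : G (γ 0) (γ 0) ≠ 0) :
    (bord (k + 1) G X γ).det = G (γ 0) (γ 0)
      * (bord k (elim G (γ 0)) (elimV G X (γ 0)) fun i => γ (i + 1)).det := by
  set B : Matrix (Fin (k + 2)) (Fin (k + 2)) ℝ := Matrix.of fun i j =>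
    if i = 0 then bord (k + 1) G X γ 0 j else
      bord (k + 1) G X γ i j - G (γ i) (γ 0) / G (γ 0) (γ 0) * bord (k + 1) G X γ 0 j with hB
  have h1 : (bord (k + 1) G X γ).det = B.det := by
    refine Matrix.det_eq_of_forall_row_eq_smul_add_const
      (fun i => if i = 0 then 0 else G (γ i) (γ 0) / G (γ 0) (γ 0)) 0 (by simp) ?_
    intro i j
    simp only [hB, Matrix.of_apply]
    by_cases hi : i = 0
    · subst hi; simp
    · simp [hi]
  rw [h1, Matrix.det_succ_column_zero, Fin.sum_univ_succ, Finset.sum_eq_zero]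
  · simp only [Fin.val_zero, pow_zero, one_mul, add_zero, Fin.succAbove_zero]
    congr 1
    · congr 1
      ext i j
      simp only [hB, Matrix.submatrix_apply, Matrix.of_apply, bord, Fin.succ_ne_zero, if_false,
        Fin.val_succ, Fin.val_zero, elim, elimV, add_lt_add_iff_right]
      split_ifs <;> ring
  · intro i _
    have : B i.succ 0 = 0 := by
      simp [hB, bord, Fin.succ_ne_zero]
      field_simp; ring
    rw [this]; simp

lemma mul_det_eq_det_bord (k : ℕ) (G : ℤ × ℤ → ℤ × ℤ → ℝ) (X : ℤ × ℤ → ℝ) (γ : ℕ → ℤ × ℤ)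
    (c : Fin k → ℝ) (hc : ∀ i, c i ≠ 0) (hX : ∀ i : Fin k, X (γ (i + 1)) = c i * X (γ i)) :
    X (γ 0) * (Matrix.of fun i j : Fin k => c i * G (γ i) (γ j) - G (γ (i + 1)) (γ j)).det
      = (bord k G X γ).det := by
  set T : Matrix (Fin (k + 1)) (Fin (k + 1)) ℝ := Matrix.of fun i j =>
    if j = i then (Fin.lastCases 1 c i : ℝ) else if (j : ℕ) = i + 1 then -1 else 0 with hT
  have hdT : T.det = ∏ i, c i := by
    rw [Matrix.det_of_isUpperTriangular, Fin.prod_univ_castSucc]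
    · simp [hT]
    · intro i j hij
      simp only [id] at hij
      simp only [hT, Matrix.of_apply]
      rw [if_neg hij.ne, if_neg]
      have := Fin.lt_def.1 hij
      omega
  have hrow : ∀ (i : Fin k) j, (T * bord k G X γ) i.castSucc j
      = c i * bord k G X γ i.castSucc j - bord k G X γ i.succ j := by
    intro i j
    rw [Matrix.mul_apply, Finset.sum_eq_add i.castSucc i.succ (Fin.castSucc_lt_succ).ne]
    · have e1 : T i.castSucc i.castSucc = c i := by simp [hT]
      have e2 : T i.castSucc i.succ = -1 := by
        simp [hT, (Fin.castSucc_lt_succ (i := i)).ne']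
      rw [e1, e2]; ring
    · intro l _ hl
      simp only [hT, Matrix.of_apply]
      rw [if_neg hl.1, if_neg, zero_mul]
      intro h
      exact hl.2 (Fin.ext (by simpa using h))
    · simp
    · simp
  have hlast : ∀ j, (T * bord k G X γ) (Fin.last k) j = bord k G X γ (Fin.last k) j := by
    intro j
    rw [Matrix.mul_apply, Finset.sum_eq_single (Fin.last k)]
    · simp [hT]
    · intro l _ hl
      simp only [hT, Matrix.of_apply]
      rw [if_neg hl, if_neg, zero_mul]
      have := l.is_lt
      simp; omega
    · simp
  have hprod : X (γ k) = (∏ i, c i) * X (γ 0) := by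
    have : ∀ m (hm : m ≤ k), X (γ m) = (∏ i : Fin m, c (Fin.castLE hm i)) * X (γ 0) := by
      intro m
      induction m with
      | zero => simp
      | succ m ih =>
        intro hm
        rw [Fin.prod_univ_castSucc, hX ⟨m, hm⟩, ih (by omega)]
        simp only [Fin.castLE_castSucc]
        have : Fin.castLE hm (Fin.last m) = ⟨m, hm⟩ := rfl
        rw [this]
        ring
    simpa using this k le_rfl
  have hdet : (T * bord k G X γ).det = X (γ k)
      * (Matrix.of fun i j : Fin k => c i * G (γ i) (γ j) - G (γ (i + 1)) (γ j)).det := by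
    rw [Matrix.det_succ_column _ (Fin.last k), Finset.sum_eq_single (Fin.last k)]
    · rw [hlast]
      simp only [Fin.val_last, Fin.succAbove_last, ← two_mul, pow_mul, neg_one_sq, one_pow, one_mul]
      congr 1
      · simp [bord]
      · congr 1
        ext i j
        rw [Matrix.submatrix_apply, hrow]
        simp [bord]
    · intro i _ hi
      obtain ⟨i', rfl⟩ := Fin.exists_castSucc_eq.2 hi
      rw [hrow]
      simp [bord, hX]
    · simp
  rw [Matrix.det_mul, hdT, hprod] at hdet
  have : (∏ i, c i) ≠ 0 := Finset.prod_ne_zero_iff.2 fun i _ => hc i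
  apply mul_left_cancel₀ this
  rw [hdet]; ring

/-! ### Walks given by words -/

/-- The positions of a walk with steps given by a word. -/
def gam (x : ℤ × ℤ) : List (Bool × Bool) → ℕ → ℤ × ℤ
  | [], _ => x
  | _ :: _, 0 => x
  | d :: w, i + 1 => gam (x + 2 • dv d) w i

/-- The end point of a walk. -/
def fin (x : ℤ × ℤ) : List (Bool × Bool) → ℤ × ℤ
  | [] => x
  | d :: w => fin (x + 2 • dv d) w

/-- The visited points of a walk, the last one excluded, most recent first. -/
def vis (A : List (ℤ × ℤ)) (x : ℤ × ℤ) : List (Bool × Bool) → List (ℤ × ℤ)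
  | [] => A
  | d :: w => vis (x :: A) (x + 2 • dv d) w

/-- The product of killed kernels along a walk. -/
def Wg (r : ℝ) (A : List (ℤ × ℤ)) (x : ℤ × ℤ) : List (Bool × Bool) → ℝ
  | [] => 1
  | d :: w => gA r A x x * Wg r (x :: A) (x + 2 • dv d) w

/-- The walk follows the edges of `S`. -/
def follows (S : Set ((ℤ × ℤ) × (ℤ × ℤ))) (x : ℤ × ℤ) : List (Bool × Bool) → Prop
  | [] => True
  | d :: w => (x, x + dv d) ∈ S ∧ follows S (x + 2 • dv d) w

lemma gam_zero (x : ℤ × ℤ) (w : List (Bool × Bool)) : gam x w 0 = x := by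
  cases w <;> rfl

lemma gam_succ (x : ℤ × ℤ) (w : List (Bool × Bool)) (i : Fin w.length) :
    gam x w (i + 1) = gam x w i + 2 • dv (w.get i) := by
  induction w generalizing x with
  | nil => exact i.elim0
  | cons d w ih =>
    refine Fin.cases ?_ (fun i => ?_) i
    · simp [gam, gam_zero]
    · exact ih _ i

lemma vis_eq (A : List (ℤ × ℤ)) (x : ℤ × ℤ) (w : List (Bool × Bool)) :
    vis A x w = ((List.range w.length).map (gam x w)).reverse ++ A := by
  induction w generalizing x A with
  | nil => simp [vis]
  | cons d w ih =>
    rw [vis, ih, List.length_cons, List.range_succ_eq_map, List.map_cons, List.reverse_cons]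
    simp [gam, Function.comp_def]

lemma vis_append (A : List (ℤ × ℤ)) (x : ℤ × ℤ) (w : List (Bool × Bool)) (d : Bool × Bool) :
    vis A x (w ++ [d]) = fin x w :: vis A x w := by
  induction w generalizing x A with
  | nil => rfl
  | cons e w ih => exact ih _ _

lemma follows_append {S : Set ((ℤ × ℤ) × (ℤ × ℤ))} {x : ℤ × ℤ} {w w' : List (Bool × Bool)}
    (h : follows S x (w ++ w')) : follows S x w := by
  induction w generalizing x with
  | nil => trivial
  | cons e w ih => exact ⟨h.1, ih h.2⟩

lemma follows_iff (S : Set ((ℤ × ℤ) × (ℤ × ℤ))) (x : ℤ × ℤ) (w : List (Bool × Bool)) :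
    follows S x w ↔ ∀ i : Fin w.length, (gam x w i, gam x w i + dv (w.get i)) ∈ S := by
  induction w generalizing x with
  | nil => simp [follows]
  | cons d w ih =>
    rw [follows, ih]
    exact (Fin.forall_fin_succ (P := fun i : Fin (w.length + 1) =>
      (gam x (d :: w) i, gam x (d :: w) i + dv ((d :: w).get i)) ∈ S)).symm

lemma gam_class {x : ℤ × ℤ} (hx : WhiteV x) (hx' : northA x) (w : List (Bool × Bool)) (i : ℕ) :
    WhiteV (gam x w i) ∧ northA (gam x w i) := by
  induction w generalizing x i with
  | nil => exact ⟨hx, hx'⟩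
  | cons d w ih =>
    cases i with
    | zero => exact ⟨hx, hx'⟩
    | succ i => exact ih (whiteV_add hx d) (northA_add hx' d) i

lemma vis_nodup_of {A : List (ℤ × ℤ)} {x : ℤ × ℤ} {w : List (Bool × Bool)}
    (h : (vis A x w).Nodup) : A.Nodup := by
  rw [vis_eq] at h
  exact h.of_append_right

lemma gam_injOn {x : ℤ × ℤ} {w : List (Bool × Bool)} (h : (vis [] x w).Nodup) :
    Function.Injective fun i : Fin w.length => gam x w i := by
  rw [vis_eq, List.append_nil, List.nodup_reverse] at h
  intro i j hij
  exact Fin.ext (List.inj_on_of_nodup_map h (List.mem_range.2 i.2) (List.mem_range.2 j.2) hij)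

lemma Wg_pos {r : ℝ} (hr : 0 ≤ r) (hr' : 4 * r < 1) {A : List (ℤ × ℤ)} {x : ℤ × ℤ}
    {w : List (Bool × Bool)} (h : (vis A x w).Nodup) : 0 < Wg r A x w := by
  induction w generalizing A x with
  | nil => exact one_pos
  | cons d w ih =>
    have h1 : x ∉ A := (List.nodup_cons.1 (vis_nodup_of (show (vis (x :: A) _ w).Nodup from h))).1
    have := (killedKernel hr hr' A).one_le hr hr' h1
    exact mul_pos (by linarith) (ih h)

lemma Wg_nonneg {r : ℝ} (hr : 0 ≤ r) (hr' : 4 * r < 1) (A : List (ℤ × ℤ)) (x : ℤ × ℤ)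
    (w : List (Bool × Bool)) : 0 ≤ Wg r A x w := by
  induction w generalizing A x with
  | nil => exact zero_le_one
  | cons d w ih => exact mul_nonneg (gA_nonneg hr hr' _ _ _) (ih _ _)

lemma Wg_mono {r s : ℝ} (hr : 0 ≤ r) (hrs : r ≤ s) (hs' : 4 * s < 1) (A : List (ℤ × ℤ))
    (x : ℤ × ℤ) (w : List (Bool × Bool)) : Wg r A x w ≤ Wg s A x w := by
  induction w generalizing A x with
  | nil => exact le_rfl
  | cons d w ih =>
    exact mul_le_mul (gA_mono hr hrs hs' _ _ _) (ih _ _) (Wg_nonneg hr (by linarith) _ _ _)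
      (gA_nonneg (hr.trans hrs) hs' _ _ _)

theorem det_bord_walk {r : ℝ} (hr : 0 ≤ r) (hr' : 4 * r < 1) (X : ℤ × ℤ → ℝ) {A : List (ℤ × ℤ)}
    {x : ℤ × ℤ} {w : List (Bool × Bool)} (h : (vis A x w).Nodup) :
    (bord w.length (gA r A) (XA r X A) (gam x w)).det
      = Wg r A x w * XA r X (vis A x w) (fin x w) := by
  induction w generalizing A x with
  | nil => simp [bord, gam, Wg, vis, fin]
  | cons d w ih =>
    have h1 : x ∉ A := (List.nodup_cons.1 (vis_nodup_of (show (vis (x :: A) _ w).Nodup from h))).1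
    have h2 := (killedKernel hr hr' A).one_le hr hr' h1
    rw [List.length_cons, det_bord_succ _ _ _ _ (by rw [gam_zero]; linarith), gam_zero]
    have := ih (A := x :: A) (x := x + 2 • dv d) h
    simp only [gA, XA] at this
    rw [Wg, vis, fin, mul_assoc, ← this]
    rfl

/-! ### Bounds on the south forest paths -/

/-- The vertical exponential function. -/
def drift (a : ℝ) (u : ℤ × ℤ) : ℝ := a ^ (u.2 / 2)

lemma drift_pos {a : ℝ} (ha : 0 < a) (u : ℤ × ℤ) : 0 < drift a u := zpow_pos ha _

lemma ea_pos {a : ℝ} (ha : 0 < a) (d : Bool × Bool) : 0 < ea a d := by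
  unfold ea; split_ifs <;> positivity

lemma drift_add {a : ℝ} (ha : 0 < a) (u : ℤ × ℤ) (d : Bool × Bool) :
    drift a (u + 2 • dv d) = ea a d * drift a u := by
  rcases d with ⟨d1, d2⟩
  cases d2
  · have : (u + 2 • dv (d1, false)).2 / 2 = -1 + u.2 / 2 := by simp [dv, sg]; omega
    rw [drift, this, zpow_add₀ ha.ne']; simp [ea, drift]
  · have : (u + 2 • dv (d1, true)).2 / 2 = 1 + u.2 / 2 := by simp [dv, sg]; omega
    rw [drift, this, zpow_add₀ ha.ne']; simp [ea, drift]

section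
variable {a : ℝ} {Ω : Type*} [MeasurableSpace Ω] {ℙ : MeasureTheory.Measure Ω}
    [MeasureTheory.IsProbabilityMeasure ℙ] {D : Ω → Set ((ℤ × ℤ) × (ℤ × ℤ))}

theorem drift_mul_measure_follows (ha : a ∈ Set.Ioo (0 : ℝ) 1)
    (hlim : ∀ E : Finset ((ℤ × ℤ) × (ℤ × ℤ)),
      Filter.Tendsto (fun m : ℕ => aztecCylProb a (4 * ((m : ℤ) + 1)) E) Filter.atTop
        (nhds ((ℙ {ω | ∀ e ∈ E, e ∈ D ω}).toReal)))
    {x : ℤ × ℤ} (hx : WhiteV x) (hx' : northA x) {w : List (Bool × Bool)}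
    (hw : (vis [] x w).Nodup) :
    drift a x * (ℙ {ω | follows (D ω) x w}).toReal
      = kap a ^ w.length * (Wg (kap a) [] x w * XA (kap a) (drift a) (vis [] x w) (fin x w)) := by
  have h1 := measure_eq_det_walk ha ℙ hlim (gam_injOn hw) (fun i => (gam_class hx hx' w i).1)
    (fun i => (gam_class hx hx' w i).2) (fun i => w.get i)
  have h2 := mul_det_eq_det_bord w.length (gA (kap a) []) (drift a) (gam x w)
    (fun i => ea a (w.get i)) (fun i => (ea_pos ha.1 _).ne')
    (fun i => by rw [gam_succ, drift_add ha.1])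
  have h3 := det_bord_walk (kap_pos ha).le (four_kap_lt ha) (drift a) hw
  simp only [follows_iff]
  rw [h1, Fintype.card_fin, ← h3]
  simp only [XA]
  rw [← h2, gam_zero]
  simp only [gA, gam_succ]
  rw [mul_left_comm]
  congr!

theorem XA_drift_le (ha : a ∈ Set.Ioo (0 : ℝ) 1)
    (hlim : ∀ E : Finset ((ℤ × ℤ) × (ℤ × ℤ)),
      Filter.Tendsto (fun m : ℕ => aztecCylProb a (4 * ((m : ℤ) + 1)) E) Filter.atTop
        (nhds ((ℙ {ω | ∀ e ∈ E, e ∈ D ω}).toReal)))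
    {x : ℤ × ℤ} (hx : WhiteV x) (hx' : northA x) {w : List (Bool × Bool)}
    (hw : (vis [] x w).Nodup) (u : ℤ × ℤ) :
    XA (kap a) (drift a) (vis [] x w) u ≤ drift a u := by
  have hr := (kap_pos ha).le
  have hr' := four_kap_lt ha
  induction w using List.reverseRecOn with
  | nil => exact le_rfl
  | append_singleton w d ih =>
    rw [vis_append] at hw ⊢
    have hw' := (List.nodup_cons.1 hw).2
    refine le_trans ?_ (ih hw')
    simp only [XA, elimV]
    have h1 := drift_mul_measure_follows ha hlim hx hx' hw'
    have h2 : 0 ≤ XA (kap a) (drift a) (vis [] x w) (fin x w) := by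
      by_contra hneg
      have h3 : kap a ^ w.length * (Wg (kap a) [] x w
          * XA (kap a) (drift a) (vis [] x w) (fin x w)) < 0 :=
        mul_neg_of_pos_of_neg (pow_pos (kap_pos ha) _)
          (mul_neg_of_pos_of_neg (Wg_pos hr hr' hw') (not_le.1 hneg))
      have h4 : 0 ≤ drift a x * (ℙ {ω | follows (D ω) x w}).toReal :=
        mul_nonneg (drift_pos ha.1 _).le ENNReal.toReal_nonneg
      linarith
    have := div_nonneg (mul_nonneg (gA_nonneg hr hr' (vis [] x w) u (fin x w)) h2)
      (gA_nonneg hr hr' (vis [] x w) (fin x w) (fin x w))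
    linarith

theorem measure_follows_eq_zero (ha : a ∈ Set.Ioo (0 : ℝ) 1)
    (hlim : ∀ E : Finset ((ℤ × ℤ) × (ℤ × ℤ)),
      Filter.Tendsto (fun m : ℕ => aztecCylProb a (4 * ((m : ℤ) + 1)) E) Filter.atTop
        (nhds ((ℙ {ω | ∀ e ∈ E, e ∈ D ω}).toReal)))
    {x : ℤ × ℤ} (hx : WhiteV x) (hx' : northA x) {w : List (Bool × Bool)}
    (hw : ¬ (vis [] x w).Nodup) : (ℙ {ω | follows (D ω) x w}).toReal = 0 := by
  have hr := (kap_pos ha).le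
  have hr' := four_kap_lt ha
  induction w using List.reverseRecOn with
  | nil => simp [vis] at hw
  | append_singleton w d ih =>
    have hle : (ℙ {ω | follows (D ω) x (w ++ [d])}).toReal
        ≤ (ℙ {ω | follows (D ω) x w}).toReal :=
      ENNReal.toReal_mono (MeasureTheory.measure_ne_top _ _)
        (MeasureTheory.measure_mono fun ω h => follows_append h)
    refine le_antisymm (hle.trans ?_) ENNReal.toReal_nonneg
    by_cases hw' : (vis [] x w).Nodup
    · rw [vis_append, List.nodup_cons] at hw
      have hm : fin x w ∈ vis [] x w := by
        by_contra h; exact hw ⟨h, hw'⟩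
      have h1 := drift_mul_measure_follows ha hlim hx hx' hw'
      rw [XA_eq_zero hr hr' _ _ _ hm, mul_zero, mul_zero] at h1
      exact ((mul_eq_zero.1 h1).resolve_left (drift_pos ha.1 x).ne').le
    · exact (ih hw').le

theorem measure_follows_le (ha : a ∈ Set.Ioo (0 : ℝ) 1)
    (hlim : ∀ E : Finset ((ℤ × ℤ) × (ℤ × ℤ)),
      Filter.Tendsto (fun m : ℕ => aztecCylProb a (4 * ((m : ℤ) + 1)) E) Filter.atTop
        (nhds ((ℙ {ω | ∀ e ∈ E, e ∈ D ω}).toReal)))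
    {x : ℤ × ℤ} (hx : WhiteV x) (hx' : northA x) {w : List (Bool × Bool)}
    (hh : x.2 ≤ (fin x w).2) :
    (ℙ {ω | follows (D ω) x w}).toReal ≤ kap a ^ w.length * Wg (kap a) [] x w := by
  have hr := (kap_pos ha).le
  have hr' := four_kap_lt ha
  by_cases hw : (vis [] x w).Nodup
  · have h1 := drift_mul_measure_follows ha hlim hx hx' hw
    have h2 := XA_drift_le ha hlim hx hx' hw (fin x w)
    have h3 : drift a (fin x w) ≤ drift a x :=
      zpow_le_zpow_right_of_le_one₀ ha.1 ha.2.le (by omega)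
    have h4 := mul_nonneg (pow_nonneg hr w.length) (Wg_nonneg hr hr' [] x w)
    refine le_of_mul_le_mul_left ?_ (drift_pos ha.1 x)
    rw [h1, ← mul_assoc]
    nlinarith [mul_le_mul_of_nonneg_left (h2.trans h3) h4]
  · rw [measure_follows_eq_zero ha hlim hx hx' hw]
    exact mul_nonneg (pow_nonneg hr _) (Wg_nonneg hr hr' _ _ _)

end

/-- All words of a given length. -/
def words : ℕ → Finset (List (Bool × Bool))
  | 0 => {[]}
  | k + 1 => (Finset.univ ×ˢ words k).image fun p => p.1 :: p.2

lemma mem_words {k : ℕ} {w : List (Bool × Bool)} : w ∈ words k ↔ w.length = k := by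
  induction k generalizing w with
  | zero => simp [words, List.length_eq_zero_iff]
  | succ k ih =>
    cases w with
    | nil => simp [words]
    | cons d w => simp [words, ih]

lemma sum_words_succ (k : ℕ) (F : List (Bool × Bool) → ℝ) :
    ∑ w ∈ words (k + 1), F w = ∑ d, ∑ w ∈ words k, F (d :: w) := by
  rw [words, Finset.sum_image (fun p _ q _ h => by simpa [Prod.ext_iff] using h),
    Finset.sum_product]

lemma sum_Wg_le {r : ℝ} (hr : 0 ≤ r) (hr' : 4 * r < 1) (k : ℕ) (A : List (ℤ × ℤ)) (x : ℤ × ℤ) :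
    ∑ w ∈ words (k + 1), r ^ (k + 1) * Wg r A x w ≤ hA r A x := by
  induction k generalizing A x with
  | zero =>
    have h1 := gA_nonneg hr hr' A x x
    have h2 : 0 ≤ r * ∑ e, hA r (x :: A) (x + 2 • dv e) :=
      mul_nonneg hr (Finset.sum_nonneg fun e _ => hA_nonneg hr hr' _ _)
    rw [sum_words_succ, hA_eq hr hr' A x]
    rw [sum_dirs]
    simp only [words, Wg, Finset.sum_singleton, zero_add, pow_one, mul_one]
    nlinarith
  | succ k ih =>
    rw [sum_words_succ, hA_eq hr hr' A x]
    have h1 := gA_nonneg hr hr' A x x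
    calc ∑ d, ∑ w ∈ words (k + 1), r ^ (k + 1 + 1) * Wg r A x (d :: w)
        = ∑ d, (gA r A x x * r) * ∑ w ∈ words (k + 1),
            r ^ (k + 1) * Wg r (x :: A) (x + 2 • dv d) w := by
          refine Finset.sum_congr rfl fun d _ => ?_
          rw [Finset.mul_sum]
          refine Finset.sum_congr rfl fun w _ => ?_
          simp only [Wg]; ring
      _ ≤ ∑ d, (gA r A x x * r) * hA r (x :: A) (x + 2 • dv d) :=
          Finset.sum_le_sum fun d _ => mul_le_mul_of_nonneg_left (ih _ _) (mul_nonneg h1 hr)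
      _ ≤ _ := by rw [← Finset.mul_sum]; nlinarith

/-! ### The south forest path of a matching -/

/-- The direction of the dimer covering `v`. -/
def dirOf (M : Set ((ℤ × ℤ) × (ℤ × ℤ))) (v : ℤ × ℤ) : Bool × Bool :=
  if h : ∃ d, (v, v + dv d) ∈ M then h.choose else (false, false)

lemma dirOf_eq_iff {M : Set ((ℤ × ℤ) × (ℤ × ℤ))} (hM : IsFullMatching M) {v : ℤ × ℤ}
    (hv : WhiteV v) (d : Bool × Bool) : dirOf M v = d ↔ (v, v + dv d) ∈ M := by
  obtain ⟨b, hb, hu⟩ := hM.2.1 v hv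
  have hex : ∃ d, (v, v + dv d) ∈ M := by
    obtain ⟨d, hd⟩ := mem_diagDirs.1 (hM.1 _ hb).2
    refine ⟨d, ?_⟩
    have : v + dv d = b := by rw [← hd]; simp
    rw [this]; exact hb
  have hs : (v, v + dv (dirOf M v)) ∈ M := by
    rw [dirOf, dif_pos hex]; exact hex.choose_spec
  constructor
  · rintro rfl; exact hs
  · intro hd
    have h1 := hu _ hs
    have h2 := hu _ hd
    exact dv_injective (add_left_cancel (h1.trans h2.symm))

/-- One step of the south forest path. -/
def stp (M : Set ((ℤ × ℤ) × (ℤ × ℤ))) (v : ℤ × ℤ) : ℤ × ℤ := v + 2 • dv (dirOf M v)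

/-- The south forest path started at `x`. -/
def walk (M : Set ((ℤ × ℤ) × (ℤ × ℤ))) (x : ℤ × ℤ) (k : ℕ) : ℤ × ℤ := (stp M)^[k] x

/-- The word of the first steps of the south forest path. -/
def wd (M : Set ((ℤ × ℤ) × (ℤ × ℤ))) : ℤ × ℤ → ℕ → List (Bool × Bool)
  | _, 0 => []
  | x, k + 1 => dirOf M x :: wd M (stp M x) k

lemma walk_succ (M : Set ((ℤ × ℤ) × (ℤ × ℤ))) (x : ℤ × ℤ) (k : ℕ) :
    walk M x (k + 1) = walk M x k + 2 • dv (dirOf M (walk M x k)) :=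
  Function.iterate_succ_apply' _ _ _

lemma walk_add (M : Set ((ℤ × ℤ) × (ℤ × ℤ))) (x : ℤ × ℤ) (k l : ℕ) :
    walk M x (k + l) = walk M (walk M x l) k :=
  Function.iterate_add_apply _ _ _ _

lemma walk_class (M : Set ((ℤ × ℤ) × (ℤ × ℤ))) {x : ℤ × ℤ} (hx : WhiteV x) (hx' : northA x)
    (k : ℕ) : WhiteV (walk M x k) ∧ northA (walk M x k) := by
  induction k with
  | zero => exact ⟨hx, hx'⟩
  | succ k ih => rw [walk_succ]; exact ⟨whiteV_add ih.1 _, northA_add ih.2 _⟩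

lemma length_wd (M : Set ((ℤ × ℤ) × (ℤ × ℤ))) (x : ℤ × ℤ) (k : ℕ) : (wd M x k).length = k := by
  induction k generalizing x with
  | zero => rfl
  | succ k ih => simp [wd, ih]

lemma fin_wd (M : Set ((ℤ × ℤ) × (ℤ × ℤ))) (x : ℤ × ℤ) (k : ℕ) :
    fin x (wd M x k) = walk M x k := by
  induction k generalizing x with
  | zero => rfl
  | succ k ih => exact ih _

lemma gam_wd (M : Set ((ℤ × ℤ) × (ℤ × ℤ))) (x : ℤ × ℤ) {i k : ℕ} (h : i ≤ k) :
    gam x (wd M x k) i = walk M x i := by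
  induction k generalizing x i with
  | zero => obtain rfl : i = 0 := by omega
            rfl
  | succ k ih =>
    cases i with
    | zero => rfl
    | succ i => exact ih _ (by omega)

lemma follows_iff_wd {M : Set ((ℤ × ℤ) × (ℤ × ℤ))} (hM : IsFullMatching M) {x : ℤ × ℤ}
    (hx : WhiteV x) (w : List (Bool × Bool)) : follows M x w ↔ wd M x w.length = w := by
  induction w generalizing x with
  | nil => simp [follows, wd]
  | cons d w ih =>
    rw [follows, List.length_cons, wd, List.cons.injEq, dirOf_eq_iff hM hx]
    refine and_congr_right fun h => ?_
    rw [ih (whiteV_add hx d), stp, (dirOf_eq_iff hM hx d).2 h]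

lemma isForestPath_walk {M : Set ((ℤ × ℤ) × (ℤ × ℤ))} (hM : IsFullMatching M) {x : ℤ × ℤ}
    (hx : WhiteV x) (hx' : northA x) : IsForestPath M x (walk M x) := by
  refine ⟨rfl, fun i => ⟨dv (dirOf M (walk M x i)), mem_diagDirs.2 ⟨_, rfl⟩,
    (dirOf_eq_iff hM (walk_class M hx hx' i).1 _).1 rfl, ?_⟩⟩
  rw [walk_succ, two_smul, add_assoc]

/-! ### Heights as windings -/

/-- The step of the height across the edge of direction `e` at a vertex matched in
direction `d`. -/
def stepOf (d e : Bool × Bool) : ℤ := if d = e then -3 else 1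

lemma stepVal_eq {M : Set ((ℤ × ℤ) × (ℤ × ℤ))} (hM : IsFullMatching M) {c : ℤ × ℤ}
    (hc : WhiteV c) (d : Bool × Bool) : stepVal M c (c + dv d) = stepOf (dirOf M c) d := by
  unfold stepVal stepOf covered
  have h1 : ¬ (c + dv d, c) ∈ M := by
    intro h
    have h2 := (hM.1 _ h).1
    have h3 := blackV_add_dv hc d
    exact (Int.not_even_iff_odd.2 h2.1) h3.1
  simp only [h1, or_false, ← dirOf_eq_iff hM hc]

theorem exists_height_eq (f : ℤ × ℤ) (hf : Even (f.1 + f.2)) :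
    ∃ b : ℤ × ℤ, WhiteV b ∧ northA b ∧ |b.1 - f.1| ≤ 1 ∧ |b.2 - f.2| ≤ 1 ∧
      ∃ l : Bool × Bool → ℤ, (∀ d, |l d| ≤ 6) ∧
        ∀ (M : Set ((ℤ × ℤ) × (ℤ × ℤ))) (h : ℤ × ℤ → ℤ), IsFullMatching M → IsFullHeight M h →
          AnchoredAtInfinity M h → h f = -4 * windPath (walk M b) b + l (dirOf M b) := by
  obtain ⟨x, y⟩ := f
  obtain ⟨t, ht⟩ := hf
  simp only at ht
  have main : ∀ b : ℤ × ℤ, WhiteV b → northA b → ∀ (M : Set ((ℤ × ℤ) × (ℤ × ℤ)))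
      (h : ℤ × ℤ → ℤ), IsFullMatching M → AnchoredAtInfinity M h →
      h (b + (0, 1)) = -4 * windPath (walk M b) b := by
    intro b hb hb' M h hM hA
    have := hA (b + (0, 1)) ⟨by simpa using hb.1, by simpa using hb.2.add_one, by
      unfold northA at hb'; simp; omega⟩ (walk M b)
    rw [add_sub_cancel_right] at this
    exact this (isForestPath_walk hM hb hb')
  have h6 : ∀ d e e' : Bool × Bool, |(-stepOf d e - stepOf d e')| ≤ 6 := by
    intro d e e'; unfold stepOf; split_ifs <;> norm_num
  have h3 : ∀ d e : Bool × Bool, |stepOf d e| ≤ 6 := by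
    intro d e; unfold stepOf; split_ifs <;> norm_num
  have hr : ∀ b : ℤ × ℤ, WhiteV b → ∀ (M : Set ((ℤ × ℤ) × (ℤ × ℤ)))
      (h : ℤ × ℤ → ℤ), IsFullMatching M → IsFullHeight M h →
      h (b + (0, 1)) = h (b + (1, 0)) + stepOf (dirOf M b) (true, true) ∧
      h (b + (-1, 0)) = h (b + (0, 1)) + stepOf (dirOf M b) (false, true) ∧
      h (b + (1, 0)) = h (b + (0, -1)) + stepOf (dirOf M b) (true, false) := by
    intro b hb M h hM hH
    have := hH.1 b hb
    have e1 := stepVal_eq hM hb (true, true)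
    have e2 := stepVal_eq hM hb (false, true)
    have e3 := stepVal_eq hM hb (true, false)
    simp only [dv, sg, if_true, Bool.false_eq_true, if_false] at e1 e2 e3
    rw [← e1, ← e2, ← e3]
    exact ⟨this.1, this.2.1, this.2.2.2⟩
  rcases Int.even_or_odd x with ⟨s, hs⟩ | ⟨s, hs⟩
  · by_cases h4 : (4 : ℤ) ∣ x + y
    · have hb : WhiteV (x + 1, y) := ⟨⟨s, by simp; omega⟩, ⟨t - s, by simp; omega⟩⟩
      have hb' : northA (x + 1, y) := by unfold northA; simp; omega
      refine ⟨(x + 1, y), hb, hb', by simp, by simp, fun d => stepOf d (false, true),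
        fun d => h3 _ _, fun M h hM hH hA => ?_⟩
      rw [← main _ hb hb' M h hM hA, ← (hr _ hb M h hM hH).2.1]
      simp
    · have hb : WhiteV (x - 1, y) := ⟨⟨s - 1, by simp; omega⟩, ⟨t - s, by simp; omega⟩⟩
      have hb' : northA (x - 1, y) := by unfold northA; simp; omega
      refine ⟨(x - 1, y), hb, hb', by simp, by simp, fun d => -stepOf d (true, true),
        fun d => by rw [abs_neg]; exact h3 _ _, fun M h hM hH hA => ?_⟩
      have h1 := (hr _ hb M h hM hH).1
      rw [← main _ hb hb' M h hM hA, h1]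
      simp
  · by_cases h4 : (4 : ℤ) ∣ x + y
    · have hb : WhiteV (x, y + 1) := ⟨⟨s, by simp; omega⟩, ⟨t - s, by simp; omega⟩⟩
      have hb' : northA (x, y + 1) := by unfold northA; simp; omega
      refine ⟨(x, y + 1), hb, hb', by simp, by simp,
        fun d => -stepOf d (true, true) - stepOf d (true, false),
        fun d => h6 _ _ _, fun M h hM hH hA => ?_⟩
      obtain ⟨h1, -, h2⟩ := hr _ hb M h hM hH
      rw [← main _ hb hb' M h hM hA, h1, h2]
      simp; ring
    · have hb : WhiteV (x, y - 1) := ⟨⟨s, by simp; omega⟩, ⟨t - s - 1, by simp; omega⟩⟩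
      have hb' : northA (x, y - 1) := by unfold northA; simp; omega
      refine ⟨(x, y - 1), hb, hb', by simp, by simp, fun _ => 0, fun d => by simp,
        fun M h hM hH hA => ?_⟩
      rw [← main _ hb hb' M h hM hA]
      simp

/-- The signed crossing of the upward ray from `b` by a path at index `i`. -/
def cross (p : ℕ → ℤ × ℤ) (b : ℤ × ℤ) (i : ℕ) : ℤ :=
  (if (p (i + 1)).1 = b.1 ∧ b.2 < (p (i + 1)).2 ∧ b.1 < (p i).1 ∧ (p (i + 2)).1 < b.1
    then 1 else 0)
  - (if (p (i + 1)).1 = b.1 ∧ b.2 < (p (i + 1)).2 ∧ (p i).1 < b.1 ∧ b.1 < (p (i + 2)).1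
    then 1 else 0)

lemma windPath_eq_sum {p : ℕ → ℤ × ℤ} {b : ℤ × ℤ} {T : ℕ} (h : ∀ t, T ≤ t → (p t).2 < b.2) :
    windPath p b = ∑ i ∈ Finset.range T, cross p b i := by
  have key : ∀ Q : ℕ → Prop, (∀ i, Q i → b.2 < (p (i + 1)).2) →
      (({i : ℕ | Q i}.ncard : ℕ) : ℤ) = ∑ i ∈ Finset.range T, if Q i then 1 else 0 := by
    intro Q hQ
    have : {i : ℕ | Q i} = ((Finset.range T).filter Q : Finset ℕ) := by
      ext i
      simp only [Finset.coe_filter, Finset.mem_range]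
      refine ⟨fun hi => ⟨?_, hi⟩, fun hi => hi.2⟩
      by_contra hlt
      have := h (i + 1) (by omega)
      have := hQ i hi
      omega
    rw [this, Set.ncard_coe_finset, Finset.sum_boole]
  rw [windPath, key _ fun i hi => hi.2.1, key _ fun i hi => hi.2.1, ← Finset.sum_sub_distrib]
  refine Finset.sum_congr rfl fun i _ => ?_
  unfold cross
  congr!

lemma abs_cross_le (p : ℕ → ℤ × ℤ) (b : ℤ × ℤ) (i : ℕ) : |cross p b i| ≤ 1 := by
  unfold cross; split_ifs <;> simp

lemma abs_sum_cross_le (p : ℕ → ℤ × ℤ) (b : ℤ × ℤ) (T : ℕ) :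
    |∑ i ∈ Finset.range T, cross p b i| ≤ T := by
  refine (Finset.abs_sum_le_sum_abs _ _).trans ?_
  refine (Finset.sum_le_sum fun i _ => abs_cross_le p b i).trans ?_
  simp

lemma sq_card_le_sum {ι : Type*} (E : Finset ι) (V : ι → ℤ) (hinj : Set.InjOn V E)
    (hpos : ∀ j ∈ E, 0 < V j) : (E.card : ℤ) ^ 2 ≤ 2 * ∑ j ∈ E, V j := by
  induction h : E.card generalizing E with
  | zero =>
    have := Finset.sum_nonneg fun j hj => (hpos j hj).le
    push_cast; linarith
  | succ n ih =>
    obtain ⟨m, hm, hmax⟩ := Finset.exists_max_image E V (Finset.card_pos.1 (by omega))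
    have h1 := ih (E.erase m) (hinj.mono (by simp)) (fun j hj => hpos j (Finset.mem_of_mem_erase hj))
      (by rw [Finset.card_erase_of_mem hm, h]; rfl)
    have h2 : ((n + 1 : ℕ) : ℤ) ≤ V m := by
      have : E.image V ⊆ Finset.Icc 1 (V m) := by
        intro y hy
        obtain ⟨j, hj, rfl⟩ := Finset.mem_image.1 hy
        exact Finset.mem_Icc.2 ⟨hpos j hj, hmax j hj⟩
      have := Finset.card_le_card this
      rw [Finset.card_image_of_injOn hinj, h, Int.card_Icc] at this
      have := hpos m hm
      omega
    rw [← Finset.add_sum_erase _ _ hm]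
    push_cast at h2 ⊢
    nlinarith

section winding
variable {p : ℕ → ℤ × ℤ} {b : ℤ × ℤ}

lemma walk_parity (h0 : p 0 = b)
    (hp : ∀ t, ∃ d : Bool × Bool, p (t + 1) = p t + 2 • dv d) (k : ℕ) :
    (4 : ℤ) ∣ (p (2 * k)).1 - b.1 := by
  induction k with
  | zero => simp [h0]
  | succ k ih =>
    obtain ⟨⟨d1, d2⟩, hd⟩ := hp (2 * k)
    obtain ⟨⟨e1, e2⟩, he⟩ := hp (2 * k + 1)
    rw [show 2 * (k + 1) = 2 * k + 1 + 1 by ring, he, hd]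
    cases d1 <;> cases e1 <;> simp [dv, sg] <;> omega

lemma walk_lipschitz (hp : ∀ t, ∃ d : Bool × Bool, p (t + 1) = p t + 2 • dv d) (s t : ℕ) :
    |(p (s + t)).2 - (p s).2| ≤ 2 * t := by
  induction t with
  | zero => simp
  | succ t ih =>
    obtain ⟨⟨d1, d2⟩, hd⟩ := hp (s + t)
    rw [← add_assoc, hd]
    rw [abs_le] at ih ⊢
    cases d2 <;> simp [dv, sg] <;> omega

theorem exists_excursions (h0 : p 0 = b)
    (hp : ∀ t, ∃ d : Bool × Bool, p (t + 1) = p t + 2 • dv d) (k : ℕ) : ∃ E : Finset ℕ,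
    (∀ j ∈ E, j ≤ k ∧ (p (2 * j)).1 = b.1 ∧ b.2 < (p (2 * j)).2) ∧
    ((∑ i ∈ Finset.range (2 * k), cross p b i = 0 ∧ E = ∅) ∨
      ∃ s ≤ k, s ∉ E ∧ (p (2 * s)).1 = b.1 ∧ b.2 < (p (2 * s)).2 ∧
        ∑ j ∈ E, ((p (2 * j)).2 - b.2) ≤ 4 * s ∧ ∃ σ : ℤ, (σ = 1 ∨ σ = -1) ∧
        -(E.card : ℤ) ≤ σ * ∑ i ∈ Finset.range (2 * k), cross p b i ∧
        σ * ∑ i ∈ Finset.range (2 * k), cross p b i ≤ E.card + 1 ∧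
        (σ * ((p (2 * k + 1)).1 - b.1) < 0 ∨
          ∑ j ∈ E, ((p (2 * j)).2 - b.2) + ((p (2 * s)).2 - b.2) ≤ 4 * k + 2)) := by
  induction k with
  | zero => exact ⟨∅, by simp, Or.inl (by simp)⟩
  | succ k ih =>
    obtain ⟨E, hE, h⟩ := ih
    have hpar := walk_parity h0 hp k
    obtain ⟨⟨d1, d2⟩, hd⟩ := hp (2 * k)
    obtain ⟨⟨e1, e2⟩, he⟩ := hp (2 * k + 1)
    obtain ⟨⟨g1, g2⟩, hg⟩ := hp (2 * k + 1 + 1)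
    have hx1 : (p (2 * k + 1)).1 = (p (2 * k)).1 + 2 * sg d1 := by rw [hd]; simp [dv]
    have hx2 : (p (2 * k + 2)).1 = (p (2 * k + 1)).1 + 2 * sg e1 := by rw [he]; simp [dv]
    have hx3 : (p (2 * k + 3)).1 = (p (2 * k + 2)).1 + 2 * sg g1 := by rw [hg]; simp [dv]
    have hs1 : sg d1 = 1 ∨ sg d1 = -1 := by cases d1 <;> simp [sg]
    have hs2 : sg e1 = 1 ∨ sg e1 = -1 := by cases e1 <;> simp [sg]
    have hs3 : sg g1 = 1 ∨ sg g1 = -1 := by cases g1 <;> simp [sg]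
    have hc1 : cross p b (2 * k + 1) =
        (if (p (2 * k + 2)).1 = b.1 ∧ b.2 < (p (2 * k + 2)).2 ∧ b.1 < (p (2 * k + 1)).1 ∧
          (p (2 * k + 3)).1 < b.1 then 1 else 0)
        - (if (p (2 * k + 2)).1 = b.1 ∧ b.2 < (p (2 * k + 2)).2 ∧ (p (2 * k + 1)).1 < b.1 ∧
          b.1 < (p (2 * k + 3)).1 then 1 else 0) := rfl
    have hc0 : cross p b (2 * k) = 0 := by
      unfold cross
      rw [if_neg (by omega), if_neg (by omega), sub_zero]
    rw [show 2 * (k + 1) = 2 * k + 1 + 1 by ring, Finset.sum_range_succ, Finset.sum_range_succ,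
      hc0, add_zero]
    set W := ∑ i ∈ Finset.range (2 * k), cross p b i with hW
    have hE' : ∀ j ∈ E, j ≤ k + 1 ∧ (p (2 * j)).1 = b.1 ∧ b.2 < (p (2 * j)).2 :=
      fun j hj => ⟨(hE j hj).1.trans (by omega), (hE j hj).2⟩
    by_cases hcr : (p (2 * k + 2)).1 = b.1 ∧ sg e1 = sg g1
    · by_cases hv : b.2 < (p (2 * k + 2)).2
      · have hcv : cross p b (2 * k + 1) = - sg e1 := by
          rw [hc1]
          rcases hs2 with h2 | h2
          · rw [if_neg (by omega), if_pos (by omega), h2]; norm_num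
          · rw [if_pos (by omega), if_neg (by omega), h2]; norm_num
        rw [hcv]
        have hk1 : k + 1 ∉ E := fun hk => by have := (hE _ hk).1; omega
        have hside : -sg e1 * ((p (2 * k + 1 + 1 + 1)).1 - b.1) < 0 := by
          rw [show 2 * k + 1 + 1 + 1 = 2 * k + 3 by ring, hx3, hcr.1, ← hcr.2]
          rcases hs2 with h2 | h2 <;> rw [h2] <;> omega
        have hsg : -sg e1 = 1 ∨ -sg e1 = -1 := by rcases hs2 with h2 | h2 <;> simp [h2]
        rcases h with ⟨hW0, rfl⟩ | ⟨s, hsk, hsE, hsx, hsy, hsum, σ, hσ, hl, hu, hlast⟩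
        · refine ⟨∅, by simp, Or.inr ⟨k + 1, le_rfl, by simp, hcr.1, hv, by simp; omega, -sg e1,
            hsg, ?_, ?_, Or.inl hside⟩⟩ <;> rw [hW0] <;>
            rcases hs2 with h2 | h2 <;> rw [h2] <;> simp
        · by_cases hsame : -sg e1 = σ
          · have hlow : ∑ j ∈ E, ((p (2 * j)).2 - b.2) + ((p (2 * s)).2 - b.2) ≤ 4 * k + 2 := by
              refine hlast.resolve_left ?_
              rw [← hsame]
              rcases hs2 with h2 | h2 <;> rw [h2] at hx2 ⊢ <;> omega
            refine ⟨insert s E, ?_, Or.inr ⟨k + 1, le_rfl, ?_, hcr.1, hv, ?_, -sg e1, hsg, ?_, ?_,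
              Or.inl hside⟩⟩
            · intro j hj
              rcases Finset.mem_insert.1 hj with rfl | hj
              · exact ⟨by omega, hsx, hsy⟩
              · exact hE' j hj
            · rw [Finset.mem_insert, not_or]; exact ⟨by omega, hk1⟩
            · rw [Finset.sum_insert hsE]; push_cast; linarith
            · rw [Finset.card_insert_of_notMem hsE, hsame]
              push_cast
              rcases hσ with rfl | rfl <;> linarith
            · rw [Finset.card_insert_of_notMem hsE, hsame]
              push_cast
              rcases hσ with rfl | rfl <;> linarith
          · refine ⟨E, hE', Or.inr ⟨k + 1, le_rfl, hk1, hcr.1, hv, ?_, -sg e1, hsg, ?_, ?_,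
              Or.inl hside⟩⟩
            · push_cast; linarith [(Nat.cast_le (α := ℤ)).2 hsk]
            · have : -sg e1 = -σ := by omega
              rw [this]
              rcases hσ with rfl | rfl <;> linarith
            · have : -sg e1 = -σ := by omega
              rw [this]
              rcases hσ with rfl | rfl <;> linarith
      · have hcv : cross p b (2 * k + 1) = 0 := by
          rw [hc1]
          rw [if_neg (by omega), if_neg (by omega), sub_zero]
        rw [hcv, add_zero]
        refine ⟨E, hE', ?_⟩
        rcases h with h | ⟨s, hsk, hsE, hsx, hsy, hsum, σ, hσ, hl, hu, hlast⟩
        · exact Or.inl h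
        · refine Or.inr ⟨s, by omega, hsE, hsx, hsy, hsum, σ, hσ, hl, hu, Or.inr ?_⟩
          have := walk_lipschitz hp (2 * s) (2 * k + 2 - 2 * s)
          rw [show 2 * s + (2 * k + 2 - 2 * s) = 2 * k + 2 by omega, abs_le] at this
          have h3 : ((2 * k + 2 - 2 * s : ℕ) : ℤ) = 2 * k + 2 - 2 * s := by omega
          rw [h3] at this
          push_cast
          omega
    · have hcv : cross p b (2 * k + 1) = 0 := by
        rw [hc1]
        clear h
        rw [if_neg (by omega), if_neg (by omega), sub_zero]
      rw [hcv, add_zero]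
      refine ⟨E, hE', ?_⟩
      rcases h with h | ⟨s, hsk, hsE, hsx, hsy, hsum, σ, hσ, hl, hu, hlast⟩
      · exact Or.inl h
      · refine Or.inr ⟨s, by omega, hsE, hsx, hsy, hsum, σ, hσ, hl, hu, ?_⟩
        rcases hlast with h | h
        · left
          have hpar' := walk_parity h0 hp (k + 1)
          rw [show 2 * (k + 1) = 2 * k + 2 by ring] at hpar'
          rw [show 2 * k + 1 + 1 + 1 = 2 * k + 3 by ring]
          rcases hσ with rfl | rfl <;> omega
        · right; push_cast; linarith

theorem sq_windPath_le (h0 : p 0 = b)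
    (hp : ∀ t, ∃ d : Bool × Bool, p (t + 1) = p t + 2 • dv d) (hinj : Function.Injective p) {k : ℕ}
    (hk : ∀ t, 2 * k ≤ t → (p t).2 < b.2) : (|windPath p b| - 1) ^ 2 ≤ 8 * (k : ℤ) + 1 := by
  rw [windPath_eq_sum hk]
  obtain ⟨E, hE, h⟩ := exists_excursions h0 hp k
  rcases h with ⟨h, -⟩ | ⟨s, hsk, -, -, -, hsum, σ, hσ, hl, hu, -⟩
  · rw [h]; simp
  · have h1 := sq_card_le_sum E (fun j => (p (2 * j)).2 - b.2) (by
      intro i hi j hj hij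
      have h1 := hE i hi
      have h2 := hE j hj
      have : p (2 * i) = p (2 * j) := Prod.ext (by omega) (by simpa using hij)
      have := hinj this
      omega) (fun j hj => by have := (hE j hj).2.2; omega)
    set W := ∑ i ∈ Finset.range (2 * k), cross p b i
    have h2 : |W| ≤ E.card + 1 := by
      rw [abs_le]
      rcases hσ with rfl | rfl <;> constructor <;> linarith
    have h3 : (E.card : ℤ) ^ 2 ≤ 8 * k := by
      have : (s : ℤ) ≤ k := by exact_mod_cast hsk
      linarith
    have h4 := abs_nonneg W
    have h5 : (0 : ℤ) ≤ E.card := by positivity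
    by_cases h6 : 1 ≤ |W|
    · nlinarith
    · have : |W| = 0 := by omega
      rw [this]; norm_num

end winding

/-! ### Return times and the height tail -/

open MeasureTheory in
lemma measurableSet_follows {Ω : Type*} [MeasurableSpace Ω] {D : Ω → Set ((ℤ × ℤ) × (ℤ × ℤ))}
    (hDmeas : ∀ e, MeasurableSet {ω | e ∈ D ω}) (x : ℤ × ℤ) (w : List (Bool × Bool)) :
    MeasurableSet {ω | follows (D ω) x w} := by
  simp only [follows_iff]
  rw [Set.ofPred_forall]
  exact MeasurableSet.iInter fun i => hDmeas _

section
open MeasureTheory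
variable {a : ℝ} {Ω : Type*} [MeasurableSpace Ω] {ℙ : Measure Ω}
    [IsProbabilityMeasure ℙ] {D : Ω → Set ((ℤ × ℤ) × (ℤ × ℤ))}

/-- A path from `x` does not stay strictly below the height of `x` from time `T` on. -/
def returnsAfter (M : Set ((ℤ × ℤ) × (ℤ × ℤ))) (x : ℤ × ℤ) (T : ℕ) : Prop :=
  ∃ t, T ≤ t ∧ x.2 ≤ (walk M x t).2

lemma measureReal_walk_ge_le (ha : a ∈ Set.Ioo (0 : ℝ) 1) (hD : ∀ ω, IsFullMatching (D ω))
    (hlim : ∀ E : Finset ((ℤ × ℤ) × (ℤ × ℤ)),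
      Filter.Tendsto (fun m : ℕ => aztecCylProb a (4 * ((m : ℤ) + 1)) E) Filter.atTop
        (nhds ((ℙ {ω | ∀ e ∈ E, e ∈ D ω}).toReal)))
    {x : ℤ × ℤ} (hx : WhiteV x) (hx' : northA x) {r : ℝ} (hr : kap a ≤ r) (hr' : 4 * r < 1)
    (k : ℕ) :
    ℙ.real {ω | x.2 ≤ (walk (D ω) x (k + 1)).2} ≤ 1 / (1 - 4 * r) * (kap a / r) ^ (k + 1) := by
  have hk := kap_pos ha
  have hr0 : 0 < r := hk.trans_le hr
  have hsub : {ω | x.2 ≤ (walk (D ω) x (k + 1)).2} ⊆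
      ⋃ w ∈ (words (k + 1)).filter (fun w => x.2 ≤ (fin x w).2), {ω | follows (D ω) x w} := by
    intro ω hω
    simp only [Set.mem_iUnion]
    refine ⟨wd (D ω) x (k + 1), Finset.mem_filter.2 ⟨mem_words.2 (length_wd _ _ _), ?_⟩, ?_⟩
    · rw [fin_wd]; exact hω
    · exact (follows_iff_wd (hD ω) hx _).2 (by rw [length_wd])
  calc ℙ.real {ω | x.2 ≤ (walk (D ω) x (k + 1)).2}
      ≤ ∑ w ∈ (words (k + 1)).filter (fun w => x.2 ≤ (fin x w).2),
          ℙ.real {ω | follows (D ω) x w} :=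
        (measureReal_mono hsub (measure_ne_top _ _)).trans (measureReal_biUnion_finset_le _ _)
    _ ≤ ∑ w ∈ (words (k + 1)).filter (fun w => x.2 ≤ (fin x w).2),
          kap a ^ (k + 1) * Wg r [] x w := by
        refine Finset.sum_le_sum fun w hw => ?_
        obtain ⟨hw, hw'⟩ := Finset.mem_filter.1 hw
        have := measure_follows_le ha hlim hx hx' hw'
        rw [mem_words.1 hw] at this
        exact this.trans (mul_le_mul_of_nonneg_left (Wg_mono hk.le hr hr' _ _ _) (by positivity))
    _ ≤ ∑ w ∈ words (k + 1), kap a ^ (k + 1) * Wg r [] x w :=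
        Finset.sum_le_sum_of_subset_of_nonneg (Finset.filter_subset _ _) fun w _ _ =>
          mul_nonneg (by positivity) (Wg_nonneg hr0.le hr' _ _ _)
    _ = (∑ w ∈ words (k + 1), r ^ (k + 1) * Wg r [] x w) * (kap a / r) ^ (k + 1) := by
        rw [Finset.sum_mul]
        refine Finset.sum_congr rfl fun w _ => ?_
        rw [div_pow]; field_simp
    _ ≤ 1 / (1 - 4 * r) * (kap a / r) ^ (k + 1) :=
        mul_le_mul_of_nonneg_right (sum_Wg_le hr0.le hr' k [] x) (by positivity)

theorem exists_returnsAfter_bound (ha : a ∈ Set.Ioo (0 : ℝ) 1) (hD : ∀ ω, IsFullMatching (D ω))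
    (hlim : ∀ E : Finset ((ℤ × ℤ) × (ℤ × ℤ)),
      Filter.Tendsto (fun m : ℕ => aztecCylProb a (4 * ((m : ℤ) + 1)) E) Filter.atTop
        (nhds ((ℙ {ω | ∀ e ∈ E, e ∈ D ω}).toReal))) :
    ∃ C ρ : ℝ, 1 ≤ C ∧ 0 < ρ ∧ ρ < 1 ∧ ∀ x, WhiteV x → northA x → ∀ T,
      ℙ.real {ω | returnsAfter (D ω) x T} ≤ C * ρ ^ T := by
  have hk := kap_pos ha
  have hk' := four_kap_lt ha
  obtain ⟨r, hr, hr'⟩ : ∃ r, kap a < r ∧ 4 * r < 1 := ⟨(kap a + 1 / 4) / 2, by linarith, by linarith⟩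
  have hr0 : 0 < r := hk.trans hr
  set ρ := kap a / r with hρ
  have hρ0 : 0 < ρ := by positivity
  have hρ1 : ρ < 1 := (div_lt_one hr0).2 hr
  set C := 1 / (1 - 4 * r) with hC
  have hC1 : 1 ≤ C := by rw [hC, le_div_iff₀ (by linarith)]; linarith
  have hC2 : C ≤ C / (1 - ρ) := by
    rw [le_div_iff₀ (by linarith)]; nlinarith
  refine ⟨C / (1 - ρ), ρ, hC1.trans hC2, hρ0, hρ1, fun x hx hx' T => ?_⟩
  cases T with
  | zero => rw [pow_zero, mul_one]; exact measureReal_le_one.trans (hC1.trans hC2)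
  | succ T =>
    have hsub : {ω | returnsAfter (D ω) x (T + 1)} ⊆
        ⋃ k : ℕ, {ω | x.2 ≤ (walk (D ω) x (T + k + 1)).2} := by
      rintro ω ⟨t, ht, h⟩
      obtain ⟨k, rfl⟩ := Nat.exists_eq_add_of_le ht
      refine Set.mem_iUnion.2 ⟨k, ?_⟩
      rw [show T + 1 + k = T + k + 1 by ring] at h
      exact h
    have hs : HasSum (fun k : ℕ => C * ρ ^ (T + k + 1)) (C / (1 - ρ) * ρ ^ (T + 1)) := by
      have := (hasSum_geometric_of_lt_one hρ0.le hρ1).mul_left (C * ρ ^ (T + 1))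
      rw [mul_right_comm, ← div_eq_mul_inv] at this
      have e : (fun k : ℕ => C * ρ ^ (T + 1) * ρ ^ k) = fun k => C * ρ ^ (T + k + 1) := by
        funext k
        rw [mul_assoc, ← pow_add, add_right_comm]
      rwa [e] at this
    have h1 : ℙ {ω | returnsAfter (D ω) x (T + 1)} ≤ ENNReal.ofReal (C / (1 - ρ) * ρ ^ (T + 1)) := by
      refine (measure_mono hsub).trans ((measure_iUnion_le _).trans ?_)
      rw [← hs.tsum_eq, ENNReal.ofReal_tsum_of_nonneg (fun k => by positivity) hs.summable]
      refine ENNReal.tsum_le_tsum fun k => ?_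
      rw [← ENNReal.ofReal_toReal (measure_ne_top ℙ _)]
      exact ENNReal.ofReal_le_ofReal (measureReal_walk_ge_le ha hD hlim hx hx' hr.le hr' (T + k))
    exact ENNReal.toReal_le_of_le_ofReal
      (mul_nonneg (by linarith) (by positivity)) h1

lemma returnsAfter_of_not_injective {M : Set ((ℤ × ℤ) × (ℤ × ℤ))} {x : ℤ × ℤ}
    (h : ¬ Function.Injective (walk M x)) : ∃ i, ∀ T, returnsAfter M (walk M x i) T := by
  obtain ⟨i, l, hl, h⟩ : ∃ i l, 0 < l ∧ walk M (walk M x i) l = walk M x i := by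
    rw [Function.Injective] at h
    push Not at h
    obtain ⟨i, j, h, hne⟩ := h
    rcases lt_or_gt_of_ne hne with hlt | hlt
    · exact ⟨i, j - i, by omega, by rw [← walk_add, Nat.sub_add_cancel hlt.le, h]⟩
    · exact ⟨j, i - j, by omega, by rw [← walk_add, Nat.sub_add_cancel hlt.le, h]⟩
  refine ⟨i, fun T => ⟨T * l, Nat.le_mul_of_pos_right _ hl, ?_⟩⟩
  suffices walk M (walk M x i) (T * l) = walk M x i by rw [this]
  induction T with
  | zero => simp [walk]
  | succ T ih => rw [add_mul, one_mul, walk_add, h, ih]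

lemma ae_injective_walk {C ρ : ℝ} (hρ0 : 0 < ρ) (hρ1 : ρ < 1)
    (hb : ∀ x, WhiteV x → northA x → ∀ T, ℙ.real {ω | returnsAfter (D ω) x T} ≤ C * ρ ^ T)
    {x : ℤ × ℤ} (hx : WhiteV x) (hx' : northA x) :
    ∀ᵐ ω ∂ℙ, Function.Injective (walk (D ω) x) := by
  have key : ∀ y, WhiteV y → northA y → ∀ᵐ ω ∂ℙ, ¬ ∀ T, returnsAfter (D ω) y T := by
    intro y hy hy'
    rw [ae_iff]
    simp only [not_not]
    have h0 : ℙ.real {ω | ∀ T, returnsAfter (D ω) y T} ≤ 0 := by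
      have ht : Filter.Tendsto (fun T : ℕ => C * ρ ^ T) Filter.atTop (nhds (C * 0)) :=
        (tendsto_pow_atTop_nhds_zero_of_lt_one hρ0.le hρ1).const_mul C
      rw [mul_zero] at ht
      exact ge_of_tendsto' ht fun T =>
        (measureReal_mono (fun ω (hω : ∀ T, returnsAfter (D ω) y T) => hω T) (measure_ne_top _ _)).trans (hb y hy hy' T)
    exact (measureReal_eq_zero_iff).1 (le_antisymm h0 measureReal_nonneg)
  have hall : ∀ᵐ ω ∂ℙ, ∀ y, WhiteV y → northA y → ¬ ∀ T, returnsAfter (D ω) y T := by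
    rw [ae_all_iff]
    intro y
    by_cases hy : WhiteV y ∧ northA y
    · filter_upwards [key y hy.1 hy.2] with ω h _ _ using h
    · exact Filter.Eventually.of_forall fun ω h1 h2 => absurd ⟨h1, h2⟩ hy
  filter_upwards [hall] with ω h
  by_contra hn
  obtain ⟨i, hi⟩ := returnsAfter_of_not_injective hn
  exact h _ (walk_class _ hx hx' i).1 (walk_class _ hx hx' i).2 hi


theorem exists_gaussian_tail {C ρ : ℝ} (hC : 1 ≤ C) (hρ0 : 0 < ρ) (hρ1 : ρ < 1)
    (hD : ∀ ω, IsFullMatching (D ω))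
    (hb : ∀ x, WhiteV x → northA x → ∀ T, ℙ.real {ω | returnsAfter (D ω) x T} ≤ C * ρ ^ T)
    {H : Ω → ℤ × ℤ → ℤ} (hH : ∀ ω, IsFullHeight (D ω) (H ω))
    (hanchor : ∀ ω, AnchoredAtInfinity (D ω) (H ω)) :
    ∃ d > (0 : ℝ), ∀ f : ℤ × ℤ, Even (f.1 + f.2) → ∀ m : ℝ, 0 < m →
      ℙ.real {ω | m < |(H ω f : ℝ)|} ≤ 2 * Real.exp (-d * m ^ 2) := by
  have hlog : 0 < -Real.log ρ := by have := Real.log_neg hρ0 hρ1; linarith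
  set d1 := -Real.log ρ / 512 with hd1
  have hd1' : 0 < d1 := by positivity
  obtain ⟨N, hN⟩ := pow_unbounded_of_one_lt (C * Real.exp (1024 * d1)) (one_lt_two : (1 : ℝ) < 2)
  have hC' : 1 ≤ C * Real.exp (1024 * d1) := by
    have := Real.add_one_le_exp (1024 * d1)
    nlinarith
  have hN0 : N ≠ 0 := by rintro rfl; rw [pow_zero] at hN; linarith
  have hNpos : (0 : ℝ) < N := by positivity
  refine ⟨d1 / N, by positivity, fun f hf m hm => ?_⟩
  have hmain : ℙ.real {ω | m < |(H ω f : ℝ)|} ≤ C * Real.exp (1024 * d1) * Real.exp (-d1 * m ^ 2) := by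
    rcases lt_or_ge m 20 with hm20 | hm20
    · refine measureReal_le_one.trans ?_
      rw [mul_assoc, ← Real.exp_add]
      have := Real.add_one_le_exp (1024 * d1 + -d1 * m ^ 2)
      have h2 : m ^ 2 ≤ 400 := by nlinarith
      nlinarith [Real.exp_pos (1024 * d1 + -d1 * m ^ 2)]
    · obtain ⟨b, hb1, hb2, -, -, l, hl, hval⟩ := exists_height_eq f hf
      set k := ⌊m ^ 2 / 1024⌋₊ with hk
      have hk1 : (k : ℝ) ≤ m ^ 2 / 1024 := Nat.floor_le (by positivity)
      have hk2 : m ^ 2 / 1024 < k + 1 := Nat.lt_floor_add_one _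
      have hsub : {ω | m < |(H ω f : ℝ)|} ≤ᵐ[ℙ] {ω | returnsAfter (D ω) b (2 * k)} := by
        filter_upwards [ae_injective_walk hρ0 hρ1 hb hb1 hb2] with ω hinj hω
        change m < |(H ω f : ℝ)| at hω
        change returnsAfter (D ω) b (2 * k)
        by_contra hn
        simp only [returnsAfter, not_exists, not_and, not_le] at hn
        have h1 := sq_windPath_le (p := walk (D ω) b) rfl (fun t => ⟨_, walk_succ _ _ _⟩) hinj hn
        have h2 := hval (D ω) (H ω) (hD ω) (hH ω) (hanchor ω)
        have h3 : |H ω f| ≤ 4 * |windPath (walk (D ω) b) b| + 6 := by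
          rw [h2]
          refine (abs_add_le _ _).trans (add_le_add ?_ (hl _))
          rw [abs_mul]; norm_num
        have h4 : |(H ω f : ℝ)| ≤ 4 * ((|windPath (walk (D ω) b) b| : ℤ) : ℝ) + 6 := by
          exact_mod_cast h3
        have h5 : (((|windPath (walk (D ω) b) b| : ℤ) : ℝ) - 1) ^ 2 ≤ 8 * k + 1 := by
          exact_mod_cast h1
        nlinarith
      have h1 : ℙ.real {ω | m < |(H ω f : ℝ)|} ≤ C * ρ ^ (2 * k) :=
        (ENNReal.toReal_mono (measure_ne_top _ _) (measure_mono_ae hsub)).trans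
          (hb b hb1 hb2 (2 * k))
      refine h1.trans ?_
      rw [mul_assoc, ← Real.exp_add]
      refine mul_le_mul_of_nonneg_left ?_ (by linarith)
      rw [← Real.exp_log (pow_pos hρ0 _), Real.log_pow]
      refine Real.exp_le_exp.2 ?_
      have : Real.log ρ = -(512 * d1) := by rw [hd1]; ring
      rw [this]
      push_cast
      nlinarith
  have hx : Real.exp (-(d1 / N) * m ^ 2) ^ N = Real.exp (-d1 * m ^ 2) := by
    rw [← Real.exp_nat_mul]
    congr 1
    field_simp
  rw [← hx] at hmain
  rcases le_or_gt 1 (2 * Real.exp (-(d1 / N) * m ^ 2)) with h | h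
  · exact measureReal_le_one.trans h
  · refine hmain.trans ?_
    refine (mul_le_mul_of_nonneg_right hN.le (by positivity)).trans ?_
    rw [← mul_pow]
    exact pow_le_of_le_one (by positivity) h.le hN0

end

/-! ### Determinants with a small off-diagonal block -/

lemma abs_det_sub_det_le {ι : Type*} [Fintype ι] [DecidableEq ι] (M M₀ : Matrix ι ι ℝ) (N : ι → ι → ℝ) {θ : ℝ} (hθ : 0 ≤ θ)
    (hN : ∀ i j, 0 ≤ N i j)
    (h : ∀ f : ι → ι, |∏ i, M i (f i) - ∏ i, M₀ i (f i)| ≤ θ * ∏ i, N i (f i)) :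
    |M.det - M₀.det| ≤ θ * ∏ i, ∑ j, N i j := by
  have hprod : ∏ i, ∑ j, N i j = ∑ f : ι → ι, ∏ i, N i (f i) := by
    rw [Finset.prod_univ_sum, Fintype.piFinset_univ]
  have hdet : ∀ P : Matrix ι ι ℝ, P.det =
      ∑ σ : Equiv.Perm ι, ((Equiv.Perm.sign σ : ℤ) : ℝ) * ∏ i, P i (σ i) := fun P => by
    rw [← Matrix.det_transpose P, Matrix.det_apply']
    rfl
  rw [hdet, hdet, ← Finset.sum_sub_distrib, hprod, Finset.mul_sum]
  calc |∑ σ : Equiv.Perm ι, (((Equiv.Perm.sign σ : ℤ) : ℝ) * ∏ i, M i (σ i)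
          - ((Equiv.Perm.sign σ : ℤ) : ℝ) * ∏ i, M₀ i (σ i))|
      ≤ ∑ σ : Equiv.Perm ι, θ * ∏ i, N i (σ i) := by
        refine (Finset.abs_sum_le_sum_abs _ _).trans (Finset.sum_le_sum fun σ _ => ?_)
        rw [← mul_sub, abs_mul]
        have : |((Equiv.Perm.sign σ : ℤ) : ℝ)| = 1 := by
          rcases Int.units_eq_one_or (Equiv.Perm.sign σ) with h | h <;> simp [h]
        rw [this, one_mul]
        exact h σ
    _ = ∑ f ∈ Finset.univ.map (⟨fun σ : Equiv.Perm ι => (σ : ι → ι), DFunLike.coe_injective⟩ :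
          Equiv.Perm ι ↪ (ι → ι)), θ * ∏ i, N i (f i) := by rw [Finset.sum_map]; rfl
    _ ≤ ∑ f : ι → ι, θ * ∏ i, N i (f i) :=
        Finset.sum_le_univ_sum_of_nonneg fun f =>
          mul_nonneg hθ (Finset.prod_nonneg fun i _ => hN _ _)

theorem abs_det_fromBlocks_sub_le {m n : Type*} [Fintype m] [Fintype n] (A : Matrix m m ℝ)
    (B : Matrix m n ℝ) (C : Matrix n m ℝ) (E : Matrix n n ℝ) {R δ t : ℝ} (hδ : 0 ≤ δ)
    (ht : t = Fintype.card m + Fintype.card n) (ht0 : 0 < t) (htδ : t * δ ≤ 1)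
    (hA : ∀ i, ∑ j, |A i j| ≤ R) (hE : ∀ i, ∑ j, |E i j| ≤ R)
    (hB : ∀ i j, |B i j| ≤ δ) (hC : ∀ i j, |C i j| ≤ δ) :
    |(Matrix.fromBlocks A B C E).det - A.det * E.det|
      ≤ t * δ * (R + 1) ^ (Fintype.card m + Fintype.card n) := by
  rw [← Matrix.det_fromBlocks_zero₁₂ A C E]
  obtain ⟨N, hAA, hAE, hEA, hEE⟩ : ∃ N : m ⊕ n → m ⊕ n → ℝ,
      (∀ i j, N (Sum.inl i) (Sum.inl j) = |A i j|) ∧ (∀ i j, N (Sum.inl i) (Sum.inr j) = 1 / t) ∧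
      (∀ i j, N (Sum.inr i) (Sum.inl j) = 1 / t) ∧ ∀ i j, N (Sum.inr i) (Sum.inr j) = |E i j| :=
    ⟨Sum.elim (fun i => Sum.elim (fun j => |A i j|) fun _ => 1 / t)
      fun i => Sum.elim (fun _ => 1 / t) fun j => |E i j|,
      fun _ _ => rfl, fun _ _ => rfl, fun _ _ => rfl, fun _ _ => rfl⟩
  have hN0 : ∀ i j, 0 ≤ N i j := by
    have : 0 ≤ 1 / t := by positivity
    rintro (i | i) (j | j)
    · rw [hAA]; exact abs_nonneg _
    · rwa [hAE]
    · rwa [hEA]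
    · rw [hEE]; exact abs_nonneg _
  have hθ : 0 ≤ t * δ := by positivity
  have hδt : δ ≤ 1 / t := by rw [le_div_iff₀ ht0]; linarith
  have hMN : ∀ i j, |Matrix.fromBlocks A B C E i j| ≤ N i j := by
    rintro (i | i) (j | j)
    · rw [hAA]; rfl
    · rw [hAE]; exact (hB i j).trans hδt
    · rw [hEA]; exact (hC i j).trans hδt
    · rw [hEE]; rfl
  refine (abs_det_sub_det_le _ _ N hθ hN0 fun f => ?_).trans ?_
  · by_cases hf : ∃ i j, f (Sum.inl i) = Sum.inr j
    · obtain ⟨i, j, hij⟩ := hf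
      rw [Finset.prod_eq_zero (f := fun x => Matrix.fromBlocks A 0 C E x (f x))
        (Finset.mem_univ (Sum.inl i)) (by simp [hij]), sub_zero, Finset.abs_prod,
        ← Finset.mul_prod_erase _ _ (Finset.mem_univ (Sum.inl i)),
        ← Finset.mul_prod_erase _ (fun x => N x (f x)) (Finset.mem_univ (Sum.inl i)), ← mul_assoc]
      refine mul_le_mul ?_ (Finset.prod_le_prod (fun _ _ => abs_nonneg _) fun x _ => hMN _ _)
        (Finset.prod_nonneg fun _ _ => abs_nonneg _) (mul_nonneg hθ (hN0 _ _))
      rw [hij, hAE, mul_comm t, mul_assoc,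
        mul_one_div_cancel ht0.ne', mul_one]
      exact hB i j
    · push Not at hf
      have : ∀ x, Matrix.fromBlocks A B C E x (f x) = Matrix.fromBlocks A 0 C E x (f x) := by
        rintro (i | i)
        · rcases h : f (Sum.inl i) with j | j
          · simp
          · exact absurd h (hf i j)
        · rcases h : f (Sum.inr i) with j | j <;> simp
      rw [Finset.prod_congr rfl fun x _ => this x, sub_self, abs_zero]
      exact mul_nonneg hθ (Finset.prod_nonneg fun _ _ => hN0 _ _)
  · refine mul_le_mul_of_nonneg_left ?_ hθ
    rw [← Fintype.card_sum]
    refine (Finset.prod_le_prod (fun i _ => Finset.sum_nonneg fun j _ => hN0 i j)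
      fun i _ => (?_ : _ ≤ R + 1)).trans (by rw [Finset.prod_const, Finset.card_univ])
    have h1 : (Fintype.card n : ℝ) * (1 / t) ≤ 1 := by
      rw [mul_one_div, div_le_one ht0, ht]; simp
    have h2 : (Fintype.card m : ℝ) * (1 / t) ≤ 1 := by
      rw [mul_one_div, div_le_one ht0, ht]; simp
    rcases i with i | i
    · simp only [Fintype.sum_sum_type, hAA, hAE]
      rw [Finset.sum_const, Finset.card_univ, nsmul_eq_mul]
      exact add_le_add (hA i) h1
    · simp only [Fintype.sum_sum_type, hEA, hEE]
      rw [Finset.sum_const, Finset.card_univ, nsmul_eq_mul, add_comm]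
      exact add_le_add (hE i) h2

/-! ### Row sums of the walk kernel -/

lemma sum_pk_one_le (k : ℕ) (s : Finset (ℤ × ℤ)) : ∑ v ∈ s, pk 1 k v ≤ 4 ^ k := by
  induction k generalizing s with
  | zero =>
    simp only [pk_zero, Finset.sum_ite_eq', pow_zero]
    split_ifs <;> norm_num
  | succ k ih =>
    simp only [← pk_one_succ]
    rw [Finset.sum_comm]
    have : ∀ d : Bool × Bool, ∑ v ∈ s, pk 1 k (v + 2 • dv d) ≤ 4 ^ k := fun d => by
      refine le_trans (le_of_eq ?_) (ih (s.map (addRightEmbedding (2 • dv d))))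
      rw [Finset.sum_map]; rfl
    refine (Finset.sum_le_sum fun d _ => this d).trans ?_
    simp [pow_succ]; linarith

lemma gr_one_nonneg {r : ℝ} (hr : 0 ≤ r) (v : ℤ × ℤ) : 0 ≤ gr 1 r v :=
  tsum_nonneg fun k => mul_nonneg (by positivity) (pk_one_nonneg _ _)

lemma sum_gr_one_le {r : ℝ} (hr : 0 ≤ r) (hr' : 4 * r < 1) {ι : Type*} [Fintype ι]
    {v : ι → ℤ × ℤ} (hv : Function.Injective v) (u : ℤ × ℤ) :
    ∑ j, gr 1 r (u - v j) ≤ 1 / (1 - 4 * r) := by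
  simp only [gr]
  rw [← Summable.tsum_finsetSum fun j _ => summable_gr (Or.inl rfl) hr hr' _]
  have hg := hasSum_geometric_of_lt_one (by positivity : 0 ≤ 4 * r) hr'
  rw [one_div, ← hg.tsum_eq]
  refine Summable.tsum_le_tsum (fun k => ?_)
    (summable_sum fun j _ => summable_gr (Or.inl rfl) hr hr' _) hg.summable
  rw [← Finset.mul_sum, mul_pow, mul_comm]
  refine mul_le_mul_of_nonneg_right ?_ (by positivity)
  have hinj : Function.Injective fun j => u - v j := fun i j h => hv (sub_right_injective h)
  refine le_trans (le_of_eq ?_) (sum_pk_one_le k (Finset.univ.map ⟨_, hinj⟩))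
  rw [Finset.sum_map]; rfl

/-- The entry of the determinantal kernel at displacement `u`, for an edge in direction `d`. -/
def ker (a : ℝ) (d : Bool × Bool) (u : ℤ × ℤ) : ℝ :=
  ea a d * gr 1 (kap a) u - gr 1 (kap a) (u + 2 • dv d)

/-- A bound on the row sums of the determinantal kernel. -/
def kerR (a : ℝ) : ℝ := (a⁻¹ + 1) / (1 - 4 * kap a)

lemma ea_le {a : ℝ} (ha : a ∈ Set.Ioo (0 : ℝ) 1) (d : Bool × Bool) : ea a d ≤ a⁻¹ := by
  have h1 : 1 ≤ a⁻¹ := (one_le_inv₀ ha.1).2 ha.2.le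
  unfold ea
  split_ifs
  · exact ha.2.le.trans h1
  · rfl

lemma kerR_pos {a : ℝ} (ha : a ∈ Set.Ioo (0 : ℝ) 1) : 0 < kerR a := by
  have := four_kap_lt ha
  have := ha.1
  unfold kerR
  exact div_pos (by positivity) (by linarith)

lemma sum_abs_ker_le {a : ℝ} (ha : a ∈ Set.Ioo (0 : ℝ) 1) {ι : Type*} [Fintype ι]
    {v : ι → ℤ × ℤ} (hv : Function.Injective v) (d : Bool × Bool) (u : ℤ × ℤ) :
    ∑ j, |ker a d (u - v j)| ≤ kerR a := by
  have hk := (kap_pos ha).le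
  have hk' := four_kap_lt ha
  have h1 := sum_gr_one_le hk hk' hv u
  have h2 := sum_gr_one_le hk hk' hv (u + 2 • dv d)
  have h3 : 0 < a⁻¹ := inv_pos.2 ha.1
  calc ∑ j, |ker a d (u - v j)|
      ≤ ∑ j, (a⁻¹ * gr 1 (kap a) (u - v j) + gr 1 (kap a) (u + 2 • dv d - v j)) := by
        refine Finset.sum_le_sum fun j _ => ?_
        rw [ker, sub_add_eq_add_sub]
        refine (abs_sub _ _).trans (add_le_add ?_ (abs_of_nonneg (gr_one_nonneg hk _)).le)
        rw [abs_mul, abs_of_pos (ea_pos ha.1 d), abs_of_nonneg (gr_one_nonneg hk _)]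
        exact mul_le_mul_of_nonneg_right (ea_le ha d) (gr_one_nonneg hk _)
    _ ≤ a⁻¹ * (1 / (1 - 4 * kap a)) + 1 / (1 - 4 * kap a) := by
        rw [Finset.sum_add_distrib, ← Finset.mul_sum]
        exact add_le_add (mul_le_mul_of_nonneg_left h1 h3.le) h2
    _ = kerR a := by rw [kerR]; ring

lemma abs_ker_le {a : ℝ} (ha : a ∈ Set.Ioo (0 : ℝ) 1) (d : Bool × Bool) {u : ℤ × ℤ} {L : ℕ}
    (hu : 2 * (L : ℤ) < max |u.1| |u.2|) : |ker a d u| ≤ kerR a * (4 * kap a) ^ L := by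
  have hk := (kap_pos ha).le
  have hk' := four_kap_lt ha
  have h3 : 0 < a⁻¹ := inv_pos.2 ha.1
  have h1 := abs_gr_le_of_dist (s := 1) (Or.inl rfl) hk hk' L u (by omega)
  have h2 := abs_gr_le_of_dist (s := 1) (Or.inl rfl) hk hk' L (u + 2 • dv d) (by
    obtain ⟨d1, d2⟩ := d
    rw [lt_max_iff, lt_abs, lt_abs] at hu ⊢
    cases d1 <;> cases d2 <;> simp [dv, sg] <;> omega)
  calc |ker a d u| ≤ a⁻¹ * ((4 * kap a) ^ L / (1 - 4 * kap a)) + (4 * kap a) ^ L / (1 - 4 * kap a) := by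
        rw [ker]
        refine (abs_sub _ _).trans (add_le_add ?_ h2)
        rw [abs_mul, abs_of_pos (ea_pos ha.1 d)]
        exact mul_le_mul (ea_le ha d) h1 (abs_nonneg _) h3.le
    _ = kerR a * (4 * kap a) ^ L := by rw [kerR]; ring

/-! ### Joint laws of separated forest paths -/

lemma abs_gam_sub_le (x : ℤ × ℤ) (w : List (Bool × Bool)) (i : ℕ) :
    |(gam x w i).1 - x.1| ≤ 2 * (w.length : ℤ) ∧ |(gam x w i).2 - x.2| ≤ 2 * (w.length : ℤ) := by
  induction w generalizing x i with
  | nil => cases i <;> simp [gam]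
  | cons d w ih =>
    cases i with
    | zero => simp [gam]; positivity
    | succ i =>
      have h := ih (x + 2 • dv d) i
      rw [gam, List.length_cons]
      rw [abs_le, abs_le] at h ⊢
      obtain ⟨d1, d2⟩ := d
      cases d1 <;> cases d2 <;> simp [dv, sg] at h ⊢ <;> omega

section
open MeasureTheory
variable {a : ℝ} {Ω : Type*} [MeasurableSpace Ω] {ℙ : Measure Ω}
    [IsProbabilityMeasure ℙ] {D : Ω → Set ((ℤ × ℤ) × (ℤ × ℤ))}

theorem abs_measureReal_pair_sub_le (ha : a ∈ Set.Ioo (0 : ℝ) 1)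
    (hlim : ∀ E : Finset ((ℤ × ℤ) × (ℤ × ℤ)),
      Filter.Tendsto (fun m : ℕ => aztecCylProb a (4 * ((m : ℤ) + 1)) E) Filter.atTop
        (nhds ((ℙ {ω | ∀ e ∈ E, e ∈ D ω}).toReal)))
    {ι κ : Type*} [Fintype ι] [Fintype κ] {L : ℕ} {t : ℝ} {v : ι → ℤ × ℤ} {v' : κ → ℤ × ℤ}
    (hv : Function.Injective v) (hv' : Function.Injective v')
    (hvw : ∀ i, WhiteV (v i)) (hvn : ∀ i, northA (v i))
    (hvw' : ∀ i, WhiteV (v' i)) (hvn' : ∀ i, northA (v' i))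
    (d : ι → Bool × Bool) (d' : κ → Bool × Bool)
    (hsep : ∀ i j, 2 * (L : ℤ) < max |(v i - v' j).1| |(v i - v' j).2|)
    (ht : t = Fintype.card ι + Fintype.card κ) (ht0 : 0 < t)
    (htδ : t * (kerR a * (4 * kap a) ^ L) ≤ 1) :
    |ℙ.real {ω | (∀ i, (v i, v i + dv (d i)) ∈ D ω) ∧ ∀ i, (v' i, v' i + dv (d' i)) ∈ D ω}
        - ℙ.real {ω | ∀ i, (v i, v i + dv (d i)) ∈ D ω}
          * ℙ.real {ω | ∀ i, (v' i, v' i + dv (d' i)) ∈ D ω}|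
      ≤ t * (kerR a * (4 * kap a) ^ L) * (kerR a + 1) ^ (Fintype.card ι + Fintype.card κ) := by
  have hk := kap_pos ha
  have hk' := four_kap_lt ha
  have hR := kerR_pos ha
  have hsep' : ∀ i j, 2 * (L : ℤ) < max |(v' j - v i).1| |(v' j - v i).2| := by
    intro i j
    have := hsep i j
    rwa [← neg_sub (v i), Prod.fst_neg, Prod.snd_neg, abs_neg, abs_neg]
  have hinj : Function.Injective (Sum.elim v v') := by
    refine hv.sumElim hv' fun i j h => ?_
    have := hsep i j
    rw [h, sub_self] at this
    simp only [Prod.fst_zero, Prod.snd_zero, abs_zero, max_self] at this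
    omega
  have e1 := measure_eq_det_walk ha ℙ hlim hv hvw hvn d
  have e2 := measure_eq_det_walk ha ℙ hlim hv' hvw' hvn' d'
  have e3 := measure_eq_det_walk ha ℙ hlim hinj (by rintro (i | i); exacts [hvw i, hvw' i])
    (by rintro (i | i); exacts [hvn i, hvn' i]) (Sum.elim d d')
  have s3 : {ω | ∀ i, (Sum.elim v v' i, Sum.elim v v' i + dv (Sum.elim d d' i)) ∈ D ω} =
      {ω | (∀ i, (v i, v i + dv (d i)) ∈ D ω) ∧ ∀ i, (v' i, v' i + dv (d' i)) ∈ D ω} := by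
    ext ω
    exact Sum.forall
  have hker : ∀ (p q : ℤ × ℤ) (d : Bool × Bool),
      ea a d * gr 1 (kap a) (p - q) - gr 1 (kap a) (p + 2 • dv d - q) = ker a d (p - q) := by
    intro p q d
    rw [ker, sub_add_eq_add_sub]
  rw [s3] at e3
  simp only [hker] at e1 e2 e3
  obtain ⟨A, hA⟩ : ∃ A : Matrix ι ι ℝ, A = Matrix.of fun i j => ker a (d i) (v i - v j) := ⟨_, rfl⟩
  obtain ⟨E, hE⟩ : ∃ E : Matrix κ κ ℝ, E = Matrix.of fun i j => ker a (d' i) (v' i - v' j) :=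
    ⟨_, rfl⟩
  obtain ⟨B, hB⟩ : ∃ B : Matrix ι κ ℝ, B = Matrix.of fun i j => ker a (d i) (v i - v' j) :=
    ⟨_, rfl⟩
  obtain ⟨C, hC⟩ : ∃ C : Matrix κ ι ℝ, C = Matrix.of fun i j => ker a (d' i) (v' i - v j) :=
    ⟨_, rfl⟩
  have hblock : (Matrix.of fun i j => ker a (Sum.elim d d' i) (Sum.elim v v' i - Sum.elim v v' j)) =
      Matrix.fromBlocks A B C E := by
    rw [hA, hB, hC, hE]
    ext (i | i) (j | j) <;> rfl
  rw [hblock] at e3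
  rw [← hA] at e1
  rw [← hE] at e2
  have hmain := abs_det_fromBlocks_sub_le A B C E (R := kerR a) (t := t)
    (by positivity : 0 ≤ kerR a * (4 * kap a) ^ L) ht ht0 htδ
    (fun i => by rw [hA]; exact sum_abs_ker_le ha hv _ _)
    (fun i => by rw [hE]; exact sum_abs_ker_le ha hv' _ _)
    (fun i j => by rw [hB]; exact abs_ker_le ha _ (hsep i j))
    (fun i j => by rw [hC]; exact abs_ker_le ha _ (hsep' j i))
  rw [Fintype.card_sum] at e3
  obtain ⟨x, hx⟩ : ∃ x, x = (Matrix.fromBlocks A B C E).det := ⟨_, rfl⟩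
  rw [← hx] at hmain
  have e3' : ℙ.real {ω | (∀ i, (v i, v i + dv (d i)) ∈ D ω) ∧ ∀ i, (v' i, v' i + dv (d' i)) ∈ D ω}
      = kap a ^ (Fintype.card ι + Fintype.card κ) * x := by
    rw [hx]
    refine e3.trans ?_
    congr!
  change ℙ.real _ = _ at e1
  change ℙ.real _ = _ at e2
  rw [e1, e2, e3', pow_add, mul_mul_mul_comm, ← mul_sub, abs_mul, abs_of_pos (by positivity),
    ← pow_add]
  refine (mul_le_of_le_one_left (abs_nonneg _) (pow_le_one₀ hk.le (by linarith))).trans hmain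

theorem abs_measureReal_follows_sub_le (ha : a ∈ Set.Ioo (0 : ℝ) 1)
    (hlim : ∀ E : Finset ((ℤ × ℤ) × (ℤ × ℤ)),
      Filter.Tendsto (fun m : ℕ => aztecCylProb a (4 * ((m : ℤ) + 1)) E) Filter.atTop
        (nhds ((ℙ {ω | ∀ e ∈ E, e ∈ D ω}).toReal)))
    {x x' : ℤ × ℤ} (hx : WhiteV x) (hxn : northA x) (hx' : WhiteV x') (hxn' : northA x')
    {n L : ℕ} (hn : 0 < n) (hdist : 2 * (L : ℤ) + 4 * n < max |x.1 - x'.1| |x.2 - x'.2|)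
    {w w' : List (Bool × Bool)} (hw : w.length = n) (hw' : w'.length = n) :
    |ℙ.real {ω | follows (D ω) x w ∧ follows (D ω) x' w'}
        - ℙ.real {ω | follows (D ω) x w} * ℙ.real {ω | follows (D ω) x' w'}|
      ≤ 2 * n * (kerR a * (4 * kap a) ^ L) * (kerR a + 1) ^ (n + n) := by
  have hk := kap_pos ha
  have hk' := four_kap_lt ha
  have hR := kerR_pos ha
  have hn' : (0 : ℝ) < n := by exact_mod_cast hn
  set δ := kerR a * (4 * kap a) ^ L with hδ
  have hδ0 : 0 ≤ δ := by positivity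
  have hbound : 0 ≤ 2 * n * δ * (kerR a + 1) ^ (n + n) := by positivity
  have h01 : ∀ s : Set Ω, 0 ≤ ℙ.real s ∧ ℙ.real s ≤ 1 := fun s =>
    ⟨measureReal_nonneg, measureReal_le_one⟩
  set J := {ω | follows (D ω) x w ∧ follows (D ω) x' w'} with hJ
  set F := {ω | follows (D ω) x w} with hF
  set F' := {ω | follows (D ω) x' w'} with hF'
  have hJF : ℙ.real J ≤ ℙ.real F := measureReal_mono (fun ω hω => hω.1) (measure_ne_top _ _)
  have hJF' : ℙ.real J ≤ ℙ.real F' := measureReal_mono (fun ω hω => hω.2) (measure_ne_top _ _)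
  rcases lt_or_ge 1 (2 * n * δ) with hlarge | hsmall
  · have h1 := h01 J
    have h2 := h01 F
    have h3 := h01 F'
    have h4 : 0 ≤ ℙ.real F * ℙ.real F' := mul_nonneg h2.1 h3.1
    have h5 : ℙ.real F * ℙ.real F' ≤ 1 := mul_le_one₀ h2.2 h3.1 h3.2
    have h6 : 1 ≤ 2 * n * δ * (kerR a + 1) ^ (n + n) :=
      one_le_mul_of_one_le_of_one_le hlarge.le (one_le_pow₀ (by linarith))
    refine le_trans ?_ h6
    rw [abs_le]; constructor <;> linarith
  by_cases hnd : (vis [] x w).Nodup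
  swap
  · have h0 : ℙ.real F = 0 := measure_follows_eq_zero ha hlim hx hxn hnd
    rw [h0, zero_mul, sub_zero, le_antisymm (hJF.trans h0.le) (h01 J).1, abs_zero]
    exact hbound
  by_cases hnd' : (vis [] x' w').Nodup
  swap
  · have h0 : ℙ.real F' = 0 := measure_follows_eq_zero ha hlim hx' hxn' hnd'
    rw [h0, mul_zero, sub_zero, le_antisymm (hJF'.trans h0.le) (h01 J).1, abs_zero]
    exact hbound
  have hsep : ∀ (i j : ℕ), 2 * (L : ℤ) < max |(gam x w i - gam x' w' j).1| |(gam x w i - gam x' w' j).2| := by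
    intro i j
    have h1 := abs_gam_sub_le x w i
    have h2 := abs_gam_sub_le x' w' j
    rw [hw, abs_le, abs_le] at h1
    rw [hw', abs_le, abs_le] at h2
    simp only [Prod.fst_sub, Prod.snd_sub]
    rw [lt_max_iff, lt_abs, lt_abs] at hdist ⊢
    omega
  have s1 : {ω | ∀ i : Fin w.length, (gam x w i, gam x w i + dv (w.get i)) ∈ D ω} = F := by
    ext ω; exact (follows_iff _ _ _).symm
  have s2 : {ω | ∀ i : Fin w'.length, (gam x' w' i, gam x' w' i + dv (w'.get i)) ∈ D ω} = F' := by
    ext ω; exact (follows_iff _ _ _).symm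
  have s3 : {ω | (∀ i : Fin w.length, (gam x w i, gam x w i + dv (w.get i)) ∈ D ω) ∧
      ∀ i : Fin w'.length, (gam x' w' i, gam x' w' i + dv (w'.get i)) ∈ D ω} = J := by
    ext ω
    exact and_congr (follows_iff _ _ _).symm (follows_iff _ _ _).symm
  have hmain := abs_measureReal_pair_sub_le ha hlim (t := 2 * n) (gam_injOn hnd) (gam_injOn hnd')
    (fun i => (gam_class hx hxn w i).1) (fun i => (gam_class hx hxn w i).2)
    (fun i => (gam_class hx' hxn' w' i).1) (fun i => (gam_class hx' hxn' w' i).2)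
    w.get w'.get (fun i j => hsep i j) (by simp only [Fintype.card_fin]; rw [hw, hw']; ring)
    (by positivity) hsmall
  rw [s1, s2, s3] at hmain
  simp only [Fintype.card_fin] at hmain
  rwa [hw, hw'] at hmain

end

/-! ### Truncation -/

section
open MeasureTheory Filter
variable {Ω : Type*} [MeasurableSpace Ω] {ℙ : Measure Ω} [IsProbabilityMeasure ℙ]

lemma exists_sq_mul_pow_le {ρ ν : ℝ} (hρ : 0 < ρ) (hν : ρ < ν) :
    ∃ K, 0 ≤ K ∧ ∀ S : ℕ, ((S : ℝ) + 2) ^ 2 * ρ ^ S ≤ K * ν ^ S := by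
  have hν0 : 0 < ν := hρ.trans hν
  obtain ⟨r, hr⟩ : ∃ r, r = ρ / ν := ⟨_, rfl⟩
  have hr0 : 0 < r := hr ▸ div_pos hρ hν0
  have hr1 : r < 1 := by rw [hr, div_lt_one hν0]; exact hν
  have hρr : ρ = r * ν := by rw [hr, div_mul_cancel₀ _ hν0.ne']
  obtain ⟨B, hB⟩ := (tendsto_pow_const_mul_const_pow_of_abs_lt_one 2
    (r := r) (by rwa [abs_of_pos hr0])).bddAbove_range
  have hB' : ∀ n : ℕ, (n : ℝ) ^ 2 * r ^ n ≤ B := fun n => hB ⟨n, rfl⟩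
  have hB0 : 0 ≤ B := le_trans (by simp) (hB' 0)
  refine ⟨B / r ^ 2, by positivity, fun S => ?_⟩
  have h := hB' (S + 2)
  push_cast at h
  rw [hρr, mul_pow, ← mul_assoc]
  refine mul_le_mul_of_nonneg_right ?_ (by positivity)
  rw [le_div_iff₀ (by positivity), mul_assoc, ← pow_add]
  exact h

lemma ae_exists_notMem {C ρ : ℝ} (hρ0 : 0 < ρ) (hρ1 : ρ < 1) {Bad : ℕ → Set Ω}
    (hP : ∀ T, ℙ.real (Bad T) ≤ C * ρ ^ T) : ∀ᵐ ω ∂ℙ, ∃ T, ω ∉ Bad T := by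
  rw [ae_iff]
  have h0 : ℙ.real {ω | ¬ ∃ T, ω ∉ Bad T} ≤ 0 := by
    have ht : Tendsto (fun T : ℕ => C * ρ ^ T) atTop (nhds (C * 0)) :=
      (tendsto_pow_atTop_nhds_zero_of_lt_one hρ0.le hρ1).const_mul C
    rw [mul_zero] at ht
    refine ge_of_tendsto' ht fun T => (measureReal_mono (fun ω hω => ?_) (measure_ne_top _ _)).trans (hP T)
    by_contra h
    exact hω ⟨T, h⟩
  exact (measureReal_eq_zero_iff (measure_ne_top _ _)).1 (le_antisymm h0 measureReal_nonneg)

theorem exists_truncation_bound {C K ρ : ℝ} (hC : 0 ≤ C) (hK : 0 ≤ K) (hρ0 : 0 < ρ) (hρ1 : ρ < 1) :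
    ∃ ν, 0 < ν ∧ ν < 1 ∧ ∃ K', 0 ≤ K' ∧
      ∀ (Z : Ω → ℝ) (V : ℕ → Ω → ℝ) (Bad : ℕ → Set Ω), (∀ T, Measurable (V T)) → Antitone Bad →
        (∀ T, ℙ.real (Bad T) ≤ C * ρ ^ T) → (∀ T ω, |V T ω| ≤ K * ((T : ℝ) + 1) ^ 2) →
        (∀ T ω, ω ∉ Bad T → Z ω = V T ω) →
        ∀ T, |∫ ω, Z ω ∂ℙ - ∫ ω, V T ω ∂ℙ| ≤ K' * ν ^ T := by
  obtain ⟨ν, hρν, hν1⟩ := exists_between hρ1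
  have hν0 : 0 < ν := hρ0.trans hρν
  obtain ⟨K1, hK1, hS⟩ := exists_sq_mul_pow_le hρ0 hρν
  refine ⟨ν, hν0, hν1, 2 * K * C * K1 * (1 - ν)⁻¹, by
    have : 0 < 1 - ν := by linarith
    positivity, ?_⟩
  intro Z V Bad hV hBad hP hVb hZ T
  have hVint : ∀ S, Integrable (V S) ℙ := fun S =>
    Integrable.of_bound (hV S).aestronglyMeasurable (K * ((S : ℝ) + 1) ^ 2)
      (ae_of_all _ fun ω => hVb S ω)
  have hW : ∀ S, ∫ ω, ‖V (S + 1) ω - V S ω‖ ∂ℙ ≤ 2 * K * C * K1 * ν ^ S := by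
    intro S
    have hms : MeasurableSet {ω | V (S + 1) ω - V S ω ≠ 0} :=
      ((hV (S + 1)).sub (hV S)) (measurableSet_singleton 0).compl
    have hle : ∀ ω, ‖V (S + 1) ω - V S ω‖ ≤
        {ω | V (S + 1) ω - V S ω ≠ 0}.indicator (fun _ => 2 * K * ((S : ℝ) + 2) ^ 2) ω := by
      intro ω
      by_cases h : V (S + 1) ω - V S ω = 0
      · rw [h, norm_zero, Set.indicator_of_notMem (by simpa using h)]
      · rw [Set.indicator_of_mem (by exact h), Real.norm_eq_abs]
        have h1 := hVb S ω
        have h2 := hVb (S + 1) ω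
        push_cast at h2
        have h3 : K * ((S : ℝ) + 1) ^ 2 ≤ K * ((S : ℝ) + 2) ^ 2 := by gcongr; norm_num
        have h4 : (S : ℝ) + 1 + 1 = S + 2 := by ring
        rw [h4] at h2
        refine (abs_sub _ _).trans ?_
        linarith
    have hsub : {ω | V (S + 1) ω - V S ω ≠ 0} ⊆ Bad S := by
      intro ω hω
      by_contra h
      refine hω ?_
      rw [← hZ S ω h, ← hZ (S + 1) ω (fun h' => h (hBad (Nat.le_succ S) h')), sub_self]
    have hPr : ℙ.real {ω | V (S + 1) ω - V S ω ≠ 0} ≤ C * ρ ^ S :=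
      (measureReal_mono hsub (measure_ne_top _ _)).trans (hP S)
    calc ∫ ω, ‖V (S + 1) ω - V S ω‖ ∂ℙ
        ≤ ∫ ω, {ω | V (S + 1) ω - V S ω ≠ 0}.indicator
            (fun _ => 2 * K * ((S : ℝ) + 2) ^ 2) ω ∂ℙ :=
          integral_mono ((hVint (S + 1)).sub (hVint S)).norm
            ((integrable_const _).indicator hms) hle
      _ = ℙ.real {ω | V (S + 1) ω - V S ω ≠ 0} * (2 * K * ((S : ℝ) + 2) ^ 2) := by
          rw [integral_indicator_const _ hms, smul_eq_mul]
      _ ≤ C * ρ ^ S * (2 * K * ((S : ℝ) + 2) ^ 2) :=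
          mul_le_mul_of_nonneg_right hPr (by positivity)
      _ = 2 * K * C * (((S : ℝ) + 2) ^ 2 * ρ ^ S) := by ring
      _ ≤ 2 * K * C * (K1 * ν ^ S) := mul_le_mul_of_nonneg_left (hS S) (by positivity)
      _ = _ := by ring
  obtain ⟨F, hF0, hFs⟩ : ∃ F : ℕ → Ω → ℝ, F 0 = V T ∧
      ∀ i, F (i + 1) = fun ω => V (T + i + 1) ω - V (T + i) ω :=
    ⟨fun n => Nat.casesOn n (V T) fun i ω => V (T + i + 1) ω - V (T + i) ω, rfl, fun _ => rfl⟩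
  have hFint : ∀ i, Integrable (F i) ℙ := by
    rintro (_ | i)
    · rw [hF0]; exact hVint T
    · rw [hFs]; exact (hVint _).sub (hVint _)
  have hgeom : HasSum (fun i : ℕ => 2 * K * C * K1 * ν ^ (T + i))
      (2 * K * C * K1 * (1 - ν)⁻¹ * ν ^ T) := by
    have := (hasSum_geometric_of_lt_one hν0.le hν1).mul_left (2 * K * C * K1 * ν ^ T)
    rw [mul_right_comm (2 * K * C * K1) (1 - ν)⁻¹]
    simp only [pow_add, ← mul_assoc]
    exact this
  have hFb : ∀ i, ∫ ω, ‖F (i + 1) ω‖ ∂ℙ ≤ 2 * K * C * K1 * ν ^ (T + i) := by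
    intro i; rw [hFs]; exact hW (T + i)
  have hFsum : Summable fun i => ∫ ω, ‖F i ω‖ ∂ℙ :=
    (summable_nat_add_iff 1).1 (Summable.of_nonneg_of_le
      (fun i => integral_nonneg fun ω => norm_nonneg _) hFb hgeom.summable)
  have hsum := hasSum_integral_of_summable_integral_norm hFint hFsum
  have hae : (fun ω => ∑' i, F i ω) =ᵐ[ℙ] Z := by
    filter_upwards [ae_exists_notMem hρ0 hρ1 hP] with ω hω
    obtain ⟨S, hS⟩ := hω
    have hgood : ∀ n, S ≤ n → Z ω = V n ω := fun n hn => hZ n ω fun h => hS (hBad hn h)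
    have htel : ∀ n, ∑ i ∈ Finset.range (n + 1), F i ω = V (T + n) ω := by
      intro n
      induction n with
      | zero => simp [hF0]
      | succ n ih => rw [Finset.sum_range_succ, ih, hFs]; simp [add_assoc]
    rw [tsum_eq_sum (s := Finset.range (S + 1)), htel, ← hgood _ (Nat.le_add_left _ _)]
    intro i hi
    rw [Finset.mem_range, not_lt] at hi
    obtain ⟨j, rfl⟩ := Nat.exists_eq_add_of_le' hi
    rw [show j + (S + 1) = (j + S) + 1 from rfl, hFs]
    simp only
    rw [← hgood _ (by omega), ← hgood _ (by omega), sub_self]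
  rw [integral_congr_ae hae] at hsum
  have h1 := (hasSum_nat_add_iff' 1).2 hsum
  rw [Finset.sum_range_one, hF0] at h1
  rw [← h1.tsum_eq, ← Real.norm_eq_abs]
  refine tsum_of_norm_bounded hgeom fun i => ?_
  exact (norm_integral_le_integral_norm _).trans (hFb i)

end

/-! ### Covariances of truncated heights -/

section
open MeasureTheory

lemma card_words (k : ℕ) : (words k).card = 4 ^ k := by
  induction k with
  | zero => rfl
  | succ k ih =>
    rw [words, Finset.card_image_of_injective, Finset.card_product, ih, pow_succ']
    · rfl
    · rintro ⟨d, w⟩ ⟨e, u⟩ h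
      simpa using h

lemma comp_eq_sum_indicator {Ω β : Type*} {W : Ω → β} {s : Finset β} (hW : ∀ ω, W ω ∈ s) (g : β → ℝ) :
    (fun ω => g (W ω)) = fun ω => ∑ w ∈ s, {ω | W ω = w}.indicator (fun _ => g w) ω := by
  funext ω
  rw [Finset.sum_eq_single_of_mem (W ω) (hW ω), Set.indicator_of_mem (by rfl)]
  intro w _ hw
  exact Set.indicator_of_notMem (fun h : W ω = w => hw h.symm) _

section finite
variable {Ω β : Type*} [MeasurableSpace Ω] {ℙ : Measure Ω} [IsFiniteMeasure ℙ]
  {W : Ω → β} {s : Finset β}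

lemma measurable_comp_of_finset (hW : ∀ ω, W ω ∈ s)
    (hm : ∀ w ∈ s, MeasurableSet {ω | W ω = w}) (g : β → ℝ) : Measurable fun ω => g (W ω) := by
  rw [comp_eq_sum_indicator hW]
  exact Finset.measurable_fun_sum _ fun w hw => measurable_const.indicator (hm w hw)

lemma integral_comp_of_finset (hW : ∀ ω, W ω ∈ s)
    (hm : ∀ w ∈ s, MeasurableSet {ω | W ω = w}) (g : β → ℝ) :
    ∫ ω, g (W ω) ∂ℙ = ∑ w ∈ s, g w * ℙ.real {ω | W ω = w} := by
  rw [comp_eq_sum_indicator hW, integral_finsetSum _ fun w hw =>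
    (integrable_const _).indicator (hm w hw)]
  refine Finset.sum_congr rfl fun w hw => ?_
  rw [integral_indicator_const _ (hm w hw), smul_eq_mul, mul_comm]

lemma abs_integral_mul_sub_le {W' : Ω → β} (hW : ∀ ω, W ω ∈ s) (hW' : ∀ ω, W' ω ∈ s)
    (hm : ∀ w ∈ s, MeasurableSet {ω | W ω = w}) (hm' : ∀ w ∈ s, MeasurableSet {ω | W' ω = w})
    {g g' : β → ℝ} {B ε : ℝ} (hB : 0 ≤ B) (hg : ∀ w, |g w| ≤ B) (hg' : ∀ w, |g' w| ≤ B)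
    (hε : ∀ w ∈ s, ∀ w' ∈ s, |ℙ.real {ω | W ω = w ∧ W' ω = w'}
      - ℙ.real {ω | W ω = w} * ℙ.real {ω | W' ω = w'}| ≤ ε) :
    |∫ ω, g (W ω) * g' (W' ω) ∂ℙ - (∫ ω, g (W ω) ∂ℙ) * ∫ ω, g' (W' ω) ∂ℙ|
      ≤ (s.card : ℝ) * s.card * (B * B * ε) := by
  have h2 : ∫ ω, g (W ω) * g' (W' ω) ∂ℙ = ∑ p ∈ s ×ˢ s,
      g p.1 * g' p.2 * ℙ.real {ω | W ω = p.1 ∧ W' ω = p.2} := by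
    have := integral_comp_of_finset (ℙ := ℙ) (W := fun ω => (W ω, W' ω)) (s := s ×ˢ s)
      (fun ω => Finset.mem_product.2 ⟨hW ω, hW' ω⟩) (fun p hp => by
        have e : {ω | (W ω, W' ω) = p} = {ω | W ω = p.1} ∩ {ω | W' ω = p.2} := by
          ext ω; exact Prod.ext_iff
        rw [e]
        exact (hm _ (Finset.mem_product.1 hp).1).inter (hm' _ (Finset.mem_product.1 hp).2))
      fun p => g p.1 * g' p.2
    rw [this]
    refine Finset.sum_congr rfl fun p _ => ?_
    simp only [Prod.ext_iff]
  rw [h2, integral_comp_of_finset hW hm, integral_comp_of_finset hW' hm', Finset.sum_mul_sum,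
    ← Finset.sum_product', ← Finset.sum_sub_distrib]
  refine (Finset.abs_sum_le_sum_abs _ _).trans ?_
  refine (Finset.sum_le_card_nsmul _ _ (B * B * ε) fun p hp => ?_).trans (le_of_eq ?_)
  · obtain ⟨h1, h2⟩ := Finset.mem_product.1 hp
    rw [mul_mul_mul_comm, ← mul_sub, abs_mul, abs_mul]
    exact mul_le_mul (mul_le_mul (hg _) (hg' _) (abs_nonneg _) hB) (hε _ h1 _ h2) (abs_nonneg _)
      (by positivity)
  · rw [Finset.card_product, nsmul_eq_mul, Nat.cast_mul]

end finite

/-- The height read off from the first steps of a forest path, ignoring late crossings. -/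
def truncHeight (b : ℤ × ℤ) (l : Bool × Bool → ℤ) (T : ℕ) (w : List (Bool × Bool)) : ℝ :=
  ((-4 * ∑ i ∈ Finset.range T, cross (gam b w) b i + l w.headI : ℤ) : ℝ)

lemma abs_truncHeight_le (b : ℤ × ℤ) {l : Bool × Bool → ℤ} (hl : ∀ d, |l d| ≤ 6) (T : ℕ)
    (w : List (Bool × Bool)) : |truncHeight b l T w| ≤ 6 * ((T : ℝ) + 1) := by
  have h1 := abs_sum_cross_le (gam b w) b T
  have h2 := hl w.headI
  have h3 : |(-4 * ∑ i ∈ Finset.range T, cross (gam b w) b i + l w.headI : ℤ)| ≤ 6 * ((T : ℤ) + 1) := by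
    rw [abs_le] at *
    constructor <;> linarith
  rw [truncHeight]
  exact_mod_cast h3

lemma truncHeight_wd (M : Set ((ℤ × ℤ) × (ℤ × ℤ))) {b : ℤ × ℤ} (l : Bool × Bool → ℤ) {T : ℕ}
    (h : ¬ returnsAfter M b T) :
    truncHeight b l T (wd M b (T + 1)) = ((-4 * windPath (walk M b) b + l (dirOf M b) : ℤ) : ℝ) := by
  simp only [returnsAfter, not_exists, not_and, not_le] at h
  rw [truncHeight, windPath_eq_sum h]
  have h' : ∑ i ∈ Finset.range T, cross (gam b (wd M b (T + 1))) b i =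
      ∑ i ∈ Finset.range T, cross (walk M b) b i := by
    refine Finset.sum_congr rfl fun i hi => ?_
    rw [Finset.mem_range] at hi
    rw [cross, cross, gam_wd M b (by omega), gam_wd M b (by omega), gam_wd M b (by omega)]
  rw [h']
  rfl

lemma returnsAfter_antitone (M : Set ((ℤ × ℤ) × (ℤ × ℤ))) (x : ℤ × ℤ) {S T : ℕ} (h : S ≤ T) :
    returnsAfter M x T → returnsAfter M x S :=
  fun ⟨t, ht, hx⟩ => ⟨t, h.trans ht, hx⟩

lemma setOf_wd_eq {Ω : Type*} {D : Ω → Set ((ℤ × ℤ) × (ℤ × ℤ))} (hD : ∀ ω, IsFullMatching (D ω)) {x : ℤ × ℤ} (hx : WhiteV x) {n : ℕ}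
    {w : List (Bool × Bool)} (hw : w.length = n) :
    {ω | wd (D ω) x n = w} = {ω | follows (D ω) x w} := by
  ext ω
  subst hw
  exact (follows_iff_wd (hD ω) hx w).symm

variable {a : ℝ} {Ω : Type*} [MeasurableSpace Ω] {ℙ : Measure Ω}
    [IsProbabilityMeasure ℙ] {D : Ω → Set ((ℤ × ℤ) × (ℤ × ℤ))}

lemma measurableSet_wd_eq (hD : ∀ ω, IsFullMatching (D ω))
    (hDmeas : ∀ e, MeasurableSet {ω | e ∈ D ω}) {x : ℤ × ℤ} (hx : WhiteV x) {n : ℕ}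
    {w : List (Bool × Bool)} (hw : w ∈ words n) : MeasurableSet {ω | wd (D ω) x n = w} := by
  rw [setOf_wd_eq hD hx (mem_words.1 hw)]
  exact measurableSet_follows hDmeas x w

lemma measurable_truncHeight_wd (hD : ∀ ω, IsFullMatching (D ω))
    (hDmeas : ∀ e, MeasurableSet {ω | e ∈ D ω}) {x : ℤ × ℤ} (hx : WhiteV x)
    (l : Bool × Bool → ℤ) (T n : ℕ) :
    Measurable fun ω => truncHeight x l T (wd (D ω) x n) :=
  measurable_comp_of_finset (fun _ => mem_words.2 (length_wd _ _ _))
    (fun _ hw => measurableSet_wd_eq hD hDmeas hx hw) _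

/-- Forest paths of well separated starting points decorrelate. -/
theorem exists_truncHeight_covariance_bound (ha : a ∈ Set.Ioo (0 : ℝ) 1)
    (hD : ∀ ω, IsFullMatching (D ω)) (hDmeas : ∀ e, MeasurableSet {ω | e ∈ D ω})
    (hlim : ∀ E : Finset ((ℤ × ℤ) × (ℤ × ℤ)),
      Filter.Tendsto (fun m : ℕ => aztecCylProb a (4 * ((m : ℤ) + 1)) E) Filter.atTop
        (nhds ((ℙ {ω | ∀ e ∈ E, e ∈ D ω}).toReal))) :
    ∃ K, 0 ≤ K ∧ ∃ q : ℕ, 4 ≤ q ∧ ∀ x x' : ℤ × ℤ, WhiteV x → northA x → WhiteV x' → northA x' →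
      ∀ l l' : Bool × Bool → ℤ, (∀ d, |l d| ≤ 6) → (∀ d, |l' d| ≤ 6) → ∀ T : ℕ,
      (q : ℤ) * (T + 1) < max |x.1 - x'.1| |x.2 - x'.2| →
      |∫ ω, truncHeight x l T (wd (D ω) x (T + 1)) * truncHeight x' l' T (wd (D ω) x' (T + 1)) ∂ℙ
        - (∫ ω, truncHeight x l T (wd (D ω) x (T + 1)) ∂ℙ)
          * ∫ ω, truncHeight x' l' T (wd (D ω) x' (T + 1)) ∂ℙ| ≤ K * (1 / 2) ^ T := by
  have hk := kap_pos ha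
  have hk' := four_kap_lt ha
  have hR := kerR_pos ha
  obtain ⟨p, hp⟩ := exists_pow_lt_of_lt_one
    (show (0 : ℝ) < 1 / (256 * (kerR a + 1) ^ 2) by positivity) hk'
  rw [lt_div_iff₀ (by positivity)] at hp
  refine ⟨72 * kerR a, by positivity, 2 * p + 4, by omega, ?_⟩
  intro x x' hx hxn hx' hxn' l l' hl hl' T hdist
  have hε : ∀ w ∈ words (T + 1), ∀ w' ∈ words (T + 1),
      |ℙ.real {ω | wd (D ω) x (T + 1) = w ∧ wd (D ω) x' (T + 1) = w'}
        - ℙ.real {ω | wd (D ω) x (T + 1) = w} * ℙ.real {ω | wd (D ω) x' (T + 1) = w'}|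
      ≤ 2 * (T + 1 : ℕ) * (kerR a * (4 * kap a) ^ (p * (T + 1)))
        * (kerR a + 1) ^ ((T + 1) + (T + 1)) := by
    intro w hw w' hw'
    rw [mem_words] at hw hw'
    have e := setOf_wd_eq hD hx hw
    have e' := setOf_wd_eq hD hx' hw'
    have e'' : {ω | wd (D ω) x (T + 1) = w ∧ wd (D ω) x' (T + 1) = w'} =
        {ω | follows (D ω) x w ∧ follows (D ω) x' w'} := by
      rw [Set.ofPred_and, Set.ofPred_and, e, e']
    rw [e, e', e'']
    refine abs_measureReal_follows_sub_le ha hlim hx hxn hx' hxn' (Nat.succ_pos T) ?_ hw hw'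
    refine lt_of_eq_of_lt ?_ hdist
    push_cast
    ring
  refine (abs_integral_mul_sub_le (fun ω => mem_words.2 (length_wd _ _ _))
    (fun ω => mem_words.2 (length_wd _ _ _)) (fun w hw => measurableSet_wd_eq hD hDmeas hx hw)
    (fun w hw => measurableSet_wd_eq hD hDmeas hx' hw) (by positivity)
    (abs_truncHeight_le x hl T) (abs_truncHeight_le x' hl' T) hε).trans ?_
  rw [card_words]
  have hn3 : ((T : ℝ) + 1) ^ 3 ≤ 8 ^ (T + 1) := by
    have h : ((T + 1 : ℕ) : ℝ) ≤ 2 ^ (T + 1) := by exact_mod_cast Nat.lt_two_pow_self.le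
    push_cast at h
    calc ((T : ℝ) + 1) ^ 3 ≤ (2 ^ (T + 1)) ^ 3 := by gcongr
      _ = (2 ^ 3) ^ (T + 1) := by rw [← pow_mul, ← pow_mul, mul_comm]
      _ = 8 ^ (T + 1) := by norm_num
  have hX : 128 * (kerR a + 1) ^ 2 * (4 * kap a) ^ p ≤ 1 / 2 := by linarith
  calc ((4 ^ (T + 1) : ℕ) : ℝ) * (4 ^ (T + 1) : ℕ) * (6 * ((T : ℝ) + 1) * (6 * ((T : ℝ) + 1)) *
        (2 * (T + 1 : ℕ) * (kerR a * (4 * kap a) ^ (p * (T + 1)))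
        * (kerR a + 1) ^ ((T + 1) + (T + 1))))
      = 72 * kerR a * (((T : ℝ) + 1) ^ 3 *
          (16 * (kerR a + 1) ^ 2 * (4 * kap a) ^ p) ^ (T + 1)) := by
        have h16 : (16 : ℝ) ^ (T + 1) = 4 ^ (T + 1) * 4 ^ (T + 1) := by rw [← mul_pow]; norm_num
        rw [pow_mul (4 * kap a), mul_pow _ ((4 * kap a) ^ p), mul_pow 16, h16, pow_right_comm (kerR a + 1) 2,
          sq ((kerR a + 1) ^ (T + 1)), pow_add (kerR a + 1)]
        push_cast
        generalize ((4 * kap a) ^ p) ^ (T + 1) = Q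
        generalize (kerR a + 1) ^ (T + 1) = S
        ring
    _ ≤ 72 * kerR a * (8 ^ (T + 1) * (16 * (kerR a + 1) ^ 2 * (4 * kap a) ^ p) ^ (T + 1)) := by
        gcongr
    _ = 72 * kerR a * (128 * (kerR a + 1) ^ 2 * (4 * kap a) ^ p) ^ (T + 1) := by
        rw [← mul_pow]; congr 2; ring
    _ ≤ 72 * kerR a * (1 / 2) ^ (T + 1) := by gcongr
    _ ≤ 72 * kerR a * (1 / 2) ^ T :=
        mul_le_mul_of_nonneg_left
          (pow_le_pow_of_le_one (by norm_num) (by norm_num) (Nat.le_succ T)) (by positivity)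

end

/-! ### Covariances of heights -/

lemma exists_exp_bound {K μ : ℝ} (hK : 0 ≤ K) (hμ0 : 0 < μ) (hμ1 : μ < 1) {q : ℕ} (hq : 0 < q) :
    ∃ d > (0 : ℝ), ∀ N : ℕ, K * μ ^ (N / q) ≤ K / μ * Real.exp (-d * N) := by
  have hlog := Real.log_neg hμ0 hμ1
  have hq' : (0 : ℝ) < q := by exact_mod_cast hq
  refine ⟨-Real.log μ / q, div_pos (by linarith) hq', fun N => ?_⟩
  have h1 : (N : ℝ) / q ≤ (N / q : ℕ) + 1 := by
    rw [div_le_iff₀ hq']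
    have : N < q * (N / q + 1) := Nat.lt_mul_div_succ N hq
    have h2 : (N : ℝ) < q * ((N / q : ℕ) + 1) := by exact_mod_cast this
    linarith
  have h3 : μ ^ (N / q + 1) ≤ Real.exp (-(-Real.log μ / q) * N) := by
    rw [← Real.exp_log (pow_pos hμ0 _), Real.exp_le_exp, Real.log_pow]
    push_cast
    have := mul_le_mul_of_nonpos_right h1 hlog.le
    calc _ ≤ (N : ℝ) / q * Real.log μ := this
      _ = _ := by ring
  calc K * μ ^ (N / q) = K / μ * μ ^ (N / q + 1) := by rw [pow_succ]; field_simp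
    _ ≤ _ := mul_le_mul_of_nonneg_left h3 (by positivity)

section
open MeasureTheory
variable {a : ℝ} {Ω : Type*} [MeasurableSpace Ω] {ℙ : Measure Ω}
    [IsProbabilityMeasure ℙ] {D : Ω → Set ((ℤ × ℤ) × (ℤ × ℤ))}

theorem exists_covariance_bound {C ρ : ℝ} (ha : a ∈ Set.Ioo (0 : ℝ) 1) (hC : 1 ≤ C) (hρ0 : 0 < ρ)
    (hρ1 : ρ < 1) (hD : ∀ ω, IsFullMatching (D ω)) (hDmeas : ∀ e, MeasurableSet {ω | e ∈ D ω})
    (hlim : ∀ E : Finset ((ℤ × ℤ) × (ℤ × ℤ)),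
      Filter.Tendsto (fun m : ℕ => aztecCylProb a (4 * ((m : ℤ) + 1)) E) Filter.atTop
        (nhds ((ℙ {ω | ∀ e ∈ E, e ∈ D ω}).toReal)))
    (hret : ∀ x, WhiteV x → northA x → ∀ T, ℙ.real {ω | returnsAfter (D ω) x T} ≤ C * ρ ^ T)
    {H : Ω → ℤ × ℤ → ℤ} (hH : ∀ ω, IsFullHeight (D ω) (H ω))
    (hanchor : ∀ ω, AnchoredAtInfinity (D ω) (H ω)) :
    ∃ c, 0 ≤ c ∧ ∃ d > (0 : ℝ), ∀ f f' : ℤ × ℤ, Even (f.1 + f.2) → Even (f'.1 + f'.2) →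
      (∫ ω, (H ω f : ℝ) * (H ω f' : ℝ) ∂ℙ)
          - (∫ ω, (H ω f : ℝ) ∂ℙ) * (∫ ω, (H ω f' : ℝ) ∂ℙ)
        ≤ c * Real.exp (-d * ((max |f.1 - f'.1| |f.2 - f'.2| : ℤ) : ℝ)) := by
  obtain ⟨ν, hν0, hν1, K, hK, htr⟩ := exists_truncation_bound (ℙ := ℙ) (C := 2 * C) (K := 36)
    (by linarith) (by norm_num) hρ0 hρ1
  obtain ⟨K', hK', q, hq, hcov⟩ := exists_truncHeight_covariance_bound ha hD hDmeas hlim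
  set μ := max ν (1 / 2) with hμ
  have hμ0 : 0 < μ := lt_max_of_lt_left hν0
  have hμ1 : μ < 1 := max_lt hν1 (by norm_num)
  set M := 36 + 2 * K with hM
  have hM0 : 0 ≤ M := by positivity
  set K3 := K + K' + 2 * M * K + (M + M * M) with hK3
  have hK30 : 0 ≤ K3 := by positivity
  have hK4 : K3 ≤ K3 / μ := le_div_self hK30 hμ0 hμ1.le
  obtain ⟨d, hd, hexp⟩ := exists_exp_bound (K := K3 / μ) (by positivity) hμ0 hμ1
    (show 0 < 2 * q by omega)
  refine ⟨K3 / μ / μ, by positivity, d, hd, fun f f' hf hf' => ?_⟩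
  obtain ⟨b, hb, hbn, hb1, hb2, l, hl, hval⟩ := exists_height_eq f hf
  obtain ⟨b', hb', hbn', hb1', hb2', l', hl', hval'⟩ := exists_height_eq f' hf'
  obtain ⟨V, hV⟩ : ∃ V : ℕ → Ω → ℝ, V = fun T ω => truncHeight b l T (wd (D ω) b (T + 1)) :=
    ⟨_, rfl⟩
  obtain ⟨V', hV'⟩ : ∃ V : ℕ → Ω → ℝ, V = fun T ω => truncHeight b' l' T (wd (D ω) b' (T + 1)) :=
    ⟨_, rfl⟩
  have hmeas : ∀ T, Measurable (V T) := fun T => by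
    rw [hV]; exact measurable_truncHeight_wd hD hDmeas hb l T (T + 1)
  have hmeas' : ∀ T, Measurable (V' T) := fun T => by
    rw [hV']; exact measurable_truncHeight_wd hD hDmeas hb' l' T (T + 1)
  have hVb : ∀ T ω, |V T ω| ≤ 6 * ((T : ℝ) + 1) := fun T ω => by
    rw [hV]; exact abs_truncHeight_le b hl T _
  have hVb' : ∀ T ω, |V' T ω| ≤ 6 * ((T : ℝ) + 1) := fun T ω => by
    rw [hV']; exact abs_truncHeight_le b' hl' T _
  have hgood : ∀ T ω, ¬ returnsAfter (D ω) b T → (H ω f : ℝ) = V T ω := fun T ω h => by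
    rw [hV]
    simp only
    rw [truncHeight_wd _ _ h, hval _ _ (hD ω) (hH ω) (hanchor ω)]
  have hgood' : ∀ T ω, ¬ returnsAfter (D ω) b' T → (H ω f' : ℝ) = V' T ω := fun T ω h => by
    rw [hV']
    simp only
    rw [truncHeight_wd _ _ h, hval' _ _ (hD ω) (hH ω) (hanchor ω)]
  have hsq : ∀ T : ℕ, 6 * ((T : ℝ) + 1) ≤ 36 * ((T : ℝ) + 1) ^ 2 := fun T => by
    have : (0 : ℝ) ≤ T := T.cast_nonneg
    nlinarith
  have hCρ : ∀ T : ℕ, C * ρ ^ T ≤ 2 * C * ρ ^ T := fun T =>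
    mul_le_mul_of_nonneg_right (by linarith) (by positivity)
  have htX := htr (fun ω => (H ω f : ℝ)) V (fun T => {ω | returnsAfter (D ω) b T}) hmeas
    (fun S T hST ω hω => returnsAfter_antitone _ _ hST hω)
    (fun T => (hret b hb hbn T).trans (hCρ T)) (fun T ω => (hVb T ω).trans (hsq T)) hgood
  have htX' := htr (fun ω => (H ω f' : ℝ)) V' (fun T => {ω | returnsAfter (D ω) b' T}) hmeas'
    (fun S T hST ω hω => returnsAfter_antitone _ _ hST hω)
    (fun T => (hret b' hb' hbn' T).trans (hCρ T)) (fun T ω => (hVb' T ω).trans (hsq T)) hgood'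
  have htXX := htr (fun ω => (H ω f : ℝ) * (H ω f' : ℝ)) (fun T ω => V T ω * V' T ω)
    (fun T => {ω | returnsAfter (D ω) b T} ∪ {ω | returnsAfter (D ω) b' T})
    (fun T => (hmeas T).mul (hmeas' T))
    (fun S T hST => Set.union_subset_union (fun ω hω => returnsAfter_antitone _ _ hST hω)
      (fun ω hω => returnsAfter_antitone _ _ hST hω))
    (fun T => (measureReal_union_le _ _).trans (by linarith [hret b hb hbn T, hret b' hb' hbn' T]))
    (fun T ω => by
      rw [abs_mul]
      refine (mul_le_mul (hVb T ω) (hVb' T ω) (abs_nonneg _) (by positivity)).trans (le_of_eq ?_)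
      ring)
    (fun T ω h => by
      rw [Set.mem_union, not_or] at h
      rw [hgood T ω h.1, hgood' T ω h.2])
  have hcovT : ∀ T : ℕ, (q : ℤ) * (T + 1) < max |b.1 - b'.1| |b.2 - b'.2| →
      |∫ ω, V T ω * V' T ω ∂ℙ - (∫ ω, V T ω ∂ℙ) * ∫ ω, V' T ω ∂ℙ| ≤ K' * (1 / 2) ^ T := by
    rw [hV, hV']
    exact fun T => hcov b b' hb hbn hb' hbn' l l' hl hl' T
  have h0 : ∀ U : Ω → ℝ, (∀ ω, |U ω| ≤ 36) → |∫ ω, U ω ∂ℙ| ≤ 36 := fun U hU => by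
    have := norm_integral_le_of_norm_le_const (μ := ℙ) (f := U) (C := 36) (Filter.Eventually.of_forall hU)
    simpa using this
  have hVV0 := h0 (fun ω => V 0 ω * V' 0 ω) fun ω => by
    have h1 := hVb 0 ω
    have h2 := hVb' 0 ω
    rw [Nat.cast_zero, zero_add, mul_one] at h1 h2
    rw [abs_mul]
    exact (mul_le_mul h1 h2 (abs_nonneg _) (by norm_num)).trans (by norm_num)
  have hV0 := h0 (V 0) fun ω => (hVb 0 ω).trans (by norm_num)
  have hV0' := h0 (V' 0) fun ω => (hVb' 0 ω).trans (by norm_num)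
  have hX0 := htX 0
  have hX0' := htX' 0
  have hXX0 := htXX 0
  rw [pow_zero, mul_one] at hX0 hX0' hXX0
  generalize ∫ ω, (H ω f : ℝ) * (H ω f' : ℝ) ∂ℙ = EXX at *
  generalize ∫ ω, (H ω f : ℝ) ∂ℙ = EX at *
  generalize ∫ ω, (H ω f' : ℝ) ∂ℙ = EX' at *
  have hEXX : |EXX| ≤ M := by
    have := abs_sub_abs_le_abs_sub EXX (∫ ω, V 0 ω * V' 0 ω ∂ℙ)
    linarith
  have hEX : |EX| ≤ 36 + K := by
    have := abs_sub_abs_le_abs_sub EX (∫ ω, V 0 ω ∂ℙ)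
    linarith
  have hEX' : |EX'| ≤ 36 + K := by
    have := abs_sub_abs_le_abs_sub EX' (∫ ω, V' 0 ω ∂ℙ)
    linarith
  have hEXM : |EX| ≤ M := by linarith
  have hEXM' : |EX'| ≤ M := by linarith
  have htriv : EXX - EX * EX' ≤ K3 := by
    have h1 : |EX * EX'| ≤ M * M := by
      rw [abs_mul]; exact mul_le_mul hEXM hEXM' (abs_nonneg _) hM0
    have h2 := (abs_le.1 hEXX).2
    have h3 := (abs_le.1 h1).1
    have h4 : 0 ≤ K + K' + 2 * M * K := by positivity
    linarith
  have hmain : ∀ T : ℕ, (q : ℤ) * (T + 1) < max |b.1 - b'.1| |b.2 - b'.2| →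
      EXX - EX * EX' ≤ K3 * μ ^ T := by
    intro T hT
    have h1 := hcovT T hT
    have h2 := htX T
    have h3 := htX' T
    have h4 := htXX T
    generalize ∫ ω, V T ω * V' T ω ∂ℙ = EVV at *
    generalize ∫ ω, V T ω ∂ℙ = EV at *
    generalize ∫ ω, V' T ω ∂ℙ = EV' at *
    have hν : ν ^ T ≤ μ ^ T := pow_le_pow_left₀ hν0.le (le_max_left _ _) T
    have hhalf : (1 / 2 : ℝ) ^ T ≤ μ ^ T := pow_le_pow_left₀ (by norm_num) (le_max_right _ _) T
    have hν1' : ν ^ T ≤ 1 := pow_le_one₀ hν0.le hν1.le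
    have hEV : |EV| ≤ M := by
      have h5 := abs_sub_abs_le_abs_sub EV EX
      rw [abs_sub_comm] at h5
      have : K * ν ^ T ≤ K := mul_le_of_le_one_right hK hν1'
      linarith
    have h5 : |EV * EV' - EX * EX'| ≤ 2 * M * (K * ν ^ T) := by
      have e : EV * EV' - EX * EX' = -(EV * (EX' - EV')) - (EX - EV) * EX' := by ring
      rw [e]
      refine (abs_sub _ _).trans ?_
      rw [abs_neg, abs_mul, abs_mul]
      have h6 := mul_le_mul hEV h3 (abs_nonneg _) hM0
      have h7 := mul_le_mul h2 hEXM' (abs_nonneg _) (by positivity)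
      linarith
    have h6 := (abs_le.1 h1).2
    have h7 := (abs_le.1 h4).2
    have h8 := (abs_le.1 h5).2
    have h9 : K * ν ^ T ≤ K * μ ^ T := mul_le_mul_of_nonneg_left hν hK
    have h10 : K' * (1 / 2) ^ T ≤ K' * μ ^ T := mul_le_mul_of_nonneg_left hhalf hK'
    have h11 : 2 * M * (K * ν ^ T) ≤ 2 * M * (K * μ ^ T) :=
      mul_le_mul_of_nonneg_left h9 (by positivity)
    have h12 : 0 ≤ (M + M * M) * μ ^ T := by positivity
    rw [hK3, add_mul, add_mul, add_mul, mul_assoc (2 * M)]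
    linarith
  obtain ⟨N, hN⟩ := Int.eq_ofNat_of_zero_le
    (show 0 ≤ max |f.1 - f'.1| |f.2 - f'.2| from le_max_of_le_left (abs_nonneg _))
  rw [hN, Int.cast_natCast]
  refine le_trans ?_ (hexp N)
  rcases Nat.eq_zero_or_pos (N / (2 * q)) with hz | hpos
  · rw [hz, pow_zero, mul_one]
    exact htriv.trans hK4
  · obtain ⟨T, hT⟩ := Nat.exists_eq_add_of_le' hpos
    have hdist : (q : ℤ) * (T + 1) < max |b.1 - b'.1| |b.2 - b'.2| := by
      have h1 : 2 * q * (T + 1) ≤ N := by rw [← hT]; exact Nat.mul_div_le N (2 * q)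
      have h2 : 4 * (T + 1) ≤ q * (T + 1) := Nat.mul_le_mul_right _ hq
      have h3 : 2 * ((q : ℤ) * (T + 1)) ≤ N := by rw [← mul_assoc]; exact_mod_cast h1
      have h4 : 4 * ((T : ℤ) + 1) ≤ (q : ℤ) * (T + 1) := by exact_mod_cast h2
      have h5 : (N : ℤ) ≤ max |b.1 - b'.1| |b.2 - b'.2| + 2 := by
        rw [← hN]
        refine max_le ?_ ?_
        · refine le_trans ?_ (add_le_add_left (le_max_left _ _) 2)
          rw [abs_le] at hb1 hb1'
          rw [← sub_le_iff_le_add]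
          rw [le_abs']
          rcases abs_cases (f.1 - f'.1) with h | h <;> omega
        · refine le_trans ?_ (add_le_add_left (le_max_right _ _) 2)
          rw [abs_le] at hb2 hb2'
          rw [← sub_le_iff_le_add]
          rw [le_abs']
          rcases abs_cases (f.2 - f'.2) with h | h <;> omega
      have h6 : (0 : ℤ) ≤ T := T.cast_nonneg
      linarith
    rw [hT, pow_succ']
    refine (hmain T hdist).trans (le_of_eq ?_)
    field_simp

end

open MeasureTheory in
theorem stmt12 (a : ℝ) (ha : a ∈ Set.Ioo (0 : ℝ) 1)
    {Ω : Type*} [MeasurableSpace Ω] (ℙ : Measure Ω) [IsProbabilityMeasure ℙ]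
    (D : Ω → Set ((ℤ × ℤ) × (ℤ × ℤ))) (hD : ∀ ω, IsFullMatching (D ω))
    (hDmeas : ∀ e, MeasurableSet {ω | e ∈ D ω})
    -- `D` is distributed as the full-plane smooth phase `P_a`: its cylinder
    -- probabilities are the local limits of the two-periodic Aztec diamond measures
    (hlim : ∀ E : Finset ((ℤ × ℤ) × (ℤ × ℤ)),
      Filter.Tendsto (fun m : ℕ => aztecCylProb a (4 * ((m : ℤ) + 1)) E) Filter.atTop
        (nhds ((ℙ {ω | ∀ e ∈ E, e ∈ D ω}).toReal)))
    (H : Ω → ℤ × ℤ → ℤ)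
    (hH : ∀ ω, IsFullHeight (D ω) (H ω))
    (hanchor : ∀ ω, AnchoredAtInfinity (D ω) (H ω)) :
    ∃ c > (0 : ℝ), ∃ d > (0 : ℝ),
      (∀ f : ℤ × ℤ, Even (f.1 + f.2) → ∀ m : ℝ, 0 < m →
        ℙ {ω | m < |(H ω f : ℝ)|} ≤ ENNReal.ofReal (2 * Real.exp (-d * m ^ 2))) ∧
      (∀ f f' : ℤ × ℤ, Even (f.1 + f.2) → Even (f'.1 + f'.2) →
        (∫ ω, (H ω f : ℝ) * (H ω f' : ℝ) ∂ℙ)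
            - (∫ ω, (H ω f : ℝ) ∂ℙ) * (∫ ω, (H ω f' : ℝ) ∂ℙ)
          ≤ c * Real.exp (-d * ((max |f.1 - f'.1| |f.2 - f'.2| : ℤ) : ℝ))) := by
  obtain ⟨C, ρ, hC, hρ0, hρ1, hret⟩ := exists_returnsAfter_bound ha hD hlim
  obtain ⟨d₁, hd₁, htail⟩ := exists_gaussian_tail hC hρ0 hρ1 hD hret hH hanchor
  obtain ⟨c, hc, d₂, hd₂, hcov⟩ :=
    exists_covariance_bound ha hC hρ0 hρ1 hD hDmeas hlim hret hH hanchor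
  refine ⟨c + 1, by positivity, min d₁ d₂, lt_min hd₁ hd₂, fun f hf m hm => ?_,
    fun f f' hf hf' => (hcov f f' hf hf').trans ?_⟩
  · rw [← ENNReal.ofReal_toReal (measure_ne_top ℙ _)]
    refine ENNReal.ofReal_le_ofReal ((htail f hf m hm).trans ?_)
    gcongr
    exact min_le_left _ _
  · have hdist : (0 : ℝ) ≤ ((max |f.1 - f'.1| |f.2 - f'.2| : ℤ) : ℝ) := by
      exact_mod_cast le_max_of_le_left (abs_nonneg _)
    gcongr
    · exact le_add_of_nonneg_right zero_le_one
    · exact min_le_right _ _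

end
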